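/- arXiv:1710.06535 — 2 statements merged into one kernel-verified Lean document; each statement's English description precedes it below -/
import Mathlib

section
/- Every connected graph G on n vertices with chromatic number exactly 5 has at most 5!·4^{n-5} proper colourings with 5 colours, where a colouring uses labelled colours (so permuting colours gives different colourings). -/
/-- The number of proper colourings of `G` with `x` (labelled) colours. -/
noncomputable def numColorings {V : Type} (G : SimpleGraph V) (x : ℕ) : ℕ :=
  Nat.card {f : V → Fin x // ∀ u v : V, G.Adj u v → f u ≠ f v}

section Structure

open Finset

/-- The proper colourings of a finite graph with colour set `Fin 5`. -/
noncomputable def properFive {V : Type} [Fintype V] (G : SimpleGraph V) : Finset (V → Fin 5) := by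
  classical exact univ.filter fun f => ∀ u v, G.Adj u v → f u ≠ f v

lemma mem_properFive {V : Type} [Fintype V] {G : SimpleGraph V} {f : V → Fin 5} :
    f ∈ properFive G ↔ ∀ u v, G.Adj u v → f u ≠ f v := by
  classical simp [properFive]

/-- The subgraph induced on `S` has a proper colouring with four colours. -/
def FourColorableOn {V : Type} (G : SimpleGraph V) (S : Set V) : Prop :=
  ∃ f : V → Fin 4, ∀ u ∈ S, ∀ v ∈ S, G.Adj u v → f u ≠ f v

lemma fourColorableOn_univ {V : Type} {G : SimpleGraph V} :
    FourColorableOn G Set.univ ↔ G.Colorable 4 := by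
  constructor
  · rintro ⟨f, hf⟩
    exact ⟨SimpleGraph.Coloring.mk f fun {u v} h => hf u trivial v trivial h⟩
  · rintro ⟨C⟩
    exact ⟨C, fun u _ v _ h => C.valid h⟩

lemma fourColorableOn_of_induce {V : Type} {G : SimpleGraph V} {S : Set V}
    (h : (G.induce S).Colorable 4) : FourColorableOn G S := by
  classical
  obtain ⟨C⟩ := h
  refine ⟨fun x => if hx : x ∈ S then C ⟨x, hx⟩ else 0, fun u hu v hv huv => ?_⟩
  simp only [hu, hv, dif_pos]
  exact C.valid (by simpa using huv)

/-- Colourings of two parts that share at most one vertex can be glued. -/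
lemma FourColorableOn.glue {V : Type} {G : SimpleGraph V} {A B : Set V} {p : V}
    (hA : FourColorableOn G (insert p A)) (hB : FourColorableOn G (insert p B))
    (hAB : ∀ a ∈ A, ∀ b ∈ B, ¬ G.Adj a b) :
    FourColorableOn G (insert p (A ∪ B)) := by
  classical
  obtain ⟨f, hf⟩ := hA
  obtain ⟨g, hg⟩ := hB
  have hp : ∀ x, Equiv.swap (g p) (f p) (g x) = f p ↔ g x = g p := by
    intro x
    have := (Equiv.swap (g p) (f p)).injective.eq_iff (a := g x) (b := g p)
    rwa [Equiv.swap_apply_left] at this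
  refine ⟨fun x => if x ∈ insert p A then f x else Equiv.swap (g p) (f p) (g x), ?_⟩
  have key : ∀ x ∈ insert p (A ∪ B), x ∉ insert p A → x ∈ B := by
    intro x hx hxA
    simp only [Set.mem_insert_iff, Set.mem_union] at hx hxA
    tauto
  intro u hu v hv huv
  by_cases h1 : u ∈ insert p A <;> by_cases h2 : v ∈ insert p A <;>
    simp only [h1, h2, if_true, if_false]
  · exact hf u h1 v h2 huv
  · have hvB := key v hv h2
    rcases h1 with rfl | h1
    · intro h
      exact hg v (Or.inr hvB) u (Or.inl rfl) huv.symm ((hp v).1 h.symm)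
    · exact (hAB u h1 v hvB huv).elim
  · have huB := key u hu h1
    rcases h2 with rfl | h2
    · intro h
      exact hg u (Or.inr huB) v (Or.inl rfl) huv ((hp u).1 h)
    · exact (hAB v h2 u huB huv.symm).elim
  · intro h
    exact hg u (Or.inr (key u hu h1)) v (Or.inr (key v hv h2)) huv
      ((Equiv.swap (g p) (f p)).injective h)

lemma FourColorableOn.union {V : Type} {G : SimpleGraph V} {A B : Set V}
    (hA : FourColorableOn G A) (hB : FourColorableOn G B)
    (hAB : ∀ a ∈ A, ∀ b ∈ B, ¬ G.Adj a b) :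
    FourColorableOn G (A ∪ B) := by
  classical
  obtain ⟨f, hf⟩ := hA
  obtain ⟨g, hg⟩ := hB
  refine ⟨fun x => if x ∈ A then f x else g x, fun u hu v hv huv => ?_⟩
  by_cases h1 : u ∈ A <;> by_cases h2 : v ∈ A <;> simp only [h1, h2, if_true, if_false]
  · exact hf u h1 v h2 huv
  · exact (hAB u h1 v (hv.resolve_left h2) huv).elim
  · exact (hAB v h2 u (hu.resolve_left h1) huv.symm).elim
  · exact hg u (hu.resolve_left h1) v (hv.resolve_left h2) huv

lemma induce_connected_of_forall_split {V : Type} {G : SimpleGraph V} {S : Set V}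
    (hS : S.Nonempty)
    (h : ∀ A B : Set V, A ∪ B = S → Disjoint A B → A.Nonempty → B.Nonempty →
      ∃ a ∈ A, ∃ b ∈ B, G.Adj a b) : (G.induce S).Connected := by
  obtain ⟨x, hx⟩ := hS
  have : Nonempty S := ⟨⟨x, hx⟩⟩
  rw [SimpleGraph.connected_iff_exists_forall_reachable]
  refine ⟨⟨x, hx⟩, ?_⟩
  by_contra hcon
  push Not at hcon
  obtain ⟨⟨y, hy⟩, hxy⟩ := hcon
  obtain ⟨a, ⟨haS, ha⟩, b, ⟨hbS, hb⟩, hab⟩ := h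
    {z | ∃ hz : z ∈ S, (G.induce S).Reachable ⟨x, hx⟩ ⟨z, hz⟩}
    {z | ∃ hz : z ∈ S, ¬ (G.induce S).Reachable ⟨x, hx⟩ ⟨z, hz⟩}
    (by ext z; simp only [Set.mem_union, Set.mem_ofPred_eq]
        constructor
        · rintro (⟨h, -⟩ | ⟨h, -⟩) <;> exact h
        · intro hz
          by_cases hr : (G.induce S).Reachable ⟨x, hx⟩ ⟨z, hz⟩
          · exact Or.inl ⟨hz, hr⟩
          · exact Or.inr ⟨hz, hr⟩)
    (by rw [Set.disjoint_left]; rintro z ⟨_, h1⟩ ⟨_, h2⟩; exact h2 h1)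
    ⟨x, hx, SimpleGraph.Reachable.refl _⟩ ⟨y, hy, hxy⟩
  exact hb (ha.trans (SimpleGraph.Adj.reachable (by simpa using hab)))

/-- A set all of whose proper subsets are four-colourable, but which is not, induces a connected
graph. -/
lemma induce_connected_of_minimal {V : Type} {G : SimpleGraph V} {S : Set V}
    (hS : ¬ FourColorableOn G S) (hmin : ∀ T, T ⊂ S → FourColorableOn G T) :
    (G.induce S).Connected := by
  apply induce_connected_of_forall_split
  · rw [Set.nonempty_iff_ne_empty]
    rintro rfl
    exact hS ⟨fun _ => 0, fun u hu => hu.elim⟩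
  · intro A B hAB hd hA hB
    by_contra hcon
    push Not at hcon
    have hBA : ¬ B ⊆ A := fun h => hB.ne_empty (hd.symm.eq_bot_of_le h)
    have hAB' : ¬ A ⊆ B := fun h => hA.ne_empty (hd.eq_bot_of_le h)
    refine hS (hAB ▸ FourColorableOn.union (hmin A ?_) (hmin B ?_) hcon)
    · rw [← hAB]; exact Set.ssubset_union_left_iff.2 hBA
    · rw [← hAB]; exact Set.ssubset_union_right_iff.2 hAB'

/-- Deleting a vertex of a vertex-critical graph leaves a connected graph. -/
lemma induce_compl_connected_of_critical {V : Type} {G : SimpleGraph V}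
    (hG : ¬ FourColorableOn G Set.univ) (hmin : ∀ T, T ⊂ Set.univ → FourColorableOn G T)
    {p q : V} (hqp : q ≠ p) : (G.induce {p}ᶜ).Connected := by
  apply induce_connected_of_forall_split ⟨q, hqp⟩
  intro A B hAB hd hA hB
  by_contra hcon
  push Not at hcon
  obtain ⟨a, ha⟩ := hA
  obtain ⟨b, hb⟩ := hB
  have hap : a ≠ p := by
    have : a ∈ ({p}ᶜ : Set V) := hAB ▸ Or.inl ha
    simpa using this
  have hbp : b ≠ p := by
    have : b ∈ ({p}ᶜ : Set V) := hAB ▸ Or.inr hb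
    simpa using this
  have h1 : FourColorableOn G (insert p A) := by
    refine hmin _ ((Set.ssubset_univ_iff).2 fun h => ?_)
    have : b ∈ insert p A := h ▸ trivial
    exact this.elim hbp fun h => Set.disjoint_left.1 hd h hb
  have h2 : FourColorableOn G (insert p B) := by
    refine hmin _ ((Set.ssubset_univ_iff).2 fun h => ?_)
    have : a ∈ insert p B := h ▸ trivial
    exact this.elim hap fun h => Set.disjoint_left.1 hd ha h
  have h3 := h1.glue h2 hcon
  rw [hAB] at h3
  refine hG ?_
  convert h3
  ext x
  simp [em]

/-- In a vertex-critical graph every four-colouring of `G - p` uses all colours around `p`. -/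
lemma four_le_card_image_of_critical {V : Type} [Fintype V] [DecidableEq V] {G : SimpleGraph V}
    [DecidableRel G.Adj]
    (hG : ¬ FourColorableOn G Set.univ) (p : V) {f : V → Fin 4}
    (hf : ∀ u, u ≠ p → ∀ v, v ≠ p → G.Adj u v → f u ≠ f v) :
    4 ≤ #((G.neighborFinset p).image f) := by
  by_contra hcon
  have : #((G.neighborFinset p).image f) < #(univ : Finset (Fin 4)) := by
    simp only [card_univ, Fintype.card_fin]; omega
  obtain ⟨i, -, hi⟩ := exists_mem_notMem_of_card_lt_card this
  have hi' : ∀ x, G.Adj p x → f x ≠ i := fun x hx h =>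
    hi (mem_image.2 ⟨x, by simpa using hx, h⟩)
  refine hG ⟨Function.update f p i, fun u _ v _ huv => ?_⟩
  by_cases hu : u = p <;> by_cases hv : v = p
  · subst hu hv; exact (huv.ne rfl).elim
  · subst hu; simpa [Function.update_of_ne hv] using (hi' v huv).symm
  · subst hv; simpa [Function.update_of_ne hu] using hi' u huv.symm
  · simpa [Function.update_of_ne hu, Function.update_of_ne hv] using hf u hu v hv huv

/-- The maps that properly colour `S` and vanish outside `S`. -/
noncomputable def properFiveOn {V : Type} [Fintype V] (G : SimpleGraph V) (S : Finset V) :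
    Finset (V → Fin 5) := by
  classical exact univ.filter fun f =>
    (∀ u ∈ S, ∀ v ∈ S, G.Adj u v → f u ≠ f v) ∧ ∀ u ∉ S, f u = 0

lemma mem_properFiveOn {V : Type} [Fintype V] {G : SimpleGraph V} {S : Finset V}
    {f : V → Fin 5} : f ∈ properFiveOn G S ↔
      (∀ u ∈ S, ∀ v ∈ S, G.Adj u v → f u ≠ f v) ∧ ∀ u ∉ S, f u = 0 := by
  classical simp [properFiveOn]

lemma card_properFiveOn_insert_le {V : Type} [Fintype V] [DecidableEq V] {G : SimpleGraph V}
    {S : Finset V} {x y : V} (hx : x ∉ S) (hy : y ∈ S) (hxy : G.Adj x y) :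
    #(properFiveOn G (insert x S)) ≤ 4 * #(properFiveOn G S) := by
  have hyx : y ≠ x := hxy.ne.symm
  refine (card_le_mul_card_image_of_maps_to (f := fun f => Function.update f x 0)
    (t := properFiveOn G S) ?_ 4 ?_)
  · intro f hf
    rw [mem_properFiveOn] at hf ⊢
    constructor
    · intro u hu v hv huv
      have hu' : u ≠ x := by rintro rfl; exact hx hu
      have hv' : v ≠ x := by rintro rfl; exact hx hv
      simp only [Function.update_of_ne hu', Function.update_of_ne hv']
      exact hf.1 u (mem_insert_of_mem hu) v (mem_insert_of_mem hv) huv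
    · intro u hu
      by_cases hux : u = x
      · subst hux; simp
      · simp only [Function.update_of_ne hux]
        exact hf.2 u (by simp [hu, hux])
  · intro g hg
    have h4 : #((univ : Finset (Fin 5)).erase (g y)) = 4 := by simp
    refine le_trans ?_ h4.le
    apply card_le_card_of_injOn (fun f => f x)
    · intro f hf
      simp only [coe_filter, Set.mem_ofPred_eq, mem_properFiveOn] at hf
      obtain ⟨⟨hf1, hf2⟩, rfl⟩ := hf
      simpa [Function.update_of_ne hyx] using
        hf1 x (mem_insert_self _ _) y (mem_insert_of_mem hy) hxy
    · intro f hf f' hf' h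
      simp only [coe_filter, Set.mem_ofPred_eq] at hf hf'
      funext z
      by_cases hz : z = x
      · subst hz; exact h
      · have := congrFun (hf.2.trans hf'.2.symm) z
        simpa [Function.update_of_ne hz] using this

lemma card_properFiveOn_univ_le {V : Type} [Fintype V] [DecidableEq V] {G : SimpleGraph V}
    (hG : G.Connected) (k : ℕ) : ∀ S : Finset V, S.Nonempty → #S + k = Fintype.card V →
      #(properFiveOn G univ) ≤ 4 ^ k * #(properFiveOn G S) := by
  induction k with
  | zero =>
    intro S _ hS
    rw [(card_eq_iff_eq_univ S).1 (by simpa using hS)]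
    simp
  | succ k ih =>
    rintro S ⟨a, ha⟩ hS
    obtain ⟨b, hb⟩ : ∃ b, b ∉ S := by
      by_contra! h
      have : S = univ := by ext; simp [h]
      rw [this, card_univ] at hS
      omega
    obtain ⟨w⟩ := hG.preconnected a b
    obtain ⟨d, -, hd1, hd2⟩ := w.exists_boundary_dart (S : Set V) ha hb
    have h1 := ih (insert d.snd S) ⟨_, mem_insert_self _ _⟩ (by
      rw [card_insert_of_notMem hd2]; omega)
    have h2 := card_properFiveOn_insert_le hd2 hd1 d.adj.symm
    calc _ ≤ _ := h1
      _ ≤ 4 ^ k * (4 * #(properFiveOn G S)) := by gcongr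
      _ = _ := by ring

/-- Every connected graph extends the colourings of a nonempty part in at most `4` ways per
additional vertex. -/
lemma card_properFive_le_of_connected {V : Type} [Fintype V] {G : SimpleGraph V}
    (hG : G.Connected) (S : Set V) [Fintype S] (hS : S.Nonempty) :
    #(properFive G) ≤ 4 ^ (Fintype.card V - Fintype.card S) * #(properFive (G.induce S)) := by
  classical
  have hle : Fintype.card S ≤ Fintype.card V := Fintype.card_subtype_le _
  have h1 := card_properFiveOn_univ_le hG (Fintype.card V - Fintype.card S) S.toFinset
    (by simpa using hS) (by rw [Set.toFinset_card]; omega)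
  have h0 : #(properFive G) = #(properFiveOn G univ) := by
    congr 1; ext f; simp [mem_properFive, mem_properFiveOn]
  have h2 : #(properFiveOn G S.toFinset) ≤ #(properFive (G.induce S)) := by
    apply card_le_card_of_injOn (fun f (x : S) => f x)
    · intro f hf
      simp only [mem_coe, mem_properFive, mem_properFiveOn] at hf ⊢
      intro u v huv
      exact hf.1 u (by simp) v (by simp) (by simpa using huv)
    · intro f hf g hg h
      simp only [mem_coe, mem_properFiveOn] at hf hg
      funext x
      by_cases hx : x ∈ S
      · exact congrFun h ⟨x, hx⟩
      · rw [hf.2 x (by simpa using hx), hg.2 x (by simpa using hx)]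
  rw [h0]
  exact h1.trans (Nat.mul_le_mul_left _ h2)

/-- The bound to be proved, for graphs with `m` vertices. -/
def FiveColouringBound (m : ℕ) : Prop :=
  ∀ {W : Type} [Fintype W] (H : SimpleGraph W), Fintype.card W = m → H.Connected →
    ¬ H.Colorable 4 → 128 * #(properFive H) ≤ 15 * 4 ^ m

/-- Identifying two nonadjacent vertices bounds the number of colourings that agree on them. -/
lemma card_filter_eq_le_of_merge {V : Type} [Fintype V] {G : SimpleGraph V}
    (hG : G.Connected) {u w : V} (huw : u ≠ w)
    (hcol : ∀ f : V → Fin 4, (∀ x y, G.Adj x y → f x ≠ f y) → f u ≠ f w)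
    {m : ℕ} (hm : Fintype.card V = m + 1) (ih : FiveColouringBound m) :
    128 * #((properFive G).filter fun f => f u = f w) ≤ 15 * 4 ^ m := by
  classical
  by_cases hadj : G.Adj u w
  · rw [filter_false_of_mem]
    · simp
    · intro f hf
      exact mem_properFive.1 hf u w hadj
  let H : SimpleGraph {x // x ≠ w} :=
    { Adj := fun x y => G.Adj x y ∨ (x.1 = u ∧ G.Adj w y) ∨ (y.1 = u ∧ G.Adj x w)
      symm := ⟨by
        rintro x y (h | ⟨h, h'⟩ | ⟨h, h'⟩)
        · exact Or.inl h.symm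
        · exact Or.inr (Or.inr ⟨h, h'.symm⟩)
        · exact Or.inr (Or.inl ⟨h, h'.symm⟩)⟩
      loopless := ⟨by
        rintro x (h | ⟨h, h'⟩ | ⟨h, h'⟩)
        · exact h.ne rfl
        · exact hadj (h ▸ h'.symm)
        · exact hadj (h ▸ h')⟩ }
  let r : V → {x // x ≠ w} := fun x => if h : x = w then ⟨u, huw⟩ else ⟨x, h⟩
  have hrw : r w = ⟨u, huw⟩ := by simp [r]
  have hrn : ∀ x (h : x ≠ w), r x = ⟨x, h⟩ := fun x h => by simp [r, h]
  have hr : ∀ x y, G.Adj x y → H.Adj (r x) (r y) := by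
    intro x y hxy
    by_cases hx : x = w
    · subst hx
      have hy : y ≠ x := hxy.ne.symm
      rw [hrw, hrn y hy]
      exact Or.inr (Or.inl ⟨rfl, hxy⟩)
    · by_cases hy : y = w
      · subst hy
        rw [hrw, hrn x hx]
        exact Or.inr (Or.inr ⟨rfl, hxy⟩)
      · rw [hrn x hx, hrn y hy]
        exact Or.inl hxy
  have hH : H.Connected :=
    hG.map (⟨r, fun {x y} h => hr x y h⟩ : G →g H) fun x => ⟨x.1, hrn x.1 x.2⟩
  have hcard : Fintype.card {x // x ≠ w} = m := by
    rw [Fintype.card_subtype_compl, hm]; simp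
  have hcol' : ¬ H.Colorable 4 := by
    rintro ⟨C⟩
    refine hcol (fun x => C (r x)) (fun x y h => C.valid (hr x y h)) ?_
    rw [hrw, hrn u huw]
  refine le_trans (Nat.mul_le_mul_left _ ?_) (ih H hcard hH hcol')
  apply card_le_card_of_injOn (fun f x => f x.1)
  · intro f hf
    simp only [coe_filter, Set.mem_ofPred_eq, mem_coe, mem_properFive] at hf ⊢
    rintro x y (h | ⟨h, h'⟩ | ⟨h, h'⟩)
    · exact hf.1 _ _ h
    · rw [h, hf.2]; exact hf.1 _ _ h'
    · rw [h, hf.2]; exact hf.1 _ _ h'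
  · intro f hf g hg h
    simp only [coe_filter, Set.mem_ofPred_eq] at hf hg
    funext x
    by_cases hx : x = w
    · subst hx
      rw [← hf.2, ← hg.2]; exact congrFun h ⟨u, huw⟩
    · exact congrFun h ⟨x, hx⟩

/-- The ordered pairs of distinct elements of `A` that receive the same colour. -/
def monoPairs {V α : Type} [DecidableEq V] [DecidableEq α] (c : V → α) (A : Finset V) :
    Finset (V × V) := A.offDiag.filter fun p => c p.1 = c p.2

lemma le_card_monoPairs {V α : Type} [DecidableEq V] [DecidableEq α] (c : V → α) (A : Finset V)
    (k : ℕ) : (2 * k * #A - k * (k + 1) * #(A.image c) : ℤ) ≤ #(monoPairs c A) := by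
  have h1 : (#A : ℤ) = ∑ i ∈ A.image c, (#(A.filter fun x => c x = i) : ℤ) := by
    exact_mod_cast card_eq_sum_card_image c A
  have h2 : (#(monoPairs c A) : ℤ) = ∑ i ∈ A.image c,
      (#(A.filter fun x => c x = i) * #(A.filter fun x => c x = i) -
        #(A.filter fun x => c x = i) : ℤ) := by
    rw [card_eq_sum_card_fiberwise (f := fun p : V × V => c p.1) (t := A.image c)]
    · push_cast
      refine sum_congr rfl fun i _ => ?_
      have : (monoPairs c A).filter (fun p => c p.1 = i) =
          (A.filter fun x => c x = i).offDiag := by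
        ext ⟨x, y⟩
        simp only [monoPairs, mem_filter, mem_offDiag]
        constructor
        · rintro ⟨⟨⟨hx, hy, hxy⟩, h⟩, h'⟩
          exact ⟨⟨hx, h'⟩, ⟨hy, h ▸ h'⟩, hxy⟩
        · rintro ⟨⟨hx, h'⟩, ⟨hy, h⟩, hxy⟩
          exact ⟨⟨⟨hx, hy, hxy⟩, h'.trans h.symm⟩, h'⟩
      rw [this, offDiag_card, Nat.cast_sub (Nat.le_mul_self _)]
      push_cast
      rfl
    · intro p hp
      simp only [monoPairs, mem_coe, mem_filter, mem_offDiag] at hp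
      exact mem_coe.2 (mem_image_of_mem c hp.1.1)
  rw [h1, h2, mul_sum, card_eq_sum_ones]
  push_cast
  rw [mul_sum, ← sum_sub_distrib]
  refine sum_le_sum fun i _ => ?_
  generalize (#(A.filter fun x => c x = i)) = m
  rcases le_or_gt m k with h | h
  · have : (0 : ℤ) ≤ ((k : ℤ) - m) * (k + 1 - m) := by
      apply mul_nonneg <;> linarith [(Nat.cast_le (α := ℤ)).2 h]
    nlinarith
  · have : (0 : ℤ) ≤ ((m : ℤ) - k) * (m - (k + 1)) := by
      have : (k : ℤ) + 1 ≤ m := by exact_mod_cast h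
      apply mul_nonneg <;> linarith
    nlinarith

/-- Among the colourings that agree on two neighbours of `v`, weighting by the inverse number of
colours available at `v` counts at most the colourings of `G - v`. -/
lemma sum_inv_free_le {V : Type} [Fintype V] [DecidableEq V] {G : SimpleGraph V}
    [DecidableRel G.Adj] {v s t : V} (hs : G.Adj v s) (ht : G.Adj v t) (hst : s ≠ t)
    (hconn : (G.induce {v}ᶜ).Connected)
    (hcol : ∀ f : V → Fin 4, (∀ x, x ≠ v → ∀ y, y ≠ v → G.Adj x y → f x ≠ f y) → f s ≠ f t)
    {m : ℕ} (hm : Fintype.card V = m + 2) (ih : FiveColouringBound m) :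
    128 * ∑ c ∈ (properFive G).filter (fun c => c s = c t),
      (1 / (#((G.neighborFinset v).image c)ᶜ : ℝ)) ≤ 15 * 4 ^ m := by
  classical
  have hsv : s ≠ v := hs.ne.symm
  have htv : t ≠ v := ht.ne.symm
  let S : Set V := {v}ᶜ
  have hcard : Fintype.card S = m + 1 := by
    rw [Fintype.card_compl_set, hm]; simp
  have hM := card_filter_eq_le_of_merge (G := G.induce S) hconn (u := ⟨s, hsv⟩) (w := ⟨t, htv⟩)
    (fun h => hst (congrArg Subtype.val h)) (by
      intro f hf
      have := hcol (fun x => if hx : x ∈ S then f ⟨x, hx⟩ else 0) (by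
        intro x hx y hy hxy
        have hx' : x ∈ S := hx
        have hy' : y ∈ S := hy
        simp only [hx', hy', dif_pos]
        exact hf _ _ (by simpa using hxy))
      have hs' : s ∈ S := hsv
      have ht' : t ∈ S := htv
      simpa only [hs', ht', dif_pos] using this) hcard ih
  have hM' : (128 * #((properFive (G.induce S)).filter
      fun f => f ⟨s, hsv⟩ = f ⟨t, htv⟩) : ℝ) ≤ 15 * 4 ^ m := by exact_mod_cast hM
  refine le_trans (mul_le_mul_of_nonneg_left ?_ (by norm_num)) hM'
  rw [← sum_fiberwise_of_maps_to (t := (properFive (G.induce S)).filter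
      fun f => f ⟨s, hsv⟩ = f ⟨t, htv⟩) (g := fun c (x : S) => c x)]
  · rw [card_eq_sum_ones, Nat.cast_sum]
    refine sum_le_sum fun g _ => ?_
    set F := ((properFive G).filter (fun c => c s = c t)).filter fun c => (fun x : S => c x) = g
      with hF
    rcases F.eq_empty_or_nonempty with h | ⟨c₁, hc₁⟩
    · simp [h]
    have himg : ∀ c ∈ F, (G.neighborFinset v).image c = (G.neighborFinset v).image c₁ := by
      intro c hc
      refine image_congr fun x hx => ?_
      have hxv : x ≠ v := by
        have : G.Adj v x := by simpa using hx
        exact this.ne.symm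
      rw [hF, mem_filter] at hc hc₁
      exact congrFun (hc.2.trans hc₁.2.symm) ⟨x, hxv⟩
    rw [sum_congr rfl fun c hc => by rw [himg c hc], sum_const, nsmul_eq_mul]
    have hle : #F ≤ #((G.neighborFinset v).image c₁)ᶜ := by
      apply card_le_card_of_injOn (fun c => c v)
      · intro c hc
        rw [mem_coe, ← himg c hc]
        change c v ∈ ((G.neighborFinset v).image c)ᶜ
        rw [mem_compl, mem_image]
        rintro ⟨x, hx, h⟩
        rw [SimpleGraph.mem_neighborFinset] at hx
        rw [hF, mem_coe, mem_filter, mem_filter, mem_properFive] at hc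
        exact hc.1.1 v x hx h.symm
      · intro c hc c' hc' h
        rw [hF, mem_coe, mem_filter] at hc hc'
        funext x
        by_cases hx : x = v
        · subst hx; exact h
        · exact congrFun (hc.2.trans hc'.2.symm) ⟨x, hx⟩
    have hpos : (0 : ℝ) < #((G.neighborFinset v).image c₁)ᶜ := by
      exact_mod_cast lt_of_lt_of_le (card_pos.2 ⟨c₁, hc₁⟩) hle
    rw [mul_one_div, div_le_iff₀ hpos]
    simpa using hle
  · intro c hc
    simp only [mem_filter, mem_properFive] at hc ⊢
    exact ⟨fun x y h => hc.1 x y (by simpa using h), hc.2⟩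

lemma sum_card_monoPairs_mul {V α : Type} [DecidableEq V] [DecidableEq α]
    (F : Finset (V → α)) (A : Finset V) (w : (V → α) → ℝ) :
    ∑ c ∈ F, #(monoPairs c A) * w c =
      ∑ p ∈ A.offDiag, ∑ c ∈ F.filter (fun c => c p.1 = c p.2), w c := by
  simp only [sum_filter]
  rw [sum_comm]
  refine sum_congr rfl fun c _ => ?_
  rw [← sum_filter, sum_const, nsmul_eq_mul]
  rfl

lemma sum_card_monoPairs_mul_le {V α : Type} [DecidableEq V] [DecidableEq α]
    {F : Finset (V → α)} {A : Finset V} {w : (V → α) → ℝ} {r : ℝ}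
    (h : ∀ s ∈ A, ∀ t ∈ A, s ≠ t → ∑ c ∈ F.filter (fun c => c s = c t), w c ≤ r) :
    ∑ c ∈ F, #(monoPairs c A) * w c ≤ (#A * (#A - 1)) * r := by
  rw [sum_card_monoPairs_mul]
  have : ∑ p ∈ A.offDiag, ∑ c ∈ F.filter (fun c => c p.1 = c p.2), w c
      ≤ ∑ _p ∈ A.offDiag, r := by
    refine sum_le_sum fun p hp => ?_
    rw [mem_offDiag] at hp
    exact h _ hp.1 _ hp.2.1 hp.2.2
  refine this.trans_eq ?_
  rw [sum_const, offDiag_card, nsmul_eq_mul, Nat.cast_sub (Nat.le_mul_self _)]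
  push_cast
  ring

lemma card_le_eight_absurd {V : Type} [Fintype V] [DecidableEq V] {G : SimpleGraph V}
    [DecidableRel G.Adj] (hdeg : ∀ v, 4 ≤ G.degree v) {r : ℝ} (hr : 0 ≤ r)
    (hP : 4 * r < #(properFive G))
    (hpair : ∀ s t, s ≠ t → #((properFive G).filter fun c => c s = c t) ≤ r)
    (h5 : 6 ≤ Fintype.card V) (h8 : Fintype.card V ≤ 8) : False := by
  set n := Fintype.card V with hn
  have hn5 : (6 : ℝ) ≤ n := by exact_mod_cast h5
  have hn8 : (n : ℝ) ≤ 8 := by exact_mod_cast h8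
  have h1 : (2 * n - 10 : ℝ) * #(properFive G) ≤
      ∑ c ∈ properFive G, #(monoPairs c univ) * (1 : ℝ) := by
    rw [mul_comm, ← nsmul_eq_mul, ← sum_const]
    refine sum_le_sum fun c _ => ?_
    have := le_card_monoPairs c univ 1
    have h2 : #(univ.image c) ≤ 5 := by
      simpa using card_le_univ (univ.image c)
    have h3 : (2 * n - 10 : ℤ) ≤ #(monoPairs c univ) := by
      refine le_trans ?_ this
      rw [card_univ, ← hn]
      push_cast
      have : (#(univ.image c) : ℤ) ≤ 5 := by exact_mod_cast h2
      linarith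
    rw [mul_one]
    exact_mod_cast h3
  rw [sum_card_monoPairs_mul] at h1
  have h2 : ∑ p ∈ (univ : Finset V).offDiag,
      ∑ c ∈ (properFive G).filter (fun c => c p.1 = c p.2), (1 : ℝ) ≤
      ∑ v : V, ∑ u ∈ univ.filter (fun u => u ≠ v ∧ ¬ G.Adj v u), r := by
    have h0 : ∀ v : V, ∑ u ∈ univ.filter (fun u => u ≠ v ∧ ¬ G.Adj v u), r =
      ∑ u : V, if u ≠ v ∧ ¬ G.Adj v u then r else 0 := fun v => sum_filter _ _
    simp only [h0]
    rw [← sum_product', univ_product_univ, ← sum_subset (subset_univ (univ : Finset V).offDiag)]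
    · refine sum_le_sum fun p hp => ?_
      rw [mem_offDiag] at hp
      rw [sum_const, nsmul_eq_mul, mul_one]
      by_cases hadj : G.Adj p.1 p.2
      · rw [filter_false_of_mem fun c hc => mem_properFive.1 hc _ _ hadj]
        simp [hadj]
      · rw [if_pos ⟨hp.2.2.symm, hadj⟩]
        exact hpair _ _ hp.2.2
    · rintro ⟨v, u⟩ _ hp
      rw [if_neg]
      rintro ⟨h, -⟩
      exact hp (by simp [h.symm])
  have h3 : ∑ v : V, ∑ u ∈ univ.filter (fun u => u ≠ v ∧ ¬ G.Adj v u), r ≤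
      ∑ _v : V, (n - 5) * r := by
    refine sum_le_sum fun v _ => ?_
    rw [sum_const, nsmul_eq_mul]
    refine mul_le_mul_of_nonneg_right ?_ hr
    have : univ.filter (fun u => u ≠ v ∧ ¬ G.Adj v u) = (insert v (G.neighborFinset v))ᶜ := by
      ext u; simp
    rw [this, card_compl, card_insert_of_notMem (by simp),
      SimpleGraph.card_neighborFinset_eq_degree,
      ← hn]
    have := hdeg v
    have h' : n - (G.degree v + 1) ≤ n - 5 := by omega
    calc ((n - (G.degree v + 1) : ℕ) : ℝ) ≤ ((n - 5 : ℕ) : ℝ) := by exact_mod_cast h'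
      _ = n - 5 := by rw [Nat.cast_sub (by omega)]; norm_num
  rw [sum_const, card_univ, ← hn, nsmul_eq_mul] at h3
  have h4 := h1.trans (h2.trans h3)
  have h5 : (2 * n - 10 : ℝ) * (4 * r) < (2 * n - 10) * #(properFive G) :=
    mul_lt_mul_of_pos_left hP (by linarith)
  have h6 : (n : ℝ) * ((n - 5) * r) ≤ 8 * ((n - 5) * r) :=
    mul_le_mul_of_nonneg_right hn8 (mul_nonneg (by linarith) hr)
  linarith

/-- On five vertices minimum degree four forces the complete graph, which has `5!` colourings. -/
lemma card_properFive_eq_of_card_eq_five {V : Type} [Fintype V] {G : SimpleGraph V}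
    [DecidableRel G.Adj] (hdeg : ∀ v, 4 ≤ G.degree v) (h5 : Fintype.card V = 5) :
    #(properFive G) = 120 := by
  classical
  have hadj : ∀ u v, u ≠ v → G.Adj u v := by
    intro u v huv
    have h1 : G.neighborFinset u = univ.erase u := by
      refine eq_of_subset_of_card_le (fun x hx => ?_) ?_
      · rw [SimpleGraph.mem_neighborFinset] at hx
        simp [hx.ne.symm]
      · rw [card_erase_of_mem (mem_univ u), card_univ, h5,
          SimpleGraph.card_neighborFinset_eq_degree]
        exact hdeg u
    have : v ∈ G.neighborFinset u := by rw [h1]; simp [huv.symm]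
    simpa using this
  have h1 : #(properFive G) = Fintype.card (V ↪ Fin 5) := by
    rw [← card_univ]
    refine card_bij' (fun f hf => ⟨f, fun u v h => by
        by_contra huv
        exact mem_properFive.1 hf u v (hadj u v huv) h⟩) (fun f _ => f) ?_ ?_ ?_ ?_
    · simp
    · intro f _
      exact mem_properFive.2 fun u v h => f.injective.ne h.ne
    · exact fun _ _ => rfl
    · exact fun _ _ => rfl
  rw [h1, Fintype.card_embedding_eq, h5]
  rfl

/-- The neighbours of `v` that precede it in the vertex order `e`. -/
def earlier {V : Type} [Fintype V] {n : ℕ} (G : SimpleGraph V) [DecidableRel G.Adj]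
    (e : V ≃ Fin n) (v : V) : Finset V := (G.neighborFinset v).filter fun u => e u < e v

lemma sum_sum_update {V : Type} [Fintype V] [DecidableEq V] {k : ℕ} (v : V)
    (g : (V → Fin k) → ℝ) :
    ∑ c, ∑ x, g (Function.update c v x) = k * ∑ c, g c := by
  have hinv : Function.Involutive fun p : (V → Fin k) × Fin k =>
      (Function.update p.1 v p.2, p.1 v) := by
    rintro ⟨c, x⟩
    simp
  have h1 : ∑ c, ∑ x, g (Function.update c v x) =
      ∑ p : (V → Fin k) × Fin k, g (Function.update p.1 v p.2) := by
    rw [Fintype.sum_prod_type]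
  have h2 : ∑ p : (V → Fin k) × Fin k, g (Function.update p.1 v p.2) =
      ∑ p : (V → Fin k) × Fin k, g p.1 :=
    Fintype.sum_equiv hinv.toPerm _ _ fun _ => rfl
  rw [h1, h2, Fintype.sum_prod_type]
  simp [mul_sum]

lemma sum_prod_inv_free_le_one {V : Type} [Fintype V] [DecidableEq V] {n : ℕ}
    (G : SimpleGraph V) [DecidableRel G.Adj] (e : V ≃ Fin n) :
    ∑ c ∈ properFive G, ∏ v, (1 / (#((earlier G e v).image c)ᶜ : ℝ)) ≤ 1 := by
  have hn : Fintype.card V = n := by simpa using Fintype.card_congr e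
  let q : V → (V → Fin 5) → ℝ := fun v c =>
    if c v ∈ ((earlier G e v).image c)ᶜ then 1 / (#((earlier G e v).image c)ᶜ : ℝ) else 0
  have hq0 : ∀ v c, 0 ≤ q v c := fun v c => by
    simp only [q]; split_ifs <;> positivity
  have hQ : ∀ k ≤ n, 5 ^ k * ∑ c, ∏ v ∈ univ.filter (fun v => (e v : ℕ) < k), q v c ≤ 5 ^ n := by
    intro k
    induction k with
    | zero => simp [hn]
    | succ k ih =>
      intro hk
      refine le_trans ?_ (ih (by omega))
      rw [pow_succ, mul_assoc]
      refine mul_le_mul_of_nonneg_left ?_ (by positivity)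
      set v := e.symm ⟨k, by omega⟩ with hv
      have hev : (e v : ℕ) = k := by simp [hv]
      have hset : univ.filter (fun u => (e u : ℕ) < k + 1) =
          insert v (univ.filter fun u => (e u : ℕ) < k) := by
        ext u
        simp only [mem_filter, mem_univ, true_and, mem_insert]
        rw [Nat.lt_succ_iff_lt_or_eq, or_comm, ← hev, Fin.val_inj, e.injective.eq_iff]
      have hnot : v ∉ univ.filter fun u => (e u : ℕ) < k := by simp [hev]
      have himg : ∀ (c : V → Fin 5) x u, (e u : ℕ) ≤ k →
          (earlier G e u).image (Function.update c v x) = (earlier G e u).image c := by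
        intro c x u hu
        refine image_congr fun y hy => Function.update_of_ne ?_ _ _
        intro h
        simp only [earlier, coe_filter, Set.mem_ofPred_eq] at hy
        have : (e y : ℕ) < e u := hy.2
        rw [h] at this
        omega
      have h5 := sum_sum_update (k := 5) v
        fun c => ∏ u ∈ univ.filter (fun u => (e u : ℕ) < k + 1), q u c
      push_cast at h5
      rw [← h5]
      refine sum_le_sum fun c _ => ?_
      have hx : ∀ x, ∏ u ∈ univ.filter (fun u => (e u : ℕ) < k + 1), q u (Function.update c v x) =
          (∏ u ∈ univ.filter (fun u => (e u : ℕ) < k), q u c) *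
            if x ∈ ((earlier G e v).image c)ᶜ then
              1 / (#((earlier G e v).image c)ᶜ : ℝ) else 0 := by
        intro x
        rw [hset, prod_insert hnot, mul_comm]
        congr 1
        · refine prod_congr rfl fun u hu => ?_
          have hu' : (e u : ℕ) < k := by simpa using hu
          have huv : u ≠ v := by rintro rfl; omega
          simp only [q, himg c x u hu'.le, Function.update_of_ne huv]
        · simp only [q, himg c x v hev.le, Function.update_self]
      simp only [hx]
      rw [← mul_sum, ← sum_filter]
      refine mul_le_of_le_one_right (prod_nonneg fun u _ => hq0 u c) ?_
      rw [filter_univ_mem, sum_const, nsmul_eq_mul, mul_one_div]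
      exact div_self_le_one _
  have h := hQ n le_rfl
  have huniv : univ.filter (fun v => (e v : ℕ) < n) = univ := by
    ext v; simp
  rw [huniv] at h
  have h1 : ∑ c, ∏ v, q v c ≤ 1 := by
    have : (0 : ℝ) < 5 ^ n := by positivity
    nlinarith
  refine le_trans (le_trans (sum_le_sum fun c hc => ?_)
    (sum_le_sum_of_subset_of_nonneg (subset_univ (properFive G))
      fun c _ _ => prod_nonneg fun v _ => hq0 v c)) h1
  refine (prod_congr rfl fun v _ => ?_).le
  have : c v ∈ ((earlier G e v).image c)ᶜ := by
    rw [mem_compl, mem_image]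
    rintro ⟨u, hu, h⟩
    simp only [earlier, mem_filter, SimpleGraph.mem_neighborFinset] at hu
    exact mem_properFive.1 hc v u hu.1 h.symm
  simp only [q, if_pos this]

lemma free_earlier_pos {V : Type} [Fintype V] [DecidableEq V] {n : ℕ}
    {G : SimpleGraph V} [DecidableRel G.Adj] (e : V ≃ Fin n) {c : V → Fin 5}
    (hc : c ∈ properFive G) (v : V) : 0 < #((earlier G e v).image c)ᶜ := by
  refine card_pos.2 ⟨c v, ?_⟩
  rw [mem_compl, mem_image]
  rintro ⟨u, hu, h⟩
  simp only [earlier, mem_filter, SimpleGraph.mem_neighborFinset] at hu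
  exact mem_properFive.1 hc v u hu.1 h.symm

/-- The entropy inequality for the number of proper colourings. -/
lemma sum_sum_log_le {V : Type} [Fintype V] [DecidableEq V] {n : ℕ}
    (G : SimpleGraph V) [DecidableRel G.Adj] (e : V ≃ Fin n) (hP : 0 < #(properFive G)) :
    ∑ c ∈ properFive G, ∑ v, Real.log (4 / (#((earlier G e v).image c)ᶜ : ℝ)) ≤
      #(properFive G) * Real.log (4 ^ n / #(properFive G)) := by
  have hn : Fintype.card V = n := by simpa using Fintype.card_congr e
  set P : ℝ := ((#(properFive G) : ℕ) : ℝ) with hPdef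
  have hP' : 0 < P := Nat.cast_pos.2 hP
  have hseq := sum_prod_inv_free_le_one G e
  set w : (V → Fin 5) → ℝ := fun c => ∏ v, (1 / (#((earlier G e v).image c)ᶜ : ℝ)) with hw
  have hwpos : ∀ c ∈ properFive G, 0 < w c := fun c hc => prod_pos fun v _ => by
    have : (0 : ℝ) < #((earlier G e v).image c)ᶜ := by exact_mod_cast free_earlier_pos e hc v
    positivity
  have hterm : ∀ c ∈ properFive G, ∑ v, Real.log (4 / (#((earlier G e v).image c)ᶜ : ℝ)) ≤
      Real.log (4 ^ n / P) + (P * w c - 1) := by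
    intro c hc
    have h1 : ∑ v, Real.log (4 / (#((earlier G e v).image c)ᶜ : ℝ)) = Real.log (4 ^ n * w c) := by
      rw [← Real.log_prod]
      · congr 1
        simp only [hw, div_eq_mul_one_div (4 : ℝ)]
        rw [prod_mul_distrib, prod_const, card_univ, hn]
      · intro v _
        have : (0 : ℝ) < #((earlier G e v).image c)ᶜ := by exact_mod_cast free_earlier_pos e hc v
        positivity
    have h2 : (4 : ℝ) ^ n * w c = 4 ^ n / P * (P * w c) := by field_simp
    rw [h1, h2, Real.log_mul (by positivity) (mul_pos hP' (hwpos c hc)).ne']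
    have := Real.log_le_sub_one_of_pos (mul_pos hP' (hwpos c hc))
    linarith
  refine (sum_le_sum hterm).trans ?_
  rw [sum_add_distrib, sum_const, nsmul_eq_mul, sum_sub_distrib, ← mul_sum, sum_const, nsmul_eq_mul,
    ← hPdef]
  nlinarith

lemma sum_rank {V : Type} [DecidableEq V] {n : ℕ} (e : V ≃ Fin n) (D : Finset V) (g : ℕ → ℝ) :
    ∑ x ∈ D, g #(D.filter fun u => e u < e x) = ∑ b ∈ range #D, g b := by
  have hlt : ∀ x ∈ D, ∀ y, e x < e y →
      #(D.filter fun u => e u < e x) < #(D.filter fun u => e u < e y) := by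
    intro x hx y hxy
    refine card_lt_card ⟨fun u hu => ?_, fun h => ?_⟩
    · rw [mem_filter] at hu ⊢
      exact ⟨hu.1, hu.2.trans hxy⟩
    · have := h (mem_filter.2 ⟨hx, hxy⟩)
      exact lt_irrefl _ (mem_filter.1 this).2
  have hinj : Set.InjOn (fun x => #(D.filter fun u => e u < e x)) (D : Set V) := by
    intro x hx y hy h
    rcases lt_trichotomy (e x) (e y) with h' | h' | h'
    · exact absurd h (hlt x hx y h').ne
    · exact e.injective h'
    · exact absurd h (hlt y hy x h').ne'
  rw [← sum_image (f := g) hinj]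
  congr 1
  refine eq_of_subset_of_card_le (fun b hb => ?_) ?_
  · obtain ⟨x, hx, rfl⟩ := mem_image.1 hb
    refine mem_range.2 (card_lt_card ⟨filter_subset _ _, fun h => ?_⟩)
    exact lt_irrefl _ (mem_filter.1 (h hx)).2
  · rw [card_image_of_injOn hinj, card_range]

/-- In a uniformly random vertex order, the number of elements of `B` that precede `v` is uniformly
distributed. -/
lemma sum_equiv_card_filter_lt {V : Type} [Fintype V] [DecidableEq V] {n : ℕ} {v : V}
    {B : Finset V} (hv : v ∉ B) (g : ℕ → ℝ) :
    (#B + 1) * ∑ e : V ≃ Fin n, g #(B.filter fun u => e u < e v) =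
      Fintype.card (V ≃ Fin n) * ∑ b ∈ range (#B + 1), g b := by
  set D := insert v B with hD
  have hDcard : #D = #B + 1 := card_insert_of_notMem hv
  have hinv : ∀ x ∈ D, ∑ e : V ≃ Fin n, g #(D.filter fun u => e u < e x) =
      ∑ e : V ≃ Fin n, g #(D.filter fun u => e u < e v) := by
    intro x hx
    have hvD : v ∈ D := mem_insert_self _ _
    have hswap : ∀ u ∈ D, Equiv.swap v x u ∈ D := by
      intro u hu
      rw [Equiv.swap_apply_def]
      split_ifs <;> assumption
    refine Fintype.sum_equiv (Equiv.equivCongr (Equiv.swap v x) (Equiv.refl _)) _ _ fun e => ?_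
    congr 1
    refine card_nbij' (Equiv.swap v x) (Equiv.swap v x) ?_ ?_ ?_ ?_
    · intro u hu
      simp only [coe_filter, Set.mem_ofPred_eq] at hu ⊢
      refine ⟨hswap u hu.1, ?_⟩
      simpa [Equiv.equivCongr] using hu.2
    · intro u hu
      simp only [coe_filter, Set.mem_ofPred_eq] at hu ⊢
      refine ⟨hswap u hu.1, ?_⟩
      simpa [Equiv.equivCongr] using hu.2
    · intro u _; simp
    · intro u _; simp
  have hBD : ∀ e : V ≃ Fin n, B.filter (fun u => e u < e v) = D.filter fun u => e u < e v := by
    intro e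
    rw [hD, filter_insert, if_neg (lt_irrefl _)]
  simp only [hBD]
  calc _ = ∑ x ∈ D, ∑ e : V ≃ Fin n, g #(D.filter fun u => e u < e x) := by
        rw [sum_congr rfl hinv, sum_const, hDcard, nsmul_eq_mul]
        push_cast; rfl
    _ = _ := by
        rw [sum_comm, sum_congr rfl fun e _ => sum_rank e D g, sum_const, nsmul_eq_mul, hDcard]
        rfl

end Structure

section Gains

open Finset Real

lemma mul_log_le_of_pow_le {a b p q : ℕ} (hb : 0 < b) (h : b ^ q ≤ a ^ p) :
    q * log b ≤ p * log a := by
  rw [← log_pow, ← log_pow]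
  have : (0 : ℝ) < (b : ℝ) ^ q := by positivity
  exact log_le_log this (by exact_mod_cast h)

lemma three_mul_log_two_le : 3 * log 2 ≤ 2 * log 3 := by
  simpa using mul_log_le_of_pow_le (a := 3) (b := 2) (p := 2) (q := 3) (by norm_num) (by norm_num)

/-- The average gain at a vertex of degree four with `b` earlier neighbours. -/
noncomputable def gainFour : ℕ → ℝ
  | 0 => 2 * log 2 - log 5
  | 1 => 0
  | 2 => 3 / 4 * (2 * log 2 - log 3)
  | 3 => log 2 - 9 / 16 * (log 3 - log 2)
  | _ => 2 * log 2 - 9 / 16 * log 3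

/-- The average gain at a vertex with `b` earlier neighbours among five chosen ones. -/
noncomputable def gainFive : ℕ → ℝ
  | 0 => 2 * log 2 - log 5
  | 1 => 0
  | 2 => 3 / 4 * (2 * log 2 - log 3)
  | 3 => log 2 - 3 / 4 * (log 3 - log 2)
  | 4 => log 2 - 1 / 2 * (log 3 - log 2)
  | _ => log 3 - 5 / 4 * (log 3 - log 2)

lemma log_bound_ratio : log (128 / 15) = 7 * log 2 - log 3 - log 5 := by
  rw [log_div (by norm_num) (by norm_num), show (128 : ℝ) = 2 ^ 7 by norm_num, log_pow,
    show (15 : ℝ) = 3 * 5 by norm_num, log_mul (by norm_num) (by norm_num)]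
  norm_num; ring

set_option exponentiation.threshold 500 in
lemma sum_gainFour : 5 * log (128 / 15) ≤ 9 * ∑ b ∈ range 5, gainFour b := by
  have h0 := log_bound_ratio
  have h1 : 190 * log 3 + 64 * log 5 ≤ 457 * log 2 := by
    have : (3 : ℝ) ^ 190 * 5 ^ 64 ≤ 2 ^ 457 := by norm_num
    have := log_le_log (by positivity) this
    rw [log_mul (by positivity) (by positivity), log_pow, log_pow, log_pow] at this
    exact_mod_cast this
  simp only [sum_range_succ, range_zero, sum_empty, gainFour]
  linarith

lemma sum_gainFive : 6 * log (128 / 15) ≤ 9 * ∑ b ∈ range 6, gainFive b := by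
  have h0 := log_bound_ratio
  have h1 : 19 * log 3 + 4 * log 5 ≤ 40 * log 2 := by
    have : (3 : ℝ) ^ 19 * 5 ^ 4 ≤ 2 ^ 40 := by norm_num
    have := log_le_log (by positivity) this
    rw [log_mul (by positivity) (by positivity), log_pow, log_pow, log_pow] at this
    exact_mod_cast this
  simp only [sum_range_succ, range_zero, sum_empty, gainFive]
  linarith

lemma log_four_div {a : ℕ} (ha : 0 < a) : log (4 / (a : ℝ)) = 2 * log 2 - log a := by
  rw [log_div (by norm_num) (by positivity), log_four_eq]

lemma log_four_div_ge {a m : ℕ} (ha : 0 < a) (h : a ≤ m) :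
    2 * log 2 - log m ≤ log (4 / (a : ℝ)) := by
  rw [log_four_div ha]
  have : log a ≤ log m := log_le_log (by exact_mod_cast ha) (by exact_mod_cast h)
  linarith

lemma image_card_bounds {V : Type} {c : V → Fin 5} {A : Finset V} {a : ℕ}
    (ha : 0 < a) (h : a ≤ #(A.image c)ᶜ) :
    a + #(A.image c) ≤ 5 := by
  rw [card_compl, Fintype.card_fin] at h
  omega

lemma local_gain_zero {V : Type} {c : V → Fin 5} {A : Finset V} {a : ℕ}
    (ha : 0 < a) (h : a ≤ #(A.image c)ᶜ) :
    2 * log 2 - log 5 ≤ log (4 / (a : ℝ)) := by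
  have := image_card_bounds ha h
  exact_mod_cast log_four_div_ge (m := 5) ha (by omega)

lemma local_gain_one {V : Type} {c : V → Fin 5} {A : Finset V} {a : ℕ}
    (hA : 0 < #A) (ha : 0 < a) (h : a ≤ #(A.image c)ᶜ) :
    0 ≤ log (4 / (a : ℝ)) := by
  have := image_card_bounds ha h
  have hj : 0 < #(A.image c) := card_pos.2 ((card_pos.1 hA).image c)
  have := log_four_div_ge (m := 4) ha (by omega)
  have h4 := log_four_eq
  push_cast at this
  linarith

section Local

variable {V : Type} [DecidableEq V] {c : V → Fin 5} {A : Finset V} {a : ℕ}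

lemma local_gain_two (hA : #A = 2) (ha : 0 < a) (h : a ≤ #(A.image c)ᶜ) :
    (2 * log 2 - log 3) - (2 * log 2 - log 3) / 2 * #(monoPairs c A) ≤ log (4 / (a : ℝ)) := by
  have hb := image_card_bounds ha h
  have h1 := le_card_monoPairs c A 1
  have h0 := local_gain_one (by omega) ha h
  have hj := card_image_le (s := A) (f := c)
  have hj0 : 0 < #(A.image c) := card_pos.2 ((card_pos.1 (by omega)).image c)
  have hlog := three_mul_log_two_le
  have hpos := log_pos (show (1 : ℝ) < 2 by norm_num)
  have h43 : 0 ≤ 2 * log 2 - log 3 := by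
    simpa using mul_log_le_of_pow_le (a := 2) (b := 3) (p := 2) (q := 1) (by norm_num) (by norm_num)
  rw [hA] at h1 hj
  generalize #(monoPairs c A) = Y at *
  generalize #(A.image c) = j at *
  have hY0 : (0 : ℝ) ≤ Y := Nat.cast_nonneg Y
  interval_cases j
  · have hY : (2 : ℝ) ≤ Y := by norm_num at h1; exact_mod_cast h1
    nlinarith
  · have := log_four_div_ge (m := 3) ha (by omega)
    push_cast at this
    nlinarith

lemma local_gain_three (hA : #A = 3) (ha : 0 < a) (h : a ≤ #(A.image c)ᶜ) :
    log 2 - (log 3 - log 2) / 2 * #(monoPairs c A) ≤ log (4 / (a : ℝ)) := by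
  have hb := image_card_bounds ha h
  have h1 := le_card_monoPairs c A 1
  have h2 := le_card_monoPairs c A 2
  have h0 := local_gain_one (by omega) ha h
  have hj := card_image_le (s := A) (f := c)
  have hj0 : 0 < #(A.image c) := card_pos.2 ((card_pos.1 (by omega)).image c)
  have hlog := three_mul_log_two_le
  have hpos := log_pos (show (1 : ℝ) < 2 by norm_num)
  rw [hA] at h1 h2 hj
  generalize #(monoPairs c A) = Y at *
  generalize #(A.image c) = j at *
  have hY0 : (0 : ℝ) ≤ Y := Nat.cast_nonneg Y
  interval_cases j
  · have hY : (6 : ℝ) ≤ Y := by norm_num at h2; exact_mod_cast h2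
    nlinarith
  · have hY : (2 : ℝ) ≤ Y := by norm_num at h1; exact_mod_cast h1
    have := log_four_div_ge (m := 3) ha (by omega)
    push_cast at this
    nlinarith
  · have := log_four_div_ge (m := 2) ha (by omega)
    push_cast at this
    nlinarith

lemma local_gain_four (hA : #A = 4) (ha : 0 < a) (h : a ≤ #(A.image c)ᶜ) :
    log 3 - (log 3 - log 2) / 2 * #(monoPairs c A) ≤ log (4 / (a : ℝ)) := by
  have hb := image_card_bounds ha h
  have h1 := le_card_monoPairs c A 1
  have h2 := le_card_monoPairs c A 3
  have h0 := local_gain_one (by omega) ha h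
  have hj := card_image_le (s := A) (f := c)
  have hj0 : 0 < #(A.image c) := card_pos.2 ((card_pos.1 (by omega)).image c)
  have hlog := three_mul_log_two_le
  have hpos := log_pos (show (1 : ℝ) < 2 by norm_num)
  have h43 : log 3 ≤ 2 * log 2 := by
    simpa using mul_log_le_of_pow_le (a := 2) (b := 3) (p := 2) (q := 1) (by norm_num) (by norm_num)
  rw [hA] at h1 h2 hj
  generalize #(monoPairs c A) = Y at *
  generalize #(A.image c) = j at *
  have hY0 : (0 : ℝ) ≤ Y := Nat.cast_nonneg Y
  interval_cases j
  · have hY : (12 : ℝ) ≤ Y := by norm_num at h2; exact_mod_cast h2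
    nlinarith
  · have hY : (4 : ℝ) ≤ Y := by norm_num at h1; exact_mod_cast h1
    have := log_four_div_ge (m := 3) ha (by omega)
    push_cast at this
    nlinarith
  · have hY : (2 : ℝ) ≤ Y := by norm_num at h1; exact_mod_cast h1
    have := log_four_div_ge (m := 2) ha (by omega)
    push_cast at this
    nlinarith
  · have := log_four_div_ge (m := 1) ha (by omega)
    push_cast at this
    rw [log_one] at this
    nlinarith

lemma local_gain_five (hA : #A = 5) (ha : 0 < a) (h : a ≤ #(A.image c)ᶜ) :
    log 3 - (log 3 - log 2) / 4 * #(monoPairs c A) ≤ log (4 / (a : ℝ)) := by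
  have hb := image_card_bounds ha h
  have h1 := le_card_monoPairs c A 1
  have h2 := le_card_monoPairs c A 2
  have h3 := le_card_monoPairs c A 4
  have h0 := local_gain_one (by omega) ha h
  have hj0 : 0 < #(A.image c) := card_pos.2 ((card_pos.1 (by omega)).image c)
  have hj : #(A.image c) ≤ 4 := by omega
  have hlog := three_mul_log_two_le
  have hpos := log_pos (show (1 : ℝ) < 2 by norm_num)
  have h43 : log 3 ≤ 2 * log 2 := by
    simpa using mul_log_le_of_pow_le (a := 2) (b := 3) (p := 2) (q := 1) (by norm_num) (by norm_num)
  rw [hA] at h1 h2 h3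
  generalize #(monoPairs c A) = Y at *
  generalize #(A.image c) = j at *
  have hY0 : (0 : ℝ) ≤ Y := Nat.cast_nonneg Y
  interval_cases j
  · have hY : (20 : ℝ) ≤ Y := by norm_num at h3; exact_mod_cast h3
    nlinarith
  · have hY : (8 : ℝ) ≤ Y := by norm_num at h2; exact_mod_cast h2
    have := log_four_div_ge (m := 3) ha (by omega)
    push_cast at this
    nlinarith
  · have hY : (4 : ℝ) ≤ Y := by norm_num at h1; exact_mod_cast h1
    have := log_four_div_ge (m := 2) ha (by omega)
    push_cast at this
    nlinarith
  · have := log_four_div_ge (m := 1) ha (by omega)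
    push_cast at this
    rw [log_one] at this
    nlinarith

lemma local_weighted_gain_three (hA : #A = 3) (ha : 0 < a) (h : a ≤ #(A.image c)ᶜ) {α : ℕ}
    (hα : 0 < α) (hαA : α ≤ #(A.image c)ᶜ) :
    log 2 - 3 / 2 * (log 3 - log 2) * (#(monoPairs c A) * (1 / α)) ≤ log (4 / (a : ℝ)) := by
  have hb := image_card_bounds ha h
  have hb' := image_card_bounds hα hαA
  have h1 := le_card_monoPairs c A 1
  have h2 := le_card_monoPairs c A 2
  have h0 := local_gain_one (by omega) ha h
  have hj := card_image_le (s := A) (f := c)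
  have hj0 : 0 < #(A.image c) := card_pos.2 ((card_pos.1 (by omega)).image c)
  have hlog := three_mul_log_two_le
  have hpos := log_pos (show (1 : ℝ) < 2 by norm_num)
  rw [hA] at h1 h2 hj
  generalize #(monoPairs c A) = Y at *
  generalize #(A.image c) = j at *
  have hα' : (0 : ℝ) < α := by exact_mod_cast hα
  have hY0 : (0 : ℝ) ≤ Y * (1 / α) := by positivity
  interval_cases j
  · have hY : (3 / 2 : ℝ) ≤ Y * (1 / α) := by
      rw [mul_one_div, le_div_iff₀ hα']
      have hY : (6 : ℝ) ≤ Y := by norm_num at h2; exact_mod_cast h2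
      have : (α : ℝ) ≤ 4 := by exact_mod_cast (by omega : α ≤ 4)
      linarith
    nlinarith
  · have hY : (2 / 3 : ℝ) ≤ Y * (1 / α) := by
      rw [mul_one_div, le_div_iff₀ hα']
      have hY : (2 : ℝ) ≤ Y := by norm_num at h1; exact_mod_cast h1
      have : (α : ℝ) ≤ 3 := by exact_mod_cast (by omega : α ≤ 3)
      linarith
    have := log_four_div_ge (m := 3) ha (by omega)
    push_cast at this
    nlinarith
  · have := log_four_div_ge (m := 2) ha (by omega)
    push_cast at this
    nlinarith

lemma local_weighted_gain_four (hA : #A = 4) (ha : 0 < a) (h : a ≤ #(A.image c)ᶜ) {α : ℕ}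
    (hα : 0 < α) (hαA : α ≤ #(A.image c)ᶜ) :
    2 * log 2 - 3 / 4 * log 3 * (#(monoPairs c A) * (1 / α)) ≤ log (4 / (a : ℝ)) := by
  have hb := image_card_bounds ha h
  have hb' := image_card_bounds hα hαA
  have h1 := le_card_monoPairs c A 1
  have h2 := le_card_monoPairs c A 3
  have h0 := local_gain_one (by omega) ha h
  have hj := card_image_le (s := A) (f := c)
  have hj0 : 0 < #(A.image c) := card_pos.2 ((card_pos.1 (by omega)).image c)
  have hlog : 4 * log 2 ≤ 3 * log 3 := by
    simpa using mul_log_le_of_pow_le (a := 3) (b := 2) (p := 3) (q := 4) (by norm_num) (by norm_num)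
  have hpos := log_pos (show (1 : ℝ) < 3 by norm_num)
  rw [hA] at h1 h2 hj
  generalize #(monoPairs c A) = Y at *
  generalize #(A.image c) = j at *
  have hα' : (0 : ℝ) < α := by exact_mod_cast hα
  have hY0 : (0 : ℝ) ≤ Y * (1 / α) := by positivity
  interval_cases j
  · have hY : (3 : ℝ) ≤ Y * (1 / α) := by
      rw [mul_one_div, le_div_iff₀ hα']
      have hY : (12 : ℝ) ≤ Y := by norm_num at h2; exact_mod_cast h2
      have : (α : ℝ) ≤ 4 := by exact_mod_cast (by omega : α ≤ 4)
      linarith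
    nlinarith
  · have hY : (4 / 3 : ℝ) ≤ Y * (1 / α) := by
      rw [mul_one_div, le_div_iff₀ hα']
      have hY : (4 : ℝ) ≤ Y := by norm_num at h1; exact_mod_cast h1
      have : (α : ℝ) ≤ 3 := by exact_mod_cast (by omega : α ≤ 3)
      linarith
    have := log_four_div_ge (m := 3) ha (by omega)
    push_cast at this
    nlinarith
  · have hY : (1 : ℝ) ≤ Y * (1 / α) := by
      rw [mul_one_div, le_div_iff₀ hα']
      have hY : (2 : ℝ) ≤ Y := by norm_num at h1; exact_mod_cast h1
      have : (α : ℝ) ≤ 2 := by exact_mod_cast (by omega : α ≤ 2)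
      linarith
    have := log_four_div_ge (m := 2) ha (by omega)
    push_cast at this
    nlinarith
  · have := log_four_div_ge (m := 1) ha (by omega)
    push_cast at this
    rw [log_one] at this
    nlinarith

end Local

lemma le_sum_of_affine_le {ι : Type} {F : Finset ι} {X w : ι → ℝ} {C D W : ℝ} (hD : 0 ≤ D)
    (h : ∀ c ∈ F, C - D * w c ≤ X c) (hW : ∑ c ∈ F, w c ≤ W) :
    #F * C - D * W ≤ ∑ c ∈ F, X c := by
  have h1 := sum_le_sum h
  rw [sum_sub_distrib, sum_const, nsmul_eq_mul, ← mul_sum] at h1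
  have := mul_le_mul_of_nonneg_left hW hD
  linarith

section Averages

variable {V : Type} [DecidableEq V] {F : Finset (V → Fin 5)} {A : Finset V}
  {a : (V → Fin 5) → ℕ}

lemma gain_two_le_sum (ha : ∀ c ∈ F, 0 < a c) (haA : ∀ c ∈ F, a c ≤ #(A.image c)ᶜ)
    {r : ℝ} (hr : 4 * r ≤ #F)
    (hpair : ∀ s ∈ A, ∀ t ∈ A, s ≠ t → #(F.filter fun c => c s = c t) ≤ r) (hA : #A = 2) :
    #F * (3 / 4 * (2 * log 2 - log 3)) ≤ ∑ c ∈ F, log (4 / (a c : ℝ)) := by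
  have hsum := sum_card_monoPairs_mul_le (F := F) (A := A) (w := fun _ => 1) (r := r)
    (fun s hs t ht hst => by simpa using hpair s hs t ht hst)
  simp only [mul_one] at hsum
  have h43 : 0 ≤ 2 * log 2 - log 3 := by
    simpa using mul_log_le_of_pow_le (a := 2) (b := 3) (p := 2) (q := 1) (by norm_num) (by norm_num)
  have := le_sum_of_affine_le (by positivity) (fun c hc =>
      local_gain_two hA (ha c hc) (haA c hc)) hsum
  rw [hA] at this
  push_cast at this
  nlinarith

lemma gainFive_le_sum (ha : ∀ c ∈ F, 0 < a c) (haA : ∀ c ∈ F, a c ≤ #(A.image c)ᶜ)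
    {r : ℝ} (hr : 4 * r ≤ #F)
    (hpair : ∀ s ∈ A, ∀ t ∈ A, s ≠ t → #(F.filter fun c => c s = c t) ≤ r) (hA : #A ≤ 5) :
    #F * gainFive #A ≤ ∑ c ∈ F, log (4 / (a c : ℝ)) := by
  have hsum := sum_card_monoPairs_mul_le (F := F) (A := A) (w := fun _ => 1) (r := r)
    (fun s hs t ht hst => by simpa using hpair s hs t ht hst)
  simp only [mul_one] at hsum
  have hl : 0 ≤ log 3 - log 2 := by
    linarith [three_mul_log_two_le, log_pos (show (1 : ℝ) < 2 by norm_num)]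
  obtain hA | hA | hA | hA | hA | hA : #A = 0 ∨ #A = 1 ∨ #A = 2 ∨ #A = 3 ∨ #A = 4 ∨ #A = 5 := by
    omega
  · rw [hA, ← nsmul_eq_mul, ← sum_const]
    exact sum_le_sum fun c hc => local_gain_zero (ha c hc) (haA c hc)
  · rw [hA, ← nsmul_eq_mul, ← sum_const]
    exact sum_le_sum fun c hc => local_gain_one (by omega) (ha c hc) (haA c hc)
  · rw [hA]
    exact gain_two_le_sum ha haA hr hpair hA
  · have := le_sum_of_affine_le (by positivity) (fun c hc =>
      local_gain_three hA (ha c hc) (haA c hc)) hsum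
    rw [hA] at this ⊢
    push_cast at this
    simp only [gainFive]
    nlinarith
  · have := le_sum_of_affine_le (by positivity) (fun c hc =>
      local_gain_four hA (ha c hc) (haA c hc)) hsum
    rw [hA] at this ⊢
    push_cast at this
    simp only [gainFive]
    nlinarith
  · have := le_sum_of_affine_le (by positivity) (fun c hc =>
      local_gain_five hA (ha c hc) (haA c hc)) hsum
    rw [hA] at this ⊢
    push_cast at this
    simp only [gainFive]
    nlinarith

lemma gainFour_le_sum (ha : ∀ c ∈ F, 0 < a c) (haA : ∀ c ∈ F, a c ≤ #(A.image c)ᶜ)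
    {r : ℝ} (hr : 4 * r ≤ #F)
    (hpair : ∀ s ∈ A, ∀ t ∈ A, s ≠ t → #(F.filter fun c => c s = c t) ≤ r)
    {α : (V → Fin 5) → ℕ} (hα : ∀ c ∈ F, 0 < α c) (hαA : ∀ c ∈ F, α c ≤ #(A.image c)ᶜ)
    {r' : ℝ} (hr' : 16 * r' ≤ #F)
    (hpair' : ∀ s ∈ A, ∀ t ∈ A, s ≠ t →
      ∑ c ∈ F.filter (fun c => c s = c t), (1 / (α c : ℝ)) ≤ r') (hA : #A ≤ 4) :
    #F * gainFour #A ≤ ∑ c ∈ F, log (4 / (a c : ℝ)) := by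
  have hsum := sum_card_monoPairs_mul_le (F := F) (A := A) hpair'
  have hpos := log_pos (show (1 : ℝ) < 3 by norm_num)
  have hl : 0 ≤ log 3 - log 2 := by
    linarith [three_mul_log_two_le, log_pos (show (1 : ℝ) < 2 by norm_num)]
  obtain hA | hA | hA | hA | hA : #A = 0 ∨ #A = 1 ∨ #A = 2 ∨ #A = 3 ∨ #A = 4 := by
    omega
  · rw [hA, ← nsmul_eq_mul, ← sum_const]
    exact sum_le_sum fun c hc => local_gain_zero (ha c hc) (haA c hc)
  · rw [hA, ← nsmul_eq_mul, ← sum_const]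
    exact sum_le_sum fun c hc => local_gain_one (by omega) (ha c hc) (haA c hc)
  · rw [hA]
    exact gain_two_le_sum ha haA hr hpair hA
  · have := le_sum_of_affine_le (by positivity) (fun c hc =>
      local_weighted_gain_three hA (ha c hc) (haA c hc) (hα c hc) (hαA c hc)) hsum
    rw [hA] at this ⊢
    push_cast at this
    simp only [gainFour]
    nlinarith
  · have := le_sum_of_affine_le (by positivity) (fun c hc =>
      local_weighted_gain_four hA (ha c hc) (haA c hc) (hα c hc) (hαA c hc)) hsum
    rw [hA] at this ⊢
    push_cast at this
    simp only [gainFour]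
    nlinarith

end Averages

/-- If every vertex has, on average over the colourings, a large gain in terms of the number of
earlier elements of a set of neighbours, then there are few colourings. -/
lemma entropy_absurd {V : Type} [Fintype V] [DecidableEq V] {G : SimpleGraph V}
    [DecidableRel G.Adj] (hn : 9 ≤ Fintype.card V)
    (hP : 15 * 4 ^ Fintype.card V < 128 * #(properFive G))
    (h : ∀ v, ∃ B : Finset V, ∃ g : ℕ → ℝ, v ∉ B ∧
      (#B + 1) * log (128 / 15) ≤ 9 * ∑ b ∈ range (#B + 1), g b ∧
      ∀ e : V ≃ Fin (Fintype.card V), #(properFive G) * g #(B.filter fun u => e u < e v) ≤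
        ∑ c ∈ properFive G, log (4 / (#((earlier G e v).image c)ᶜ : ℝ))) : False := by
  set n := Fintype.card V with hndef
  have hP0 : 0 < #(properFive G) := by
    by_contra h0
    rw [Nat.eq_zero_of_not_pos h0] at hP
    simp at hP
  have hPR : (15 * 4 ^ n : ℝ) < 128 * (#(properFive G) : ℕ) := by exact_mod_cast hP
  have hPpos : (0 : ℝ) < (#(properFive G) : ℕ) := by exact_mod_cast hP0
  generalize hPdef : ((#(properFive G) : ℕ) : ℝ) = P at *
  have hL : 0 < log (128 / 15 : ℝ) := log_pos (by norm_num)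
  have hE : (0 : ℝ) < Fintype.card (V ≃ Fin n) := by
    have : Nonempty (V ≃ Fin n) := ⟨Fintype.equivFin V⟩
    exact_mod_cast Fintype.card_pos
  have hupper : ∀ e : V ≃ Fin n, ∑ v, ∑ c ∈ properFive G,
      log (4 / (#((earlier G e v).image c)ᶜ : ℝ)) < P * log (128 / 15) := by
    intro e
    rw [sum_comm]
    refine (sum_sum_log_le G e hP0).trans_lt ?_
    rw [hPdef]
    refine mul_lt_mul_of_pos_left (log_lt_log (by positivity) ?_) hPpos
    rw [div_lt_div_iff₀ hPpos (by norm_num)]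
    linarith
  have hlower : ∀ v, P * Fintype.card (V ≃ Fin n) * log (128 / 15) ≤
      9 * ∑ e : V ≃ Fin n, ∑ c ∈ properFive G,
        log (4 / (#((earlier G e v).image c)ᶜ : ℝ)) := by
    intro v
    obtain ⟨B, g, hvB, hg, hBe⟩ := h v
    have h1 := sum_le_sum fun (e : V ≃ Fin n) (_ : e ∈ univ) => hBe e
    rw [← mul_sum] at h1
    have h2 := sum_equiv_card_filter_lt (n := n) hvB g
    have hB : (0 : ℝ) < #B + 1 := by positivity
    set S := ∑ e : V ≃ Fin n, g #(B.filter fun u => e u < e v)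
    have h3 : Fintype.card (V ≃ Fin n) * log (128 / 15) ≤ 9 * S := by
      refine le_of_mul_le_mul_left ?_ hB
      calc _ = Fintype.card (V ≃ Fin n) * ((#B + 1) * log (128 / 15)) := by ring
        _ ≤ Fintype.card (V ≃ Fin n) * (9 * ∑ b ∈ range (#B + 1), g b) := by gcongr
        _ = 9 * ((#B + 1) * S) := by rw [h2]; ring
        _ = _ := by ring
    have h4 := mul_le_mul_of_nonneg_left h3 hPpos.le
    linarith
  have h1 := sum_le_sum fun v (_ : v ∈ (univ : Finset V)) => hlower v
  rw [sum_const, card_univ, ← hndef, nsmul_eq_mul, ← mul_sum, sum_comm] at h1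
  have h2 : ∑ e : V ≃ Fin n, ∑ v, ∑ c ∈ properFive G,
      log (4 / (#((earlier G e v).image c)ᶜ : ℝ)) <
        ∑ _e : V ≃ Fin n, P * log (128 / 15) :=
    sum_lt_sum_of_nonempty ⟨Fintype.equivFin V, mem_univ _⟩ fun e _ => hupper e
  rw [sum_const, card_univ, nsmul_eq_mul] at h2
  have h3 : (9 : ℝ) ≤ n := by exact_mod_cast hn
  have h4 : 0 < P * Fintype.card (V ≃ Fin n) * log (128 / 15) := by positivity
  nlinarith

/-- A minimal counterexample is vertex-critical. -/
lemma fourColorableOn_of_ssubset_of_lt {W : Type} [Fintype W] {H : SimpleGraph W} {m : ℕ}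
    (ih : ∀ k < m, FiveColouringBound k) (hcard : Fintype.card W = m) (hconn : H.Connected)
    (hP : 15 * 4 ^ m < 128 * #(properFive H)) (T : Set W) (hT : T ⊂ Set.univ) :
    FourColorableOn H T := by
  classical
  by_contra hTcol
  obtain ⟨S, ⟨hSu, hScol⟩, hSmin⟩ := (wellFounded_lt (α := Set W)).has_min
    {S | S ⊂ Set.univ ∧ ¬ FourColorableOn H S} ⟨T, hT, hTcol⟩
  have hSconn : (H.induce S).Connected := induce_connected_of_minimal hScol fun T hTS => by
    by_contra h
    exact hSmin T ⟨hTS.trans hSu, h⟩ hTS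
  have hne : S.Nonempty := Set.nonempty_coe_sort.1 hSconn.nonempty
  have hlt : Fintype.card S < m := by
    rw [← hcard]
    obtain ⟨x, hx⟩ := (Set.ne_univ_iff_exists_notMem S).1 hSu.ne
    exact Fintype.card_subtype_lt hx
  have h1 := card_properFive_le_of_connected hconn S hne
  have h2 := ih _ hlt (H.induce S) rfl hSconn fun h => hScol (fourColorableOn_of_induce h)
  have h3 : 4 ^ m = 4 ^ (m - Fintype.card S) * 4 ^ Fintype.card S := by
    rw [← pow_add, Nat.sub_add_cancel hlt.le]
  rw [hcard] at h1
  have h4 := Nat.mul_le_mul_left (4 ^ (m - Fintype.card S)) h2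
  rw [h3] at hP
  nlinarith

lemma free_neighborFinset_pos {V : Type} [Fintype V] [DecidableEq V] {G : SimpleGraph V}
    [DecidableRel G.Adj] {c : V → Fin 5} (hc : c ∈ properFive G) (v : V) :
    0 < #((G.neighborFinset v).image c)ᶜ := by
  refine card_pos.2 ⟨c v, ?_⟩
  rw [mem_compl, mem_image]
  rintro ⟨u, hu, h⟩
  rw [SimpleGraph.mem_neighborFinset] at hu
  exact mem_properFive.1 hc v u hu h.symm

lemma fiveColouringBound (m : ℕ) : FiveColouringBound m := by
  induction m using Nat.strong_induction_on with
  | _ m ih =>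
  intro W _ H hcard hconn hcol
  classical
  by_contra! hP
  have hG : ¬ FourColorableOn H Set.univ := fun h => hcol (fourColorableOn_univ.1 h)
  have hmin := fourColorableOn_of_ssubset_of_lt ih hcard hconn hP
  have hcompl : ∀ p : W, ({p}ᶜ : Set W) ⊂ Set.univ := fun p =>
    Set.ssubset_univ_iff.2 fun h => by
      have : p ∈ ({p}ᶜ : Set W) := h ▸ trivial
      exact this rfl
  have hdeg : ∀ p, 4 ≤ H.degree p := by
    intro p
    obtain ⟨f, hf⟩ := hmin _ (hcompl p)
    exact (four_le_card_image_of_critical hG p hf).trans card_image_le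
  obtain ⟨x⟩ := hconn.nonempty
  have hm5 : 5 ≤ m := by
    have h1 := hdeg x
    have h2 := H.degree_lt_card_verts x
    omega
  have hPR : (15 * 4 ^ m : ℝ) < 128 * (#(properFive H) : ℕ) := by exact_mod_cast hP
  obtain ⟨k, rfl⟩ : ∃ k, m = k + 2 := ⟨m - 2, by omega⟩
  have hpair : ∀ s t, s ≠ t → (#((properFive H).filter fun c => c s = c t) : ℝ) ≤
      15 * 4 ^ (k + 1) / 128 := by
    intro s t hst
    have := card_filter_eq_le_of_merge hconn hst
      (fun f hf => (hcol ⟨SimpleGraph.Coloring.mk f fun {u v} h => hf u v h⟩).elim)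
      hcard (ih (k + 1) (by omega))
    rw [le_div_iff₀ (by norm_num), mul_comm]
    exact_mod_cast this
  have hr : 4 * (15 * 4 ^ (k + 1) / 128 : ℝ) < #(properFive H) := by
    rw [pow_succ] at hPR
    linarith
  have hr' : 16 * (15 * 4 ^ k / 128 : ℝ) < #(properFive H) := by
    rw [pow_succ, pow_succ] at hPR
    linarith
  obtain h5 | h5 : k + 2 = 5 ∨ 6 ≤ k + 2 := by omega
  · rw [card_properFive_eq_of_card_eq_five hdeg (hcard.trans h5), h5] at hP
    norm_num at hP
  obtain h8 | h9 := le_or_gt (k + 2) 8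
  · exact card_le_eight_absurd hdeg (by positivity) hr hpair (h5.trans hcard.ge) (hcard.trans_le h8)
  refine entropy_absurd (G := H) (by omega) (by rwa [hcard]) fun v => ?_
  have hsub : ∀ (B : Finset W) (e : W ≃ Fin (Fintype.card W)), B ⊆ H.neighborFinset v →
      B.filter (fun u => e u < e v) ⊆ earlier H e v := fun B e hB =>
    filter_subset_filter _ hB
  have hanti : ∀ {A B : Finset W} (c : W → Fin 5), A ⊆ B → #(B.image c)ᶜ ≤ #(A.image c)ᶜ :=
    fun c h => card_le_card (compl_subset_compl.2 (image_subset_image h))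
  obtain h4 | h4 := (hdeg v).eq_or_lt
  · rw [← SimpleGraph.card_neighborFinset_eq_degree] at h4
    refine ⟨H.neighborFinset v, gainFour, by simp, ?_, fun e => ?_⟩
    · rw [← h4]
      have := sum_gainFour
      norm_num at this ⊢
      exact this
    · refine gainFour_le_sum (fun c hc => free_earlier_pos e hc v)
        (fun c _ => hanti c (hsub _ e subset_rfl)) hr.le (fun s _ t _ => hpair s t)
        (α := fun c => #((H.neighborFinset v).image c)ᶜ)
        (fun c hc => free_neighborFinset_pos hc v)
        (fun c _ => hanti c (filter_subset _ _)) hr'.le (fun s hs t ht hst => ?_)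
        ((card_filter_le _ _).trans h4.ge)
      have hs' : s ∈ H.neighborFinset v := (mem_filter.1 hs).1
      have ht' : t ∈ H.neighborFinset v := (mem_filter.1 ht).1
      have hvs : H.Adj v s := by simpa using hs'
      have hvt : H.Adj v t := by simpa using ht'
      have := sum_inv_free_le hvs hvt hst
        (induce_compl_connected_of_critical hG hmin hvs.ne.symm) (fun f hf hfst => ?_)
        hcard (ih k (by omega))
      · rw [le_div_iff₀ (by norm_num), mul_comm]
        exact this
      · have h1 := four_le_card_image_of_critical hG v hf
        have h2 : #((H.neighborFinset v).image f) = #(H.neighborFinset v) :=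
          le_antisymm card_image_le (h4.ge.trans h1)
        exact hst (card_image_iff.1 h2 hs' ht' hfst)
  · rw [← SimpleGraph.card_neighborFinset_eq_degree] at h4
    obtain ⟨B, hB, hB5⟩ := exists_subset_card_eq (Nat.succ_le_of_lt h4)
    refine ⟨B, gainFive, fun h => by simpa using hB h, ?_, fun e => ?_⟩
    · rw [hB5]
      have := sum_gainFive
      norm_num at this ⊢
      exact this
    · exact gainFive_le_sum (fun c hc => free_earlier_pos e hc v)
        (fun c _ => hanti c (hsub B e hB)) hr.le (fun s _ t _ => hpair s t)
        ((card_filter_le _ _).trans hB5.le)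

lemma numColorings_five_eq {V : Type} [Fintype V] (G : SimpleGraph V) :
    numColorings G 5 = #(properFive G) := by
  classical
  rw [numColorings, Nat.card_eq_fintype_card, Fintype.card_subtype]
  congr 1

end Gains

/-- Every connected graph `G` on `n` vertices with chromatic number exactly `5` has at most
`5!·4^(n-5)` proper colourings with `5` labelled colours. -/
theorem tomescu_five_colourings {V : Type} [Fintype V] (G : SimpleGraph V)
    (hconn : G.Connected) (hchrom : G.chromaticNumber = 5) :
    numColorings G 5 ≤ Nat.factorial 5 * 4 ^ (Fintype.card V - 5) := by
  have hcol : ¬ G.Colorable 4 := by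
    intro h
    have := h.chromaticNumber_le
    rw [hchrom] at this
    exact absurd this (by norm_num)
  have h5 : 5 ≤ Fintype.card V := by
    by_contra! h
    exact hcol (G.colorable_of_fintype.mono (by omega))
  have h := fiveColouringBound _ G rfl hconn hcol
  rw [numColorings_five_eq, show Nat.factorial 5 = 120 from rfl]
  obtain ⟨d, hd⟩ := Nat.exists_eq_add_of_le h5
  rw [hd, pow_add] at h
  rw [hd, Nat.add_sub_cancel_left]
  norm_num at h
  linarith
end

section
/- Let G be a connected graph on n vertices with chromatic number exactly 4, and let y ≥ 3 be an integer. Then the number of proper colourings of G with y+1 colours satisfies Q_G(y) ≤ (y+1)·y^{n-3}·(y-1)·(y-2). -/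
section Entropy

variable {V α β : Type*}

open Classical in
/-- The members of `F` that agree with `f` on `S`. -/
noncomputable def agreeOn (F : Finset (V → α)) (S : Finset V) (f : V → α) : Finset (V → α) :=
  F.filter fun g => ∀ v ∈ S, g v = f v

/-- `F.card` times the Shannon entropy of the restriction to `S` of a uniformly random member
of `F`. -/
noncomputable def totalEntropy (F : Finset (V → α)) (S : Finset V) : ℝ :=
  ∑ f ∈ F, Real.log (F.card / (agreeOn F S f).card)

theorem mem_agreeOn {F : Finset (V → α)} {S : Finset V} {f g : V → α} :
    g ∈ agreeOn F S f ↔ g ∈ F ∧ ∀ v ∈ S, g v = f v := by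
  classical
  simp [agreeOn]

theorem agreeOn_card_pos {F : Finset (V → α)} (S : Finset V) {f : V → α} (hf : f ∈ F) :
    0 < (agreeOn F S f).card :=
  Finset.card_pos.2 ⟨f, mem_agreeOn.2 ⟨hf, fun _ _ => rfl⟩⟩

theorem agreeOn_congr {F : Finset (V → α)} {S : Finset V} {f g : V → α}
    (hg : g ∈ agreeOn F S f) : agreeOn F S g = agreeOn F S f := by
  ext h
  rw [mem_agreeOn] at hg
  simp only [mem_agreeOn, and_congr_right_iff]
  intro _
  exact forall₂_congr fun v hv => by rw [hg.2 v hv]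

theorem sum_inv_card_fiber {ι : Type*} [DecidableEq β] (A : Finset ι) (φ : ι → β) :
    ∑ f ∈ A, (1 : ℝ) / (A.filter fun h => φ h = φ f).card = (A.image φ).card := by
  rw [← Finset.sum_fiberwise_of_maps_to (g := φ) (t := A.image φ)
    (fun i hi => Finset.mem_image_of_mem _ hi), Finset.card_eq_sum_ones, Nat.cast_sum]
  refine Finset.sum_congr rfl fun b hb => ?_
  obtain ⟨i, hi, rfl⟩ := Finset.mem_image.1 hb
  have h : ∀ f ∈ A.filter (fun h => φ h = φ i),
      (1 : ℝ) / (A.filter fun h => φ h = φ f).card = 1 / (A.filter fun h => φ h = φ i).card := by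
    intro f hf
    rw [(Finset.mem_filter.1 hf).2]
  rw [Finset.sum_congr rfl h, Finset.sum_const, nsmul_eq_mul, mul_one_div_cancel]
  · simp
  · have : 0 < (A.filter fun h => φ h = φ i).card :=
      Finset.card_pos.2 ⟨i, Finset.mem_filter.2 ⟨hi, rfl⟩⟩
    positivity

/-- Chain rule: revealing `S'` after `S` costs at most the expected logarithm of the number of
values that the additional information `φ` may take. -/
theorem totalEntropy_le_add [DecidableEq β] (F : Finset (V → α)) {S S' : Finset V}
    (φ : (V → α) → β) (a : (V → α) → ℝ)
    (hφ : ∀ f ∈ F, ∀ g ∈ agreeOn F S f, φ g = φ f → ∀ v ∈ S', g v = f v)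
    (ha : ∀ f ∈ F, (((agreeOn F S f).image φ).card : ℝ) ≤ a f)
    (hconst : ∀ f ∈ F, ∀ g ∈ agreeOn F S f, a g = a f) :
    totalEntropy F S' ≤ totalEntropy F S + ∑ f ∈ F, Real.log (a f) := by
  have hapos : ∀ f ∈ F, 0 < a f := by
    intro f hf
    refine lt_of_lt_of_le ?_ (ha f hf)
    have : 0 < ((agreeOn F S f).image φ).card :=
      Finset.card_pos.2 (Finset.Nonempty.image (Finset.card_pos.1 (agreeOn_card_pos S hf)) φ)
    exact_mod_cast this
  have hpoint : ∀ f ∈ F, Real.log (F.card / (agreeOn F S' f).card) ≤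
      Real.log (F.card / (agreeOn F S f).card) + Real.log (a f) +
        ((agreeOn F S f).card / ((agreeOn F S' f).card * a f) - 1) := by
    intro f hf
    have hF : (0 : ℝ) < F.card := by exact_mod_cast Finset.card_pos.2 ⟨f, hf⟩
    have hN : (0 : ℝ) < (agreeOn F S f).card := by exact_mod_cast agreeOn_card_pos S hf
    have hN' : (0 : ℝ) < (agreeOn F S' f).card := by exact_mod_cast agreeOn_card_pos S' hf
    have ha' := hapos f hf
    have hlog := Real.log_le_sub_one_of_pos
      (show (0 : ℝ) < (agreeOn F S f).card / ((agreeOn F S' f).card * a f) by positivity)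
    rw [Real.log_div hN.ne' (by positivity), Real.log_mul hN'.ne' ha'.ne'] at hlog
    rw [Real.log_div hF.ne' hN'.ne', Real.log_div hF.ne' hN.ne']
    linarith
  have hsum : ∑ f ∈ F, ((agreeOn F S f).card / ((agreeOn F S' f).card * a f) : ℝ) ≤ F.card := by
    have h1 : ∀ f ∈ F, ((agreeOn F S f).card / ((agreeOn F S' f).card * a f) : ℝ) =
        ∑ _g ∈ agreeOn F S f, (1 : ℝ) / ((agreeOn F S' f).card * a f) := by
      intro f _
      rw [Finset.sum_const, nsmul_eq_mul, mul_one_div]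
    rw [Finset.sum_congr rfl h1]
    have hswap : ∑ f ∈ F, ∑ _g ∈ agreeOn F S f, (1 : ℝ) / ((agreeOn F S' f).card * a f) =
        ∑ g ∈ F, ∑ f ∈ agreeOn F S g, (1 : ℝ) / ((agreeOn F S' f).card * a f) := by
      refine Finset.sum_comm' fun f g => ?_
      simp only [mem_agreeOn]
      constructor
      · rintro ⟨hf, hg, h⟩
        exact ⟨⟨hf, fun v hv => (h v hv).symm⟩, hg⟩
      · rintro ⟨⟨hf, h⟩, hg⟩
        exact ⟨hf, hg, fun v hv => (h v hv).symm⟩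
    rw [hswap]
    have h2 : ∀ g ∈ F,
        ∑ f ∈ agreeOn F S g, (1 : ℝ) / ((agreeOn F S' f).card * a f) ≤ 1 := by
      intro g hg
      have hag := hapos g hg
      calc ∑ f ∈ agreeOn F S g, (1 : ℝ) / ((agreeOn F S' f).card * a f)
          ≤ ∑ f ∈ agreeOn F S g,
              (1 : ℝ) / ((agreeOn F S g).filter fun h => φ h = φ f).card * (1 / a g) := by
            refine Finset.sum_le_sum fun f hf => ?_
            have hfF := (mem_agreeOn.1 hf).1
            rw [hconst g hg f hf, one_div_mul_one_div]
            have hpos : 0 < ((agreeOn F S g).filter fun h => φ h = φ f).card :=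
              Finset.card_pos.2 ⟨f, Finset.mem_filter.2 ⟨hf, rfl⟩⟩
            have hle : ((agreeOn F S g).filter fun h => φ h = φ f).card ≤
                (agreeOn F S' f).card := by
              refine Finset.card_le_card fun h hh => ?_
              obtain ⟨hh1, hh2⟩ := Finset.mem_filter.1 hh
              rw [← agreeOn_congr hf] at hh1
              exact mem_agreeOn.2 ⟨(mem_agreeOn.1 hh1).1, hφ f hfF h hh1 hh2⟩
            gcongr
        _ = ((agreeOn F S g).image φ).card * (1 / a g) := by
            rw [← Finset.sum_mul, sum_inv_card_fiber]
        _ ≤ a g * (1 / a g) := by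
            gcongr
            exact ha g hg
        _ = 1 := mul_one_div_cancel hag.ne'
    calc _ ≤ ∑ _g ∈ F, (1 : ℝ) := Finset.sum_le_sum h2
      _ = F.card := by simp
  have := Finset.sum_le_sum hpoint
  rw [Finset.sum_add_distrib, Finset.sum_add_distrib, Finset.sum_sub_distrib] at this
  simp only [Finset.sum_const, nsmul_eq_mul, mul_one] at this
  unfold totalEntropy
  linarith

theorem totalEntropy_empty (F : Finset (V → α)) : totalEntropy F ∅ = 0 := by
  refine Finset.sum_eq_zero fun f hf => ?_
  have hF : (F.card : ℝ) ≠ 0 := by exact_mod_cast (Finset.card_pos.2 ⟨f, hf⟩).ne'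
  have : agreeOn F ∅ f = F := by
    ext g
    simp [mem_agreeOn]
  rw [this, div_self hF, Real.log_one]

theorem totalEntropy_univ [Fintype V] (F : Finset (V → α)) :
    totalEntropy F Finset.univ = F.card * Real.log F.card := by
  have h : ∀ f ∈ F, Real.log (F.card / (agreeOn F Finset.univ f).card) = Real.log F.card := by
    intro f hf
    have : agreeOn F Finset.univ f = {f} := by
      ext g
      simp only [mem_agreeOn, Finset.mem_univ, true_implies, Finset.mem_singleton]
      exact ⟨fun h => funext h.2, fun h => by subst h; exact ⟨hf, fun _ => rfl⟩⟩
    rw [this]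
    simp
  rw [totalEntropy, Finset.sum_congr rfl h, Finset.sum_const, nsmul_eq_mul]

end Entropy

section Savings

/-- The saving of a vertex that sees one repeated colour. -/
noncomputable def saveOne (y : ℕ) : ℝ := Real.log (y / (y - 1))

/-- The saving of a vertex that sees three different colours. -/
noncomputable def saveTwo (y : ℕ) : ℝ := Real.log (y / (y - 2))

/-- The saving of a vertex with two earlier neighbours that are rarely equal. -/
noncomputable def savePair (y : ℕ) : ℝ := saveOne y - 1 / y * saveOne y

/-- The saving of a vertex with three earlier neighbours that are rarely equal. -/
noncomputable def saveTriple (y : ℕ) : ℝ := saveTwo y - 3 * (1 / y * (saveTwo y - saveOne y))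

/-- The saving of a vertex with three earlier neighbours that are rarely equal, two of which are
adjacent. -/
noncomputable def saveTripleEdge (y : ℕ) : ℝ :=
  saveTwo y - 2 * (1 / y * (saveTwo y - saveOne y))

theorem saveOne_nonneg {y : ℕ} (hy : 3 ≤ y) : 0 ≤ saveOne y := by
  have : (3 : ℝ) ≤ y := by exact_mod_cast hy
  exact Real.log_nonneg (by rw [le_div_iff₀ (by linarith)]; linarith)

theorem two_mul_saveOne_le {y : ℕ} (hy : 3 ≤ y) : 2 * saveOne y ≤ saveTwo y := by
  have : (3 : ℝ) ≤ y := by exact_mod_cast hy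
  have h : 2 * saveOne y = Real.log ((y / (y - 1)) ^ 2) := by
    rw [Real.log_pow]
    norm_num [saveOne]
  rw [h, saveTwo]
  refine Real.log_le_log (pow_pos (div_pos (by linarith) (by linarith)) 2) ?_
  rw [div_pow, div_le_div_iff₀ (by nlinarith) (by linarith)]
  nlinarith

theorem log_sub_one_eq {y : ℕ} (hy : 3 ≤ y) : Real.log ((y : ℝ) - 1) = Real.log y - saveOne y := by
  have : (3 : ℝ) ≤ y := by exact_mod_cast hy
  rw [saveOne, Real.log_div (by linarith) (by linarith)]
  ring

theorem log_sub_two_eq {y : ℕ} (hy : 3 ≤ y) : Real.log ((y : ℝ) - 2) = Real.log y - saveTwo y := by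
  have : (3 : ℝ) ≤ y := by exact_mod_cast hy
  rw [saveTwo, Real.log_div (by linarith) (by linarith)]
  ring

variable {V : Type*}

open Classical in
/-- The proper colourings of `G` with `x` colours, as a finset. -/
noncomputable def properColorings [Fintype V] (G : SimpleGraph V) (x : ℕ) :
    Finset (V → Fin x) :=
  Finset.univ.filter fun f => ∀ u v : V, G.Adj u v → f u ≠ f v

theorem mem_properColorings [Fintype V] {G : SimpleGraph V} {x : ℕ} {f : V → Fin x} :
    f ∈ properColorings G x ↔ ∀ u v : V, G.Adj u v → f u ≠ f v := by
  simp [properColorings]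

/-- The number of proper colourings of `G` in which `a` and `b` have the same colour. -/
noncomputable def equalCount [Fintype V] (G : SimpleGraph V) (x : ℕ) (a b : V) : ℕ :=
  ((properColorings G x).filter fun f => f a = f b).card

theorem equalCount_of_adj [Fintype V] {G : SimpleGraph V} {x : ℕ} {a b : V} (h : G.Adj a b) :
    equalCount G x a b = 0 := by
  rw [equalCount, Finset.card_eq_zero, Finset.filter_eq_empty_iff]
  exact fun f hf => mem_properColorings.1 hf a b h

/-- The restriction to `S` of a random proper colouring has entropy smaller by at least `d` than
the largest entropy that a connected graph on `S` allows. -/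
def EntropyDeficit [Fintype V] (G : SimpleGraph V) (y : ℕ) (S : Finset V) (d : ℝ) : Prop :=
  totalEntropy (properColorings G (y + 1)) S ≤
    (properColorings G (y + 1)).card * (Real.log (y + 1) + (S.card - 1) * Real.log y - d)

theorem EntropyDeficit.mono [Fintype V] {G : SimpleGraph V} {y : ℕ} {S : Finset V}
    {d d' : ℝ} (h : EntropyDeficit G y S d) (hd : d' ≤ d) :
    EntropyDeficit G y S d' := by
  unfold EntropyDeficit at h ⊢
  refine h.trans ?_
  gcongr

theorem sum_ite_eq_equalCount [Fintype V] (G : SimpleGraph V) (x : ℕ) (a b : V) (k : ℝ) :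
    ∑ f ∈ properColorings G x, (if f a = f b then k else 0) = equalCount G x a b * k := by
  rw [← Finset.sum_filter, Finset.sum_const, nsmul_eq_mul, equalCount]

/-- Distinct vertices receive equal colours with probability at most `1 / y`. -/
def RarelyEqual [Fintype V] (G : SimpleGraph V) (y : ℕ) : Prop :=
  ∀ a b : V, a ≠ b → y * equalCount G (y + 1) a b ≤ (properColorings G (y + 1)).card

theorem RarelyEqual.equalCount_le [Fintype V] {G : SimpleGraph V} {y : ℕ} {a b : V}
    (hy : 3 ≤ y) (hG : RarelyEqual G y)
    (hab : a ≠ b) :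
    (equalCount G (y + 1) a b : ℝ) ≤ (properColorings G (y + 1)).card * (1 / y) := by
  have h3 : (3 : ℝ) ≤ y := by exact_mod_cast hy
  rw [mul_one_div, le_div_iff₀ (by linarith), mul_comm]
  exact_mod_cast hG a b hab

variable [Fintype V] [DecidableEq V] {G : SimpleGraph V} {y : ℕ} {S : Finset V} {w a b c : V}
  {d : ℝ}

theorem totalEntropy_insert_le (T : Finset V) (hTS : T ⊆ S) (hT : ∀ t ∈ T, G.Adj w t) :
    totalEntropy (properColorings G (y + 1)) (insert w S) ≤
      totalEntropy (properColorings G (y + 1)) S +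
        ∑ f ∈ properColorings G (y + 1), Real.log ((y : ℝ) + 1 - (T.image f).card) := by
  refine totalEntropy_le_add _ (fun f => f w) _ ?_ ?_ ?_
  · intro f _ g hg hgw v hv
    rcases Finset.mem_insert.1 hv with rfl | hv
    · exact hgw
    · exact (mem_agreeOn.1 hg).2 v hv
  · intro f _
    have hsub : (agreeOn (properColorings G (y + 1)) S f).image (fun f => f w) ⊆
        (T.image f)ᶜ := by
      intro k hk
      obtain ⟨g, hg, rfl⟩ := Finset.mem_image.1 hk
      rw [Finset.mem_compl, Finset.mem_image]
      rintro ⟨t, ht, htk⟩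
      rw [mem_agreeOn, mem_properColorings] at hg
      exact hg.1 w t (hT t ht) (by rw [hg.2 t (hTS ht), htk])
    have h1 := Finset.card_le_card hsub
    have h2 := Finset.card_add_card_compl (T.image f)
    rw [Fintype.card_fin] at h2
    have h3 : ((T.image f).card : ℝ) + (T.image f)ᶜ.card = y + 1 := by exact_mod_cast h2
    have h4 : (((agreeOn (properColorings G (y + 1)) S f).image (fun f => f w)).card : ℝ) ≤
        (T.image f)ᶜ.card := by exact_mod_cast h1
    linarith
  · intro f _ g hg
    have : T.image g = T.image f :=
      Finset.image_congr fun t ht => (mem_agreeOn.1 hg).2 t (hTS ht)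
    simp only [this]

theorem EntropyDeficit.insert_of_sum_log_le {s : ℝ} (h : EntropyDeficit G y S d) (hw : w ∉ S)
    (T : Finset V)
    (hTS : T ⊆ S) (hT : ∀ t ∈ T, G.Adj w t)
    (hs : ∑ f ∈ properColorings G (y + 1), Real.log ((y : ℝ) + 1 - (T.image f).card) ≤
      (properColorings G (y + 1)).card * (Real.log y - s)) :
    EntropyDeficit G y (insert w S) (d + s) := by
  have := totalEntropy_insert_le (y := y) T hTS hT
  unfold EntropyDeficit at h ⊢
  rw [Finset.card_insert_of_notMem hw]
  push_cast
  nlinarith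

theorem entropyDeficit_singleton (v : V) : EntropyDeficit G y {v} 0 := by
  have := totalEntropy_insert_le (G := G) (y := y) (w := v) (S := ∅) ∅ (by simp) (by simp)
  rw [totalEntropy_empty] at this
  simpa [EntropyDeficit] using this

theorem EntropyDeficit.insert_of_adj (h : EntropyDeficit G y S d) (hw : w ∉ S) (ha : a ∈ S)
    (hwa : G.Adj w a) : EntropyDeficit G y (insert w S) d := by
  rw [← add_zero d]
  refine h.insert_of_sum_log_le hw {a} (by simpa) (by simpa) ?_
  simp

theorem sum_log_pair_le (hy : 3 ≤ y) (a b : V) :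
    ∑ f ∈ properColorings G (y + 1),
      Real.log ((y : ℝ) + 1 - (({a, b} : Finset V).image f).card) ≤
    (properColorings G (y + 1)).card * (Real.log y - saveOne y) +
      equalCount G (y + 1) a b * saveOne y := by
  rw [← sum_ite_eq_equalCount, ← nsmul_eq_mul, ← Finset.sum_const, ← Finset.sum_add_distrib]
  refine Finset.sum_le_sum fun f _ => ?_
  rw [Finset.image_insert, Finset.image_singleton]
  split_ifs with h
  · simp [h]
  · rw [Finset.card_pair h, ← log_sub_one_eq hy]
    apply le_of_eq
    push_cast
    ring_nf

theorem sum_log_triple_le (hy : 3 ≤ y) (a b c : V) :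
    ∑ f ∈ properColorings G (y + 1),
      Real.log ((y : ℝ) + 1 - (({a, b, c} : Finset V).image f).card) ≤
    (properColorings G (y + 1)).card * (Real.log y - saveTwo y) +
      (equalCount G (y + 1) a b + equalCount G (y + 1) a c + equalCount G (y + 1) b c) *
        (saveTwo y - saveOne y) := by
  rw [add_mul, add_mul, ← sum_ite_eq_equalCount, ← sum_ite_eq_equalCount,
    ← sum_ite_eq_equalCount, ← nsmul_eq_mul, ← Finset.sum_const, ← Finset.sum_add_distrib,
    ← Finset.sum_add_distrib, ← Finset.sum_add_distrib]
  refine Finset.sum_le_sum fun f _ => ?_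
  rw [Finset.image_insert, Finset.image_insert, Finset.image_singleton]
  have h1 := log_sub_one_eq hy
  have h2 := log_sub_two_eq hy
  have h3 := two_mul_saveOne_le hy
  have h4 := saveOne_nonneg hy
  have e1 : (y : ℝ) + 1 - (2 : ℕ) = y - 1 := by push_cast; ring
  have e2 : (y : ℝ) + 1 - (3 : ℕ) = y - 2 := by push_cast; ring
  by_cases hab : f a = f b
  · by_cases hac : f a = f c
    · have hbc : f b = f c := hab.symm.trans hac
      rw [if_pos hab, if_pos hac, if_pos hbc, hab, hbc]
      simp only [Finset.pair_eq_singleton, Finset.card_singleton, Nat.cast_one,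
        add_sub_cancel_right]
      linarith
    · have hbc : f b ≠ f c := fun h => hac (hab.trans h)
      rw [if_pos hab, if_neg hac, if_neg hbc, hab, Finset.insert_eq_of_mem (by simp),
        Finset.card_pair hbc, e1, h1]
      linarith
  · by_cases hac : f a = f c
    · have hbc : f b ≠ f c := fun h => hab (hac.trans h.symm)
      rw [if_neg hab, if_pos hac, if_neg hbc, hac, Finset.insert_eq_of_mem (by simp),
        Finset.card_pair hbc, e1, h1]
      linarith
    · by_cases hbc : f b = f c
      · rw [if_neg hab, if_neg hac, if_pos hbc, hbc, Finset.pair_eq_singleton,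
          Finset.card_pair hac, e1, h1]
        linarith
      · rw [if_neg hab, if_neg hac, if_neg hbc, Finset.card_eq_three.2
          ⟨f a, f b, f c, hab, hac, hbc, rfl⟩, e2, h2]
        linarith

theorem EntropyDeficit.insert_of_adj_edge (hy : 3 ≤ y) (h : EntropyDeficit G y S d) (hw : w ∉ S)
    (ha : a ∈ S) (hb : b ∈ S) (hwa : G.Adj w a) (hwb : G.Adj w b) (hab : G.Adj a b) :
    EntropyDeficit G y (insert w S) (d + saveOne y) := by
  refine h.insert_of_sum_log_le hw {a, b} (by simp [Finset.insert_subset_iff, ha, hb])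
    (by simp [hwa, hwb]) ?_
  have := sum_log_pair_le (G := G) hy a b
  rw [equalCount_of_adj hab] at this
  simpa using this

theorem EntropyDeficit.insert_of_adj_triangle (hy : 3 ≤ y) (h : EntropyDeficit G y S d)
    (hw : w ∉ S) (ha : a ∈ S) (hb : b ∈ S) (hc : c ∈ S) (hwa : G.Adj w a) (hwb : G.Adj w b)
    (hwc : G.Adj w c) (hab : G.Adj a b) (hac : G.Adj a c) (hbc : G.Adj b c) :
    EntropyDeficit G y (insert w S) (d + saveTwo y) := by
  refine h.insert_of_sum_log_le hw {a, b, c} (by simp [Finset.insert_subset_iff, ha, hb, hc])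
    (by simp [hwa, hwb, hwc]) ?_
  have := sum_log_triple_le (G := G) hy a b c
  rw [equalCount_of_adj hab, equalCount_of_adj hac, equalCount_of_adj hbc] at this
  simpa using this

theorem EntropyDeficit.insert_of_adj_two (hy : 3 ≤ y) (hG : RarelyEqual G y)
    (h : EntropyDeficit G y S d) (hw : w ∉ S) (ha : a ∈ S) (hb : b ∈ S) (hwa : G.Adj w a)
    (hwb : G.Adj w b) (hab : a ≠ b) :
    EntropyDeficit G y (insert w S) (d + savePair y) := by
  refine h.insert_of_sum_log_le hw {a, b} (by simp [Finset.insert_subset_iff, ha, hb])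
    (by simp [hwa, hwb]) ?_
  have h1 := sum_log_pair_le (G := G) hy a b
  have h2 := mul_le_mul_of_nonneg_right (hG.equalCount_le hy hab) (saveOne_nonneg hy)
  unfold savePair
  linarith

theorem EntropyDeficit.insert_of_adj_three (hy : 3 ≤ y) (hG : RarelyEqual G y)
    (h : EntropyDeficit G y S d) (hw : w ∉ S) (ha : a ∈ S) (hb : b ∈ S) (hc : c ∈ S)
    (hwa : G.Adj w a) (hwb : G.Adj w b) (hwc : G.Adj w c) (hab : a ≠ b) (hac : a ≠ c)
    (hbc : b ≠ c) :
    EntropyDeficit G y (insert w S) (d + saveTriple y) := by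
  refine h.insert_of_sum_log_le hw {a, b, c} (by simp [Finset.insert_subset_iff, ha, hb, hc])
    (by simp [hwa, hwb, hwc]) ?_
  have h0 : 0 ≤ saveTwo y - saveOne y := by
    linarith [two_mul_saveOne_le hy, saveOne_nonneg hy]
  have h1 := sum_log_triple_le (G := G) hy a b c
  have h2 := mul_le_mul_of_nonneg_right (hG.equalCount_le hy hab) h0
  have h3 := mul_le_mul_of_nonneg_right (hG.equalCount_le hy hac) h0
  have h4 := mul_le_mul_of_nonneg_right (hG.equalCount_le hy hbc) h0
  unfold saveTriple
  linarith

theorem EntropyDeficit.insert_of_adj_three_edge (hy : 3 ≤ y) (hG : RarelyEqual G y)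
    (h : EntropyDeficit G y S d) (hw : w ∉ S) (ha : a ∈ S) (hb : b ∈ S) (hc : c ∈ S)
    (hwa : G.Adj w a) (hwb : G.Adj w b) (hwc : G.Adj w c) (hab : G.Adj a b) (hac : a ≠ c)
    (hbc : b ≠ c) :
    EntropyDeficit G y (insert w S) (d + saveTripleEdge y) := by
  refine h.insert_of_sum_log_le hw {a, b, c} (by simp [Finset.insert_subset_iff, ha, hb, hc])
    (by simp [hwa, hwb, hwc]) ?_
  have h0 : 0 ≤ saveTwo y - saveOne y := by
    linarith [two_mul_saveOne_le hy, saveOne_nonneg hy]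
  have h1 := sum_log_triple_le (G := G) hy a b c
  rw [equalCount_of_adj hab, Nat.cast_zero] at h1
  have h3 := mul_le_mul_of_nonneg_right (hG.equalCount_le hy hac) h0
  have h4 := mul_le_mul_of_nonneg_right (hG.equalCount_le hy hbc) h0
  unfold saveTripleEdge
  linarith

end Savings

section Numerics

variable {y : ℕ}

/-- The saving of an odd cycle, in comparison with a tree. -/
noncomputable def saveCycle (y : ℕ) : ℝ := Real.log ((y + 1) / y)

theorem one_le_mul_saveOne (hy : 3 ≤ y) : 1 ≤ y * saveOne y := by
  have h : (3 : ℝ) ≤ y := by exact_mod_cast hy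
  have h1 := Real.log_le_sub_one_of_pos (x := (y - 1) / y) (div_pos (by linarith) (by linarith))
  rw [← inv_div, Real.log_inv, ← saveOne] at h1
  have h2 : ((y / (y - 1) : ℝ))⁻¹ - 1 = -(1 / y) := by
    rw [inv_div]
    field_simp
    ring
  rw [h2, neg_le_neg_iff, div_le_iff₀ (by linarith)] at h1
  linarith

theorem saveTwo_le_of_four_le (hy : 4 ≤ y) : saveTwo y ≤ 7 / 10 := by
  have h : (4 : ℝ) ≤ y := by exact_mod_cast hy
  have h1 : saveTwo y ≤ Real.log 2 := by
    refine Real.log_le_log (div_pos (by linarith) (by linarith)) ?_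
    rw [div_le_iff₀ (by linarith)]
    linarith
  linarith [Real.log_two_lt_d9]

theorem saveTwo_le_mul_saveOne (hy : 3 ≤ y) : saveTwo y ≤ y * saveOne y := by
  obtain rfl | h := hy.eq_or_lt
  · have : ((3 : ℕ) : ℝ) * saveOne 3 = Real.log ((3 / 2) ^ 3) := by
      rw [Real.log_pow]
      norm_num [saveOne]
    rw [this]
    refine Real.log_le_log (by norm_num) (by norm_num)
  · linarith [one_le_mul_saveOne hy, saveTwo_le_of_four_le h]

theorem three_mul_saveTwo_le (hy : 3 ≤ y) :
    3 * saveTwo y ≤ y * (saveCycle y + 2 * saveOne y) := by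
  obtain rfl | h := hy.eq_or_lt
  · have h1 : saveTwo 3 = saveCycle 3 + 2 * saveOne 3 := by
      have : 2 * saveOne 3 = Real.log ((3 / 2) ^ 2) := by
        rw [Real.log_pow]
        norm_num [saveOne]
      rw [this, saveCycle, saveTwo, ← Real.log_mul (by norm_num) (by norm_num)]
      norm_num
    rw [h1]
    norm_num
  · have h4 : (4 : ℝ) ≤ y := by exact_mod_cast h
    have h1 := Real.log_le_sub_one_of_pos (x := (y : ℝ) / (y + 1)) (by positivity)
    rw [← inv_div, Real.log_inv, ← saveCycle] at h1
    have h2 : (((y + 1) / y : ℝ))⁻¹ - 1 = -(1 / (y + 1)) := by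
      rw [inv_div]
      field_simp
      ring
    rw [h2, neg_le_neg_iff] at h1
    have h3 : 4 / 5 ≤ y * saveCycle y := by
      calc (4 / 5 : ℝ) ≤ y * (1 / (y + 1)) := by
            rw [mul_one_div, div_le_div_iff₀ (by norm_num) (by linarith)]
            linarith
        _ ≤ _ := by gcongr
    nlinarith [one_le_mul_saveOne hy, saveTwo_le_of_four_le h]

theorem one_div_mul_saveTwo_le (hy : 3 ≤ y) : 1 / y * saveTwo y ≤ saveOne y := by
  have h : (3 : ℝ) ≤ y := by exact_mod_cast hy
  rw [one_div_mul_eq_div, div_le_iff₀ (by linarith), mul_comm]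
  exact saveTwo_le_mul_saveOne hy

theorem one_div_mul_saveOne_nonneg (hy : 3 ≤ y) : 0 ≤ 1 / y * saveOne y :=
  mul_nonneg (by positivity) (saveOne_nonneg hy)

theorem saveTwo_le_three_pair_add_triple (hy : 3 ≤ y) :
    saveTwo y ≤ 3 * savePair y + saveTriple y := by
  unfold savePair saveTriple
  linarith [one_div_mul_saveTwo_le hy]

theorem saveTwo_le_two_pair_add_tripleEdge (hy : 3 ≤ y) :
    saveTwo y ≤ 2 * savePair y + saveTripleEdge y := by
  unfold savePair saveTripleEdge
  linarith [one_div_mul_saveTwo_le hy]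

theorem saveTwo_le_one_add_two_pair_add_triple (hy : 3 ≤ y) :
    saveTwo y ≤ saveOne y + 2 * savePair y + saveTriple y := by
  unfold savePair saveTriple
  linarith [one_div_mul_saveTwo_le hy, one_div_mul_saveOne_nonneg hy]

theorem saveTwo_le_one_add_pair_add_tripleEdge (hy : 3 ≤ y) :
    saveTwo y ≤ saveOne y + savePair y + saveTripleEdge y := by
  unfold savePair saveTripleEdge
  linarith [one_div_mul_saveTwo_le hy, one_div_mul_saveOne_nonneg hy]

theorem saveTwo_le_two_one_add_tripleEdge (hy : 3 ≤ y) :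
    saveTwo y ≤ 2 * saveOne y + saveTripleEdge y := by
  unfold saveTripleEdge
  linarith [one_div_mul_saveTwo_le hy, one_div_mul_saveOne_nonneg hy]

theorem saveOne_add_saveTwo_le (hy : 3 ≤ y) :
    saveOne y + saveTwo y ≤ saveCycle y + 3 * savePair y + saveTriple y := by
  have h : (3 : ℝ) ≤ y := by exact_mod_cast hy
  have h1 : 1 / y * (3 * saveTwo y) ≤ saveCycle y + 2 * saveOne y := by
    rw [one_div_mul_eq_div, div_le_iff₀ (by linarith), mul_comm _ (y : ℝ)]
    exact three_mul_saveTwo_le hy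
  unfold savePair saveTriple
  linarith

end Numerics

section Growth

variable {V : Type*} {G : SimpleGraph V}

/-- `c` is a proper colouring of the subgraph induced by `S`. -/
def ProperOn {α : Type*} (G : SimpleGraph V) (S : Finset V) (c : V → α) : Prop :=
  ∀ u ∈ S, ∀ v ∈ S, G.Adj u v → c u ≠ c v

theorem ProperOn.update [DecidableEq V] {α : Type*} {S : Finset V} {c : V → α} {w : V} {k : α}
    (h : ProperOn G S c) (hw : w ∉ S) (hk : ∀ u ∈ S, G.Adj w u → c u ≠ k) :
    ProperOn G (insert w S) (Function.update c w k) := by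
  intro u hu v hv huv
  rcases Finset.mem_insert.1 hu with rfl | hu'
  · rcases Finset.mem_insert.1 hv with rfl | hv'
    · exact absurd huv G.irrefl
    · rw [Function.update_self, Function.update_of_ne (ne_of_mem_of_not_mem hv' hw)]
      exact (hk v hv' huv).symm
  · rcases Finset.mem_insert.1 hv with rfl | hv'
    · rw [Function.update_self, Function.update_of_ne (ne_of_mem_of_not_mem hu' hw)]
      exact hk u hu' huv.symm
    · rw [Function.update_of_ne (ne_of_mem_of_not_mem hv' hw),
        Function.update_of_ne (ne_of_mem_of_not_mem hu' hw)]
      exact h u hu' v hv' huv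

/-- `G` is not `3`-colourable, but all its proper induced subgraphs are. -/
structure FourVertexCritical [Fintype V] (G : SimpleGraph V) : Prop where
  exists_properOn : ∀ S : Finset V, S ≠ Finset.univ → ∃ c : V → Fin 3, ProperOn G S c
  not_properOn : ∀ c : V → Fin 3, ¬ ProperOn G Finset.univ c

/-- Every vertex outside `S` has at most one neighbour in `S`. -/
def AttachedOnce (G : SimpleGraph V) (S : Finset V) : Prop :=
  ∀ w ∉ S, ∀ a ∈ S, ∀ b ∈ S, G.Adj w a → G.Adj w b → a = b

theorem AttachedOnce.exists_forbidden {S : Finset V} (hS : AttachedOnce G S) (c : V → Fin 3)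
    {w : V} (hw : w ∉ S) : ∃ k, ∀ u ∈ S, G.Adj w u → c u = k := by
  by_cases h : ∃ a ∈ S, G.Adj w a
  · obtain ⟨a, ha, hwa⟩ := h
    exact ⟨c a, fun u hu hwu => by rw [hS w hw u hu a ha hwu hwa]⟩
  · exact ⟨0, fun u hu hwu => absurd ⟨u, hu, hwu⟩ h⟩

theorem SimpleGraph.Connected.exists_adj_notMem [Fintype V] (hG : G.Connected) {S : Finset V}
    (hne : S.Nonempty) (huniv : S ≠ Finset.univ) : ∃ w ∉ S, ∃ a ∈ S, G.Adj w a := by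
  obtain ⟨a, ha⟩ := hne
  obtain ⟨b, hb⟩ : ∃ b, b ∉ S := by
    by_contra! h
    exact huniv (Finset.eq_univ_iff_forall.2 h)
  obtain ⟨p⟩ := hG.preconnected a b
  obtain ⟨d, -, h1, h2⟩ := p.exists_boundary_dart (S : Set V) (by simpa) (by simpa)
  exact ⟨d.snd, by simpa using h2, d.fst, by simpa using h1, d.adj.symm⟩

variable [Fintype V]

theorem FourVertexCritical.exists_three_neighbors (hG : FourVertexCritical G) (v : V) :
    ∃ a b c, a ≠ b ∧ a ≠ c ∧ b ≠ c ∧ G.Adj v a ∧ G.Adj v b ∧ G.Adj v c := by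
  classical
  have h2 : 2 < (G.neighborFinset v).card := by
    by_contra! hle
    obtain ⟨c, hc⟩ := hG.exists_properOn (Finset.univ.erase v)
      (fun h => by simpa using Finset.eq_univ_iff_forall.1 h v)
    obtain ⟨k, hk⟩ : ∃ k, k ∉ (G.neighborFinset v).image c := by
      by_contra! h
      have h3 : (G.neighborFinset v).image c = Finset.univ := Finset.eq_univ_iff_forall.2 h
      have h4 := (Finset.card_image_le (s := G.neighborFinset v) (f := c))
      rw [h3, Finset.card_univ, Fintype.card_fin] at h4
      omega
    have := hc.update (w := v) (k := k) (by simp) fun u _ huv h =>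
      hk (Finset.mem_image.2 ⟨u, by simpa using huv, h⟩)
    rw [Finset.insert_erase (Finset.mem_univ v)] at this
    exact hG.not_properOn _ this
  obtain ⟨a, ha, b, hb, c, hc, hab, hac, hbc⟩ := Finset.two_lt_card.1 h2
  exact ⟨a, b, c, hab, hac, hbc, by simpa using ha, by simpa using hb, by simpa using hc⟩

theorem FourVertexCritical.exists_third_neighbor (hG : FourVertexCritical G) (v a b : V) :
    ∃ c, c ≠ a ∧ c ≠ b ∧ G.Adj v c := by
  obtain ⟨p, q, r, hpq, hpr, hqr, hp, hq, hr⟩ := hG.exists_three_neighbors v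
  by_contra! h
  have key : ∀ t, G.Adj v t → t = a ∨ t = b := fun t ht => by
    by_contra! hne
    exact h t hne.1 hne.2 ht
  have h1 := key p hp
  have h2 := key q hq
  have h3 := key r hr
  grind

variable [DecidableEq V] {y : ℕ} {d : ℝ} {S : Finset V}

/-- The last vertex in a connected ordering has three earlier neighbours. -/
theorem EntropyDeficit.grow (hconn : G.Connected) (hcrit : FourVertexCritical G) (hy : 3 ≤ y)
    (hG : RarelyEqual G y) (hne : S.Nonempty) (huniv : S ≠ Finset.univ)
    (h : EntropyDeficit G y S d) : EntropyDeficit G y Finset.univ (d + saveTriple y) := by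
  induction hn : (Sᶜ).card using Nat.strong_induction_on generalizing S with
  | _ n ih =>
  obtain ⟨w, hw, a, ha, hwa⟩ := hconn.exists_adj_notMem hne huniv
  by_cases hu : insert w S = Finset.univ
  · obtain ⟨p, q, r, hpq, hpr, hqr, hp, hq, hr⟩ := hcrit.exists_three_neighbors w
    have hmem : ∀ t, G.Adj w t → t ∈ S := fun t ht =>
      (Finset.mem_insert.1 (hu ▸ Finset.mem_univ t)).resolve_left ht.ne'
    rw [← hu]
    exact h.insert_of_adj_three hy hG hw (hmem _ hp) (hmem _ hq) (hmem _ hr) hp hq hr hpq hpr hqr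
  · refine ih _ ?_ (Finset.insert_nonempty _ _) hu (h.insert_of_adj hw ha hwa) rfl
    rw [← hn]
    exact Finset.card_lt_card (Finset.compl_ssubset_compl.2 (Finset.ssubset_insert hw))

/-- Growing a connected set without saving keeps the deficit. -/
theorem EntropyDeficit.grow_univ (hconn : G.Connected) (hne : S.Nonempty)
    (h : EntropyDeficit G y S d) : EntropyDeficit G y Finset.univ d := by
  induction hn : (Sᶜ).card using Nat.strong_induction_on generalizing S with
  | _ n ih =>
  by_cases huniv : S = Finset.univ
  · exact huniv ▸ h
  obtain ⟨w, hw, a, ha, hwa⟩ := hconn.exists_adj_notMem hne huniv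
  refine ih _ ?_ (Finset.insert_nonempty _ _) (h.insert_of_adj hw ha hwa) rfl
  rw [← hn]
  exact Finset.card_lt_card (Finset.compl_ssubset_compl.2 (Finset.ssubset_insert hw))

/-- Growing by single attachments, one eventually closes a cycle through two new vertices. -/
theorem EntropyDeficit.exists_close (hconn : G.Connected) (hcrit : FourVertexCritical G)
    (hy : 3 ≤ y) (hG : RarelyEqual G y) (Φ : Finset V → Prop)
    (hΦ : ∀ S w, AttachedOnce G S → w ∉ S → Φ S → Φ (insert w S))
    (hne : S.Nonempty) (huniv : S ≠ Finset.univ) (hS : AttachedOnce G S) (hΦS : Φ S)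
    (h : EntropyDeficit G y S d) :
    ∃ Q z x, AttachedOnce G Q ∧ Φ Q ∧ z ∉ Q ∧ x ∉ Q ∧ G.Adj z x ∧ (∃ q ∈ Q, G.Adj z q) ∧
      (∃ q ∈ Q, G.Adj x q) ∧ insert x (insert z Q) ≠ Finset.univ ∧
      EntropyDeficit G y (insert x (insert z Q)) (d + savePair y) := by
  induction hn : (Sᶜ).card using Nat.strong_induction_on generalizing S with
  | _ n ih =>
  obtain ⟨z, hz, a, ha, hza⟩ := hconn.exists_adj_notMem hne huniv
  by_cases hP : AttachedOnce G (insert z S)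
  · refine ih _ ?_ (Finset.insert_nonempty _ _) ?_ hP (hΦ S z hS hz hΦS)
      (h.insert_of_adj hz ha hza) rfl
    · rw [← hn]
      exact Finset.card_lt_card (Finset.compl_ssubset_compl.2 (Finset.ssubset_insert hz))
    · intro hu
      obtain ⟨t, hta, -, hzt⟩ := hcrit.exists_third_neighbor z a a
      have ht := (Finset.mem_insert.1 (hu ▸ Finset.mem_univ t)).resolve_left hzt.ne'
      exact hta (hS z hz t ht a ha hzt hza)
  · unfold AttachedOnce at hP
    push Not at hP
    obtain ⟨x, hx, p, hp, q, hq, hxp, hxq, hpq⟩ := hP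
    have hxz : x ≠ z := fun h => hx (h ▸ Finset.mem_insert_self _ _)
    have hxS : x ∉ S := fun h => hx (Finset.mem_insert_of_mem h)
    have key : G.Adj z x ∧ ∃ q ∈ S, G.Adj x q := by
      rcases Finset.mem_insert.1 hp with rfl | hp'
      · exact ⟨hxp.symm, q, (Finset.mem_insert.1 hq).resolve_left hpq.symm, hxq⟩
      · rcases Finset.mem_insert.1 hq with rfl | hq'
        · exact ⟨hxq.symm, p, hp', hxp⟩
        · exact absurd (hS x hxS p hp' q hq' hxp hxq) hpq
    refine ⟨S, z, x, hS, hΦS, hz, hxS, key.1, ⟨a, ha, hza⟩, key.2, ?_,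
      (h.insert_of_adj hz ha hza).insert_of_adj_two hy hG hx hp hq hxp hxq hpq⟩
    intro hu
    obtain ⟨q, hqS, hxq⟩ := key.2
    obtain ⟨t, htq, htz, hxt⟩ := hcrit.exists_third_neighbor x q z
    have ht := (Finset.mem_insert.1 (hu ▸ Finset.mem_univ t)).resolve_left hxt.ne'
    have ht' := (Finset.mem_insert.1 ht).resolve_left htz
    exact htq (hS x hxS t ht' q hqS hxt hxq)

/-- `G` contains a triangle. -/
def HasTriangle (G : SimpleGraph V) : Prop :=
  ∃ a b c, G.Adj a b ∧ G.Adj a c ∧ G.Adj b c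

theorem EntropyDeficit.two_pairs (hconn : G.Connected) (hcrit : FourVertexCritical G)
    (hy : 3 ≤ y) (hG : RarelyEqual G y) (hne : S.Nonempty) (huniv : S ≠ Finset.univ)
    (hS : AttachedOnce G S) (h : EntropyDeficit G y S d) :
    EntropyDeficit G y Finset.univ (d + 2 * savePair y + saveTriple y) ∨
      HasTriangle G ∧ EntropyDeficit G y Finset.univ (d + savePair y + saveTripleEdge y) := by
  obtain ⟨Q, z, x, hQ, -, hz, hx, hzx, -, -, hPu, hP⟩ := h.exists_close hconn hcrit hy hG
    (fun _ => True) (fun _ _ _ _ _ => trivial) hne huniv hS trivial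
  by_cases hPc : AttachedOnce G (insert x (insert z Q))
  · obtain ⟨Q', z', x', -, -, -, -, -, -, -, hPu', hP'⟩ := hP.exists_close hconn hcrit hy hG
      (fun _ => True) (fun _ _ _ _ _ => trivial) (Finset.insert_nonempty _ _) hPu hPc trivial
    left
    refine (hP'.grow hconn hcrit hy hG (Finset.insert_nonempty _ _) hPu').mono (by linarith)
  · unfold AttachedOnce at hPc
    push Not at hPc
    obtain ⟨t, ht, p, hp, q, hq, htp, htq, hpq⟩ := hPc
    by_cases hu : insert t (insert x (insert z Q)) = Finset.univ
    · right
      have hmem : ∀ r, G.Adj t r → r = x ∨ r = z ∨ r ∈ Q := by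
        intro r hr
        have := hu ▸ Finset.mem_univ r
        simpa [hr.ne'] using this
      have htQ : t ∉ Q := fun h => ht (by simp [h])
      have huniq := hQ t htQ
      have key : G.Adj t x ∧ G.Adj t z ∧ ∃ r ∈ Q, G.Adj t r := by
        obtain ⟨p, q, r, hpq, hpr, hqr, hp, hq, hr⟩ := hcrit.exists_three_neighbors t
        have := hmem p hp
        have := hmem q hq
        have := hmem r hr
        grind
      obtain ⟨htx, htz, r, hr, htr⟩ := key
      refine ⟨⟨z, x, t, hzx, htz.symm, htx.symm⟩, ?_⟩
      rw [← hu]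
      exact hP.insert_of_adj_three_edge hy hG ht (by simp) (by simp) (by simp [hr]) htx htz htr
        hzx.symm (ne_of_mem_of_not_mem hr hx).symm (ne_of_mem_of_not_mem hr hz).symm
    · left
      exact ((hP.insert_of_adj_two hy hG ht hp hq htp htq hpq).grow hconn hcrit hy hG
        (Finset.insert_nonempty _ _) hu).mono (by linarith)

set_option synthInstance.maxSize 1000 in
theorem exists_cycle_four_coloring : ∀ f₁ f₂ f₃ f₄ : Fin 3, ∃ g₁ g₂ g₃ g₄ : Fin 3,
    g₁ ≠ f₁ ∧ g₂ ≠ f₂ ∧ g₃ ≠ f₃ ∧ g₄ ≠ f₄ ∧ g₁ ≠ g₂ ∧ g₂ ≠ g₃ ∧ g₃ ≠ g₄ ∧ g₄ ≠ g₁ := by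
  decide

/-- An induced four-cycle attached to an attached-once set cannot complete a critical graph. -/
theorem FourVertexCritical.false_of_four_cycle (hcrit : FourVertexCritical G) {Q : Finset V}
    {v₁ v₂ v₃ v₄ : V} (hQ : AttachedOnce G Q) (h₁ : v₁ ∉ Q) (h₂ : v₂ ∉ Q) (h₃ : v₃ ∉ Q)
    (h₄ : v₄ ∉ Q) (h₁₂ : v₁ ≠ v₂) (h₁₃ : v₁ ≠ v₃) (h₁₄ : v₁ ≠ v₄) (h₂₃ : v₂ ≠ v₃) (h₂₄ : v₂ ≠ v₄)
    (h₃₄ : v₃ ≠ v₄) (hn₁₃ : ¬ G.Adj v₁ v₃) (hn₂₄ : ¬ G.Adj v₂ v₄)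
    (hu : ∀ v, v ∈ Q ∨ v = v₁ ∨ v = v₂ ∨ v = v₃ ∨ v = v₄) : False := by
  obtain ⟨c, hc⟩ := hcrit.exists_properOn Q (fun h => h₁ (h ▸ Finset.mem_univ _))
  obtain ⟨f₁, hf₁⟩ := hQ.exists_forbidden c h₁
  obtain ⟨f₂, hf₂⟩ := hQ.exists_forbidden c h₂
  obtain ⟨f₃, hf₃⟩ := hQ.exists_forbidden c h₃
  obtain ⟨f₄, hf₄⟩ := hQ.exists_forbidden c h₄
  obtain ⟨g₁, g₂, g₃, g₄, e₁, e₂, e₃, e₄, e₁₂, e₂₃, e₃₄, e₄₁⟩ :=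
    exists_cycle_four_coloring f₁ f₂ f₃ f₄
  have step₁ := hc.update (k := g₁) h₁ (by grind)
  have step₂ := step₁.update (w := v₂) (k := g₂) (by grind) (by grind)
  have step₃ := step₂.update (w := v₃) (k := g₃) (by grind) (by grind [G.adj_comm])
  have step₄ := step₃.update (w := v₄) (k := g₄) (by grind) (by grind [G.adj_comm])
  refine hcrit.not_properOn _ (fun u _ v _ => step₄ u ?_ v ?_)
  · have := hu u
    simp only [Finset.mem_insert]
    tauto
  · have := hu v
    simp only [Finset.mem_insert]
    tauto

/-- The end of a growth process in which the last neighbourhood is independent. -/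
theorem FourVertexCritical.false_of_triangleFree_neighbors (hcrit : FourVertexCritical G)
    {Q : Finset V} {z x t s p q : V} (hQ : AttachedOnce G Q) (hz : z ∉ Q) (hx : x ∉ Q)
    (htQ : t ∉ Q) (hzx : G.Adj z x) (htz : t ≠ z) (htx : t ≠ x) (hp : p ∈ insert x (insert z Q))
    (hq : q ∈ insert x (insert z Q)) (htp : G.Adj t p) (htq : G.Adj t q) (hpq : p ≠ q)
    (hs : s ∉ insert t (insert x (insert z Q)))
    (hedge : ∀ a b, G.Adj s a → G.Adj s b → ¬ G.Adj a b)
    (hu : insert s (insert t (insert x (insert z Q))) = Finset.univ) : False := by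
  have hsQ : s ∉ Q := fun h => hs (by simp [h])
  have hsz : s ≠ z := fun h => hs (by simp [h])
  have hsx : s ≠ x := fun h => hs (by simp [h])
  have hst : s ≠ t := fun h => hs (by simp [h])
  have hmem : ∀ v, v ∈ Q ∨ v = z ∨ v = x ∨ v = t ∨ v = s := by
    intro v
    have := hu ▸ Finset.mem_univ v
    simp only [Finset.mem_insert] at this
    tauto
  have htwo : G.Adj t z ∨ G.Adj t x := by
    by_contra! hno
    have hin : ∀ r ∈ insert x (insert z Q), G.Adj t r → r ∈ Q := by
      intro r hr htr
      rcases Finset.mem_insert.1 hr with rfl | hr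
      · exact absurd htr hno.2
      rcases Finset.mem_insert.1 hr with rfl | hr
      · exact absurd htr hno.1
      · exact hr
    exact hpq (hQ t htQ p (hin p hp htp) q (hin q hq htq) htp htq)
  have hst' : G.Adj s t ∧ (G.Adj s z ∨ G.Adj s x) := by
    have hr : ∀ r, G.Adj s r → r ∈ Q ∨ r = z ∨ r = x ∨ r = t := by
      intro r hr
      have := hmem r
      have := hr.ne'
      tauto
    obtain ⟨a, b, c, hab, hac, hbc, ha, hb, hc⟩ := hcrit.exists_three_neighbors s
    have huab : a ∈ Q → b ∈ Q → a = b := fun h1 h2 => hQ s hsQ a h1 b h2 ha hb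
    have huac : a ∈ Q → c ∈ Q → a = c := fun h1 h2 => hQ s hsQ a h1 c h2 ha hc
    have hubc : b ∈ Q → c ∈ Q → b = c := fun h1 h2 => hQ s hsQ b h1 c h2 hb hc
    have h7 : ¬ (G.Adj s z ∧ G.Adj s x) := fun h => hedge z x h.1 h.2 hzx
    have h1 := hr a ha
    have h2 := hr b hb
    have h3 := hr c hc
    clear hr hQ hmem hs hu hedge hp hq hcrit
    grind
  obtain ⟨hst1, hsz' | hsx'⟩ := hst'
  · have h1 : ¬ G.Adj t z := hedge t z hst1 hsz'
    have h2 : ¬ G.Adj s x := fun h => hedge z x hsz' h hzx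
    exact hcrit.false_of_four_cycle hQ hz hx htQ hsQ hzx.ne htz.symm hsz.symm htx.symm
      hsx.symm hst.symm (fun h => h1 h.symm) (fun h => h2 h.symm) hmem
  · have h1 : ¬ G.Adj t x := hedge t x hst1 hsx'
    have h2 : ¬ G.Adj s z := fun h => hedge z x h hsx' hzx
    exact hcrit.false_of_four_cycle hQ hx hz htQ hsQ hzx.ne' htx.symm hsx.symm htz.symm
      hsz.symm hst.symm (fun h => h1 h.symm) (fun h => h2 h.symm) (fun v => by grind)

theorem EntropyDeficit.three_pairs (hconn : G.Connected) (hcrit : FourVertexCritical G)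
    (hy : 3 ≤ y) (hG : RarelyEqual G y) (Φ : Finset V → Prop)
    (hΦ : ∀ S w, AttachedOnce G S → w ∉ S → Φ S → Φ (insert w S))
    (hfalse : ∀ Q z x t, AttachedOnce G Q → Φ Q → z ∉ Q → x ∉ Q → t ∉ Q → G.Adj z x →
      G.Adj z t → G.Adj x t → (∀ v, v ∈ Q ∨ v = z ∨ v = x ∨ v = t) → False)
    (hne : S.Nonempty) (huniv : S ≠ Finset.univ)
    (hS : AttachedOnce G S) (hΦS : Φ S) (h : EntropyDeficit G y S d) :
    EntropyDeficit G y Finset.univ (d + 3 * savePair y + saveTriple y) ∨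
      HasTriangle G ∧ EntropyDeficit G y Finset.univ (d + 2 * savePair y + saveTripleEdge y) := by
  obtain ⟨Q, z, x, hQ, hΦQ, hz, hx, hzx, -, -, hPu, hP⟩ := h.exists_close hconn hcrit hy hG
    Φ hΦ hne huniv hS hΦS
  by_cases hPc : AttachedOnce G (insert x (insert z Q))
  · rcases hP.two_pairs hconn hcrit hy hG (Finset.insert_nonempty _ _) hPu hPc with h1 | ⟨h1, h2⟩
    · exact Or.inl (h1.mono (by linarith))
    · exact Or.inr ⟨h1, h2.mono (by linarith)⟩
  unfold AttachedOnce at hPc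
  push Not at hPc
  obtain ⟨t, ht, p, hp, q, hq, htp, htq, hpq⟩ := hPc
  have htQ : t ∉ Q := fun h => ht (by simp [h])
  have htz : t ≠ z := fun h => ht (by simp [h])
  have htx : t ≠ x := fun h => ht (by simp [h])
  have hP2 := hP.insert_of_adj_two hy hG ht hp hq htp htq hpq
  by_cases hu : insert t (insert x (insert z Q)) = Finset.univ
  · exfalso
    have hmem : ∀ v, v ∈ Q ∨ v = z ∨ v = x ∨ v = t := by
      intro v
      have := hu ▸ Finset.mem_univ v
      simp only [Finset.mem_insert] at this
      tauto
    have key : ∀ r, r ∉ Q → (r ≠ z → G.Adj r z) ∧ (r ≠ x → G.Adj r x) ∧ (r ≠ t → G.Adj r t) := by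
      intro r hrQ
      obtain ⟨a, b, c, hab, hac, hbc, ha, hb, hc⟩ := hcrit.exists_three_neighbors r
      have huab : a ∈ Q → b ∈ Q → a = b := fun h1 h2 => hQ r hrQ a h1 b h2 ha hb
      have huac : a ∈ Q → c ∈ Q → a = c := fun h1 h2 => hQ r hrQ a h1 c h2 ha hc
      have hubc : b ∈ Q → c ∈ Q → b = c := fun h1 h2 => hQ r hrQ b h1 c h2 hb hc
      have h0 := hmem r
      have h1 := hmem a
      have h2 := hmem b
      have h3 := hmem c
      have h4 := ha.ne'
      have h5 := hb.ne'
      have h6 := hc.ne'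
      clear hmem hfalse hΦ hu hQ hP hP2 h hcrit hG hS hconn
      grind
    exact hfalse Q z x t hQ hΦQ hz hx htQ hzx ((key z hz).2.2 htz.symm)
      ((key x hx).2.2 htx.symm) hmem
  by_cases hP2c : AttachedOnce G (insert t (insert x (insert z Q)))
  · obtain ⟨Q', z', x', -, -, -, -, -, -, -, hPu', hP'⟩ := hP2.exists_close hconn hcrit hy hG
      (fun _ => True) (fun _ _ _ _ _ => trivial) (Finset.insert_nonempty _ _) hu hP2c trivial
    left
    exact (hP'.grow hconn hcrit hy hG (Finset.insert_nonempty _ _) hPu').mono (by linarith)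
  unfold AttachedOnce at hP2c
  push Not at hP2c
  obtain ⟨s, hs, p', hp', q', hq', hsp, hsq, hpq'⟩ := hP2c
  by_cases hu' : insert s (insert t (insert x (insert z Q))) = Finset.univ
  · right
    by_cases hedge : ∃ a b, G.Adj s a ∧ G.Adj s b ∧ G.Adj a b
    · obtain ⟨a, b, hsa, hsb, hab⟩ := hedge
      refine ⟨⟨s, a, b, hsa, hsb, hab⟩, ?_⟩
      obtain ⟨c, hca, hcb, hsc⟩ := hcrit.exists_third_neighbor s a b
      have hmem : ∀ r, G.Adj s r → r ∈ insert t (insert x (insert z Q)) := fun r hr =>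
        (Finset.mem_insert.1 (hu' ▸ Finset.mem_univ r)).resolve_left hr.ne'
      rw [← hu']
      exact (hP2.insert_of_adj_three_edge hy hG hs (hmem _ hsa) (hmem _ hsb) (hmem _ hsc) hsa hsb
        hsc hab hca.symm hcb.symm).mono (by linarith)
    · push Not at hedge
      exact (hcrit.false_of_triangleFree_neighbors hQ hz hx htQ hzx htz htx hp hq htp htq hpq hs
        hedge hu').elim
  · left
    exact ((hP2.insert_of_adj_two hy hG hs hp' hq' hsp hsq hpq').grow hconn hcrit hy hG
      (Finset.insert_nonempty _ _) hu').mono (by linarith)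

end Growth

section Triangle

variable {V : Type*} {G : SimpleGraph V}

/-- Any two vertices of `S` can be separated by a proper `3`-colouring of `S`. -/
def Flexible (G : SimpleGraph V) (S : Finset V) : Prop :=
  ∀ a ∈ S, ∀ b ∈ S, a ≠ b → ∃ c : V → Fin 3, ProperOn G S c ∧ c a ≠ c b

theorem exists_ne_ne_fin_three : ∀ i j : Fin 3, ∃ k, i ≠ k ∧ j ≠ k := by
  decide

theorem exists_triangle_coloring : ∀ f₁ f₂ f₃ : Fin 3, ¬ (f₁ = f₂ ∧ f₁ = f₃) →
    ∃ g₁ g₂ g₃ : Fin 3, f₁ ≠ g₁ ∧ f₂ ≠ g₂ ∧ f₃ ≠ g₃ ∧ g₁ ≠ g₂ ∧ g₁ ≠ g₃ ∧ g₂ ≠ g₃ := by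
  decide

/-- The colouring of a diamond in which only `a` has colour `0` and only `b` has colour `1`. -/
def diamondColoring [DecidableEq V] (a b : V) (t : V) : Fin 3 :=
  if t = a then 0 else if t = b then 1 else 2

theorem diamondColoring_properOn [DecidableEq V] {a b c w : V} (hab : G.Adj a b) (hac : G.Adj a c)
    (hbc : G.Adj b c) (hwa : G.Adj w a) (hwb : G.Adj w b) (hwc : ¬ G.Adj w c) :
    ProperOn G {a, b, c, w} (diamondColoring a b) := by
  intro s hs t ht hst
  have h1 := hab.ne
  have h2 := hac.ne
  have h3 := hbc.ne
  have h4 := hwa.ne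
  have h5 := hwb.ne
  have h6 := hst.ne
  have h7 := hst.symm
  simp only [Finset.mem_insert, Finset.mem_singleton] at hs ht
  unfold diamondColoring
  rcases hs with rfl | rfl | rfl | rfl <;> rcases ht with rfl | rfl | rfl | rfl <;> grind

/-- The colour `k` can be given to `t` when the diamond is coloured by `diamondColoring`. -/
def DiamondAvailable [DecidableEq V] (G : SimpleGraph V) (a b c w t : V) (k : Fin 3) : Prop :=
  ∀ s ∈ ({a, b, c, w} : Finset V), G.Adj t s → diamondColoring a b s ≠ k

theorem diamondAvailable_zero [DecidableEq V] {a b c w t : V} (h : ¬ G.Adj t a) :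
    DiamondAvailable G a b c w t 0 := by
  intro s _ hts
  unfold diamondColoring
  grind

theorem diamondAvailable_one [DecidableEq V] {a b c w t : V} (h : ¬ G.Adj t b) :
    DiamondAvailable G a b c w t 1 := by
  intro s _ hts
  unfold diamondColoring
  grind

theorem diamondAvailable_two [DecidableEq V] {a b c w t : V} (hc : ¬ G.Adj t c) (hw : ¬ G.Adj t w) :
    DiamondAvailable G a b c w t 2 := by
  intro s hs hts
  simp only [Finset.mem_insert, Finset.mem_singleton] at hs
  unfold diamondColoring
  grind

/-- `G` has no complete subgraph on four vertices. -/
def NoFourClique (G : SimpleGraph V) : Prop :=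
  ∀ a b c d, G.Adj a b → G.Adj a c → G.Adj a d → G.Adj b c → G.Adj b d → ¬ G.Adj c d

theorem exists_diamondAvailable [DecidableEq V] (hK : NoFourClique G) {a b c w : V}
    (hab : G.Adj a b) (hac : G.Adj a c) (hbc : G.Adj b c) (hwa : G.Adj w a) (hwb : G.Adj w b)
    (t : V) : ∃ k, DiamondAvailable G a b c w t k := by
  by_cases ha : G.Adj t a
  · by_cases hb : G.Adj t b
    · exact ⟨2, diamondAvailable_two
        (fun h => hK a b c t hab hac ha.symm hbc hb.symm h.symm)
        (fun h => hK a b w t hab hwa.symm ha.symm hwb.symm hb.symm h.symm)⟩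
    · exact ⟨1, diamondAvailable_one hb⟩
  · exact ⟨0, diamondAvailable_zero ha⟩

variable [Fintype V] [DecidableEq V] {y : ℕ} {d : ℝ} {S : Finset V}

theorem Flexible.insert_of_attachedOnce (hcrit : FourVertexCritical G) {w : V}
    (hS : AttachedOnce G S) (hw : w ∉ S) (h : Flexible G S) : Flexible G (insert w S) := by
  have hsep : ∀ b ∈ S, ∃ c : V → Fin 3, ProperOn G (insert w S) c ∧ c b ≠ c w := by
    intro b hb
    obtain ⟨c, hc⟩ := hcrit.exists_properOn S (fun h => hw (h ▸ Finset.mem_univ _))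
    obtain ⟨f, hf⟩ := hS.exists_forbidden c hw
    obtain ⟨k, hk, hk'⟩ := exists_ne_ne_fin_three f (c b)
    refine ⟨_, hc.update hw fun u hu hwu => (hf u hu hwu).symm ▸ hk, ?_⟩
    rwa [Function.update_self, Function.update_of_ne (ne_of_mem_of_not_mem hb hw)]
  intro a ha b hb hab
  rcases Finset.mem_insert.1 ha with rfl | ha'
  · obtain ⟨c, hc, hne⟩ := hsep b ((Finset.mem_insert.1 hb).resolve_left hab.symm)
    exact ⟨c, hc, hne.symm⟩
  · rcases Finset.mem_insert.1 hb with rfl | hb'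
    · exact hsep a ha'
    · obtain ⟨c, hc, hne⟩ := h a ha' b hb' hab
      obtain ⟨f, hf⟩ := hS.exists_forbidden c hw
      obtain ⟨k, hk, -⟩ := exists_ne_ne_fin_three f f
      refine ⟨_, hc.update hw fun u hu hwu => (hf u hu hwu).symm ▸ hk, ?_⟩
      rwa [Function.update_of_ne (ne_of_mem_of_not_mem ha' hw),
        Function.update_of_ne (ne_of_mem_of_not_mem hb' hw)]

theorem FourVertexCritical.false_of_flexible (hcrit : FourVertexCritical G)
    (hK : NoFourClique G) {Q : Finset V} {z x t : V} (hQ : AttachedOnce G Q) (hΦ : Flexible G Q)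
    (hz : z ∉ Q) (hx : x ∉ Q) (ht : t ∉ Q) (hzx : G.Adj z x) (hzt : G.Adj z t) (hxt : G.Adj x t)
    (hu : ∀ v, v ∈ Q ∨ v = z ∨ v = x ∨ v = t) : False := by
  obtain ⟨p, hpx, hpt, hzp⟩ := hcrit.exists_third_neighbor z x t
  obtain ⟨q, hqz, hqt, hxq⟩ := hcrit.exists_third_neighbor x z t
  obtain ⟨r, hrz, hrx, htr⟩ := hcrit.exists_third_neighbor t z x
  have hpQ : p ∈ Q := by
    have := hu p
    have := hzp.ne'
    tauto
  have hqQ : q ∈ Q := by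
    have := hu q
    have := hxq.ne'
    tauto
  have hrQ : r ∈ Q := by
    have := hu r
    have := htr.ne'
    tauto
  have hc : ∃ c : V → Fin 3, ProperOn G Q c ∧ ¬ (c p = c q ∧ c p = c r) := by
    by_cases hpq : p = q
    · by_cases hpr : p = r
      · subst hpq hpr
        exact absurd htr (hK z x t p hzx hzt hzp hxt hxq)
      · obtain ⟨c, hc, hne⟩ := hΦ p hpQ r hrQ hpr
        exact ⟨c, hc, fun h => hne h.2⟩
    · obtain ⟨c, hc, hne⟩ := hΦ p hpQ q hqQ hpq
      exact ⟨c, hc, fun h => hne h.1⟩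
  obtain ⟨c, hc, hne⟩ := hc
  obtain ⟨g₁, g₂, g₃, e₁, e₂, e₃, e₁₂, e₁₃, e₂₃⟩ := exists_triangle_coloring _ _ _ hne
  have h1 : ∀ u ∈ Q, G.Adj z u → u = p := fun u hu h => hQ z hz u hu p hpQ h hzp
  have h2 : ∀ u ∈ Q, G.Adj x u → u = q := fun u hu h => hQ x hx u hu q hqQ h hxq
  have h3 : ∀ u ∈ Q, G.Adj t u → u = r := fun u hu h => hQ t ht u hu r hrQ h htr
  have hne1 := hzx.ne
  have hne2 := hzt.ne
  have hne3 := hxt.ne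
  have step₁ := hc.update (k := g₁) hz (by grind)
  have step₂ := step₁.update (w := x) (k := g₂) (by grind) (by grind)
  have step₃ := step₂.update (w := t) (k := g₃) (by grind) (by grind)
  refine hcrit.not_properOn _ (fun u _ v _ => step₃ u ?_ v ?_)
  · have := hu u
    simp only [Finset.mem_insert]
    tauto
  · have := hu v
    simp only [Finset.mem_insert]
    tauto

theorem EntropyDeficit.insert_insert_of_adj (hy : 3 ≤ y) (hG : RarelyEqual G y) {u v p r s : V}
    (h : EntropyDeficit G y S d) (hu : u ∉ S) (hv : v ∉ insert u S) (hp : p ∈ S) (hr : r ∈ S)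
    (hs : s ∈ S) (hup : G.Adj u p) (hur : G.Adj u r) (hpr : G.Adj p r) (hvp : G.Adj v p)
    (hvu : G.Adj v u) (hvs : G.Adj v s) (hps : p ≠ s) :
    EntropyDeficit G y (insert v (insert u S)) (d + saveOne y + saveTripleEdge y) :=
  (h.insert_of_adj_edge hy hu hp hr hup hur hpr).insert_of_adj_three_edge hy hG hv
    (Finset.mem_insert_of_mem hp) (Finset.mem_insert_self _ _) (Finset.mem_insert_of_mem hs)
    hvp hvu hvs hup.symm hps (ne_of_mem_of_not_mem hs hu).symm

/-- In a critical graph made of a diamond and two further vertices, these two vertices are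
adjacent and have a common neighbour among the central vertices of the diamond. -/
theorem FourVertexCritical.exists_adj_of_diamond (hcrit : FourVertexCritical G)
    (hK : NoFourClique G) {a b c w u v : V} (hab : G.Adj a b)
    (hac : G.Adj a c) (hbc : G.Adj b c) (hwa : G.Adj w a) (hwb : G.Adj w b) (hwc : ¬ G.Adj w c)
    (hu : u ∉ ({a, b, c, w} : Finset V)) (hv : v ∉ insert u ({a, b, c, w} : Finset V))
    (huniv : insert v (insert u ({a, b, c, w} : Finset V)) = Finset.univ) :
    G.Adj u v ∧ ∃ p r s, (p = a ∨ p = b) ∧ (r = c ∨ r = w) ∧ (s = c ∨ s = w) ∧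
      G.Adj u p ∧ G.Adj u r ∧ G.Adj v p ∧ G.Adj v s := by
  have key : ∀ i j, DiamondAvailable G a b c w u i → DiamondAvailable G a b c w v j →
      i = j ∧ G.Adj u v := by
    intro i j hi hj
    by_contra hij
    have h1 := (diamondColoring_properOn hab hac hbc hwa hwb hwc).update hu hi
    have h2 := h1.update (k := j) hv (by
      intro s hs hvs
      rcases Finset.mem_insert.1 hs with rfl | hs
      · rw [Function.update_self]
        exact fun h => hij ⟨h, hvs.symm⟩
      · rw [Function.update_of_ne (ne_of_mem_of_not_mem hs hu)]
        exact hj s hs hvs)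
    rw [huniv] at h2
    exact hcrit.not_properOn _ h2
  obtain ⟨i, hi⟩ := exists_diamondAvailable hK hab hac hbc hwa hwb u
  obtain ⟨j, hj⟩ := exists_diamondAvailable hK hab hac hbc hwa hwb v
  obtain ⟨rfl, huv⟩ := key i j hi hj
  have hua : i ≠ 0 → G.Adj u a := fun h => by
    by_contra hn
    exact h (key _ _ (diamondAvailable_zero hn) hj).1.symm
  have hva : i ≠ 0 → G.Adj v a := fun h => by
    by_contra hn
    exact h (key _ _ hi (diamondAvailable_zero hn)).1
  have hub : i ≠ 1 → G.Adj u b := fun h => by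
    by_contra hn
    exact h (key _ _ (diamondAvailable_one hn) hj).1.symm
  have hvb : i ≠ 1 → G.Adj v b := fun h => by
    by_contra hn
    exact h (key _ _ hi (diamondAvailable_one hn)).1
  have huc : i ≠ 2 → ∃ r, (r = c ∨ r = w) ∧ G.Adj u r := fun h => by
    by_contra! hn
    exact h (key _ _ (diamondAvailable_two (hn c (Or.inl rfl)) (hn w (Or.inr rfl))) hj).1.symm
  have hvc : i ≠ 2 → ∃ r, (r = c ∨ r = w) ∧ G.Adj v r := fun h => by
    by_contra! hn
    exact h (key _ _ hi (diamondAvailable_two (hn c (Or.inl rfl)) (hn w (Or.inr rfl)))).1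
  refine ⟨huv, ?_⟩
  by_cases h2 : i = 2
  · subst h2
    exact absurd huv (hK a b u v hab (hua (by decide)).symm (hva (by decide)).symm
      (hub (by decide)).symm (hvb (by decide)).symm)
  obtain ⟨r, hr, hur⟩ := huc h2
  obtain ⟨s, hs, hvs⟩ := hvc h2
  by_cases h0 : i = 0
  · subst h0
    exact ⟨b, r, s, Or.inr rfl, hr, hs, hub (by decide), hur, hvb (by decide), hvs⟩
  · exact ⟨a, r, s, Or.inl rfl, hr, hs, hua h0, hur, hva h0, hvs⟩

theorem EntropyDeficit.of_diamond_of_insert_eq_univ (hcrit : FourVertexCritical G) (hy : 3 ≤ y)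
    (hG : RarelyEqual G y) (hK : NoFourClique G) {a b c w u v : V} (hab : G.Adj a b)
    (hac : G.Adj a c) (hbc : G.Adj b c) (hwa : G.Adj w a) (hwb : G.Adj w b) (hwc : ¬ G.Adj w c)
    (hu : u ∉ ({a, b, c, w} : Finset V)) (hv : v ∉ insert u ({a, b, c, w} : Finset V))
    (huniv : insert v (insert u ({a, b, c, w} : Finset V)) = Finset.univ)
    (h : EntropyDeficit G y {a, b, c, w} d) :
    EntropyDeficit G y Finset.univ (d + saveOne y + saveTripleEdge y) := by
  obtain ⟨huv, p, r, s, hp, hr, hs, hup, hur, hvp, hvs⟩ :=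
    hcrit.exists_adj_of_diamond hK hab hac hbc hwa hwb hwc hu hv huniv
  rw [← huniv]
  have hpr : G.Adj p r := by
    rcases hp with rfl | rfl <;> rcases hr with rfl | rfl <;>
      first | assumption | (symm; assumption)
  have hps : G.Adj p s := by
    rcases hp with rfl | rfl <;> rcases hs with rfl | rfl <;>
      first | assumption | (symm; assumption)
  refine h.insert_insert_of_adj hy hG hu hv ?_ ?_ ?_ hup hur hpr hvp huv.symm hvs hps.ne
  · rcases hp with rfl | rfl <;> simp
  · rcases hr with rfl | rfl <;> simp
  · rcases hs with rfl | rfl <;> simp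

theorem EntropyDeficit.of_diamond (hconn : G.Connected) (hcrit : FourVertexCritical G)
    (hy : 3 ≤ y) (hG : RarelyEqual G y) (hK : NoFourClique G) {a b c w : V} (hab : G.Adj a b)
    (hac : G.Adj a c) (hbc : G.Adj b c) (hwa : G.Adj w a) (hwb : G.Adj w b) (hwc : w ≠ c) :
    EntropyDeficit G y Finset.univ (saveOne y + saveTwo y) := by
  have hnwc : ¬ G.Adj w c := fun h => hK a b c w hab hac hwa.symm hbc hwb.symm h.symm
  have hb : EntropyDeficit G y {b} 0 := entropyDeficit_singleton b
  have hab' : EntropyDeficit G y {a, b} 0 := hb.insert_of_adj (by simpa using hab.ne) (by simp) hab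
  have habc : EntropyDeficit G y (insert c {a, b}) (0 + saveOne y) :=
    hab'.insert_of_adj_edge hy (by simp [hac.ne', hbc.ne']) (by simp) (by simp) hac.symm hbc.symm
      hab
  have hD : EntropyDeficit G y (insert w (insert c {a, b})) (0 + saveOne y + saveOne y) :=
    habc.insert_of_adj_edge hy (by simp [hwa.ne, hwb.ne, hwc]) (by simp) (by simp) hwa hwb hab
  have hS : insert w (insert c {a, b}) = ({a, b, c, w} : Finset V) := by
    ext t
    simp only [Finset.mem_insert, Finset.mem_singleton]
    tauto
  rw [hS, zero_add] at hD
  have hu : ({a, b, c, w} : Finset V) ≠ Finset.univ := by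
    intro hu
    obtain ⟨t, hta, htb, hct⟩ := hcrit.exists_third_neighbor c a b
    have := hu ▸ Finset.mem_univ t
    simp only [Finset.mem_insert, Finset.mem_singleton, hta, htb, hct.ne', false_or] at this
    subst this
    exact hnwc hct.symm
  by_cases hSc : AttachedOnce G {a, b, c, w}
  · rcases hD.two_pairs hconn hcrit hy hG (Finset.insert_nonempty _ _) hu hSc with h | ⟨-, h⟩
    · exact h.mono (by linarith [saveTwo_le_one_add_two_pair_add_triple hy])
    · exact h.mono (by linarith [saveTwo_le_one_add_pair_add_tripleEdge hy])
  unfold AttachedOnce at hSc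
  push Not at hSc
  obtain ⟨u, huS, p, hp, q, hq, hup, huq, hpq⟩ := hSc
  have hD2 := hD.insert_of_adj_two hy hG huS hp hq hup huq hpq
  have hu2 : insert u ({a, b, c, w} : Finset V) ≠ Finset.univ := by
    intro hu2
    obtain ⟨k, hk⟩ := exists_diamondAvailable hK hab hac hbc hwa hwb u
    have h := (diamondColoring_properOn hab hac hbc hwa hwb hnwc).update huS hk
    rw [hu2] at h
    exact hcrit.not_properOn _ h
  by_cases hSc2 : AttachedOnce G (insert u ({a, b, c, w} : Finset V))
  · obtain ⟨Q', z', x', -, -, -, -, -, -, -, hPu', hP'⟩ := hD2.exists_close hconn hcrit hy hG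
      (fun _ => True) (fun _ _ _ _ _ => trivial) (Finset.insert_nonempty _ _) hu2 hSc2 trivial
    exact (hP'.grow hconn hcrit hy hG (Finset.insert_nonempty _ _) hPu').mono
      (by linarith [saveTwo_le_one_add_two_pair_add_triple hy])
  unfold AttachedOnce at hSc2
  push Not at hSc2
  obtain ⟨v, hvS, p', hp', q', hq', hvp, hvq, hpq'⟩ := hSc2
  by_cases hu3 : insert v (insert u ({a, b, c, w} : Finset V)) = Finset.univ
  · exact (hD.of_diamond_of_insert_eq_univ hcrit hy hG hK hab hac hbc hwa hwb hnwc huS hvS hu3).mono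
      (by linarith [saveTwo_le_two_one_add_tripleEdge hy])
  · exact ((hD2.insert_of_adj_two hy hG hvS hp' hq' hvp hvq hpq').grow hconn hcrit hy hG
      (Finset.insert_nonempty _ _) hu3).mono
      (by linarith [saveTwo_le_one_add_two_pair_add_triple hy])

theorem EntropyDeficit.of_hasTriangle (hconn : G.Connected) (hcrit : FourVertexCritical G)
    (hy : 3 ≤ y) (hG : RarelyEqual G y) (hK : NoFourClique G) (hT : HasTriangle G) :
    EntropyDeficit G y Finset.univ (saveOne y + saveTwo y) := by
  obtain ⟨a, b, c, hab, hac, hbc⟩ := hT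
  by_cases hS : AttachedOnce G {a, b, c}
  · have hc : EntropyDeficit G y {c} 0 := entropyDeficit_singleton c
    have hbc' : EntropyDeficit G y {b, c} 0 :=
      hc.insert_of_adj (by simpa using hbc.ne) (by simp) hbc
    have habc : EntropyDeficit G y {a, b, c} (0 + saveOne y) :=
      hbc'.insert_of_adj_edge hy (by simp [hab.ne, hac.ne]) (by simp) (by simp) hab hac hbc
    have hu : ({a, b, c} : Finset V) ≠ Finset.univ := by
      intro hu
      obtain ⟨t, htb, htc, hat⟩ := hcrit.exists_third_neighbor a b c
      have := hu ▸ Finset.mem_univ t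
      simp [htb, htc, hat.ne'] at this
    have hflex : Flexible G {a, b, c} := by
      obtain ⟨f, hf⟩ := hcrit.exists_properOn _ hu
      intro s hs t ht hst
      refine ⟨f, hf, hf s hs t ht ?_⟩
      simp only [Finset.mem_insert, Finset.mem_singleton] at hs ht
      have := hab.symm
      have := hac.symm
      have := hbc.symm
      grind
    rcases habc.three_pairs hconn hcrit hy hG (Flexible G)
      (fun S w h1 h2 h3 => h3.insert_of_attachedOnce hcrit h1 h2)
      (fun Q z x t hQ hΦ hz hx ht hzx hzt hxt hu =>
        hcrit.false_of_flexible hK hQ hΦ hz hx ht hzx hzt hxt hu)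
      (Finset.insert_nonempty _ _) hu hS hflex with h | ⟨-, h⟩
    · exact h.mono (by linarith [saveTwo_le_three_pair_add_triple hy])
    · exact h.mono (by linarith [saveTwo_le_two_pair_add_tripleEdge hy])
  · unfold AttachedOnce at hS
    push Not at hS
    obtain ⟨w, hw, p, hp, q, hq, hwp, hwq, hpq⟩ := hS
    simp only [Finset.mem_insert, Finset.mem_singleton, not_or] at hw hp hq
    obtain ⟨hwa, hwb, hwc⟩ := hw
    rcases hp with rfl | rfl | rfl <;> rcases hq with rfl | rfl | rfl <;>
      first
        | exact absurd rfl hpq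
        | exact .of_diamond hconn hcrit hy hG hK hab hac hbc hwp hwq hwc
        | exact .of_diamond hconn hcrit hy hG hK hab hac hbc hwq hwp hwc
        | exact .of_diamond hconn hcrit hy hG hK hac hab hbc.symm hwp hwq hwb
        | exact .of_diamond hconn hcrit hy hG hK hac hab hbc.symm hwq hwp hwb
        | exact .of_diamond hconn hcrit hy hG hK hbc hab.symm hac.symm hwp hwq hwa
        | exact .of_diamond hconn hcrit hy hG hK hbc hab.symm hac.symm hwq hwp hwa

end Triangle

section OddCycle

/-- Powers of the adjacency matrix of a complete graph. -/
theorem adjMatrix_top_pow (y k : ℕ) :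
    ∃ e o : ℤ, (⊤ : SimpleGraph (Fin (y + 1))).adjMatrix ℤ ^ k =
      e • 1 + o • (⊤ : SimpleGraph (Fin (y + 1))).adjMatrix ℤ ∧
      e + y * o = y ^ k ∧ e - o = (-1) ^ k := by
  set A := (⊤ : SimpleGraph (Fin (y + 1))).adjMatrix ℤ with hA
  have hsq : A * A = (y : ℤ) • 1 + (y - 1 : ℤ) • A := by
    have hJ : A = Matrix.of (fun _ _ => 1) - 1 := by
      ext i j
      by_cases h : i = j <;> simp [hA, h]
    have hJ2 : (Matrix.of (fun _ _ => 1) * Matrix.of (fun _ _ => 1) :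
        Matrix (Fin (y + 1)) (Fin (y + 1)) ℤ) = (y + 1 : ℤ) • Matrix.of (fun _ _ => 1) := by
      ext i j
      simp [Matrix.mul_apply]
    rw [hJ, sub_mul, mul_sub, hJ2, one_mul, mul_one]
    module
  induction k with
  | zero => exact ⟨1, 0, by simp, by simp, by simp⟩
  | succ k ih =>
    obtain ⟨e, o, h1, h2, h3⟩ := ih
    refine ⟨y * o, e + (y - 1) * o, ?_, ?_, ?_⟩
    · rw [pow_succ, h1, add_mul, smul_mul_assoc, smul_mul_assoc, one_mul, hsq]
      module
    · rw [pow_succ, ← h2]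
      ring
    · rw [pow_succ, ← h3]
      ring

/-- A complete graph on `y + 1` vertices has at most `y ^ k` closed walks of odd length `k`. -/
theorem card_closed_walks_top_le (y : ℕ) {k : ℕ} (hk : Odd k) :
    ∑ a : Fin (y + 1), ((⊤ : SimpleGraph (Fin (y + 1))).finsetWalkLength k a a).card ≤ y ^ k := by
  obtain ⟨e, o, h1, h2, h3⟩ := adjMatrix_top_pow y k
  have h : ∀ a : Fin (y + 1),
      (((⊤ : SimpleGraph (Fin (y + 1))).finsetWalkLength k a a).card : ℤ) = e := by
    intro a
    rw [← SimpleGraph.card_set_walk_length_eq]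
    have := SimpleGraph.adjMatrix_pow_apply_eq_card_walk
      (G := (⊤ : SimpleGraph (Fin (y + 1)))) (α := ℤ) k a a
    rw [h1, Matrix.add_apply, Matrix.smul_apply, Matrix.smul_apply, Matrix.one_apply_eq] at this
    simpa using this.symm
  have h4 : ((∑ a : Fin (y + 1),
      ((⊤ : SimpleGraph (Fin (y + 1))).finsetWalkLength k a a).card : ℕ) : ℤ) ≤ (y ^ k : ℕ) := by
    push_cast
    rw [Finset.sum_congr rfl fun a _ => h a]
    rw [hk.neg_one_pow] at h3
    simp only [Finset.sum_const, Finset.card_univ, Fintype.card_fin, nsmul_eq_mul]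
    push_cast
    nlinarith
  exact_mod_cast h4

variable {V : Type*} {G : SimpleGraph V}

section Entropy

variable [Fintype V] [DecidableEq V] {y : ℕ}

/-- A closed walk of odd length without repeated vertices saves `saveCycle`. -/
theorem entropyDeficit_support (hy : 3 ≤ y) {u : V} (w : G.Walk u u) (hodd : Odd w.length)
    (hcard : w.support.toFinset.card = w.length) :
    EntropyDeficit G y w.support.toFinset (saveCycle y) := by
  classical
  have hbound : ∀ f ∈ properColorings G (y + 1),
      (((agreeOn (properColorings G (y + 1)) ∅ f).image
        (fun g => w.support.map g)).card : ℝ) ≤ (y : ℝ) ^ w.length := by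
    intro f hf
    have hsub : (agreeOn (properColorings G (y + 1)) ∅ f).image (fun g => w.support.map g) ⊆
        Finset.univ.biUnion fun a : Fin (y + 1) =>
          ((⊤ : SimpleGraph (Fin (y + 1))).finsetWalkLength w.length a a).image
            fun p => p.support := by
      intro l hl
      obtain ⟨g, hg, rfl⟩ := Finset.mem_image.1 hl
      have hg' := mem_properColorings.1 (mem_agreeOn.1 hg).1
      let φ : G →g (⊤ : SimpleGraph (Fin (y + 1))) := ⟨g, fun {a b} hab => hg' a b hab⟩
      refine Finset.mem_biUnion.2 ⟨g u, Finset.mem_univ _, Finset.mem_image.2 ⟨w.map φ, ?_, ?_⟩⟩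
      · exact SimpleGraph.mem_finsetWalkLength_iff.2 (w.length_map φ)
      · exact w.support_map φ
    have := (Finset.card_le_card hsub).trans (Finset.card_biUnion_le.trans
      ((Finset.sum_le_sum fun a _ => Finset.card_image_le).trans
        (card_closed_walks_top_le y hodd)))
    exact_mod_cast this
  have h := totalEntropy_le_add (properColorings G (y + 1)) (S := ∅) (S' := w.support.toFinset)
    (fun g => w.support.map g) (fun _ => (y : ℝ) ^ w.length)
    (fun f _ g _ hfg v hv => List.map_inj_left.1 hfg v (List.mem_toFinset.1 hv)) hbound
    (fun _ _ _ _ => rfl)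
  rw [totalEntropy_empty, zero_add, Finset.sum_const, nsmul_eq_mul, Real.log_pow] at h
  have hy0 : (0 : ℝ) < y := by exact_mod_cast (by omega : 0 < y)
  refine h.trans (le_of_eq ?_)
  rw [hcard, saveCycle, Real.log_div (by positivity) hy0.ne']
  ring

end Entropy

/-- A closed walk of odd length that is as short as possible. -/
def IsShortestOdd (G : SimpleGraph V) {u : V} (w : G.Walk u u) : Prop :=
  Odd w.length ∧ ∀ (v : V) (w' : G.Walk v v), Odd w'.length → w.length ≤ w'.length

theorem exists_isShortestOdd (h : ¬ G.Colorable 2) : ∃ (u : V) (w : G.Walk u u),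
    IsShortestOdd G w := by
  classical
  rw [SimpleGraph.two_colorable_iff_forall_loop_even] at h
  push Not at h
  obtain ⟨u, w, hw⟩ := h
  have hex : ∃ n, ∃ (u : V) (w : G.Walk u u), Odd w.length ∧ w.length = n :=
    ⟨_, u, w, by simpa using hw, rfl⟩
  obtain ⟨v, w', hodd, hlen⟩ := Nat.find_spec hex
  exact ⟨v, w', hodd, fun v' w'' h' => hlen ▸ Nat.find_min' hex ⟨v', w'', h', rfl⟩⟩

theorem SimpleGraph.Walk.exists_walk_getVert {u v : V} (w : G.Walk u v) {i j : ℕ} (hij : i ≤ j)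
    (hj : j ≤ w.length) : ∃ p : G.Walk (w.getVert i) (w.getVert j), p.length = j - i := by
  induction j, hij using Nat.le_induction with
  | base => exact ⟨.nil, by simp⟩
  | succ j hij ih =>
    obtain ⟨p, hp⟩ := ih (by omega)
    exact ⟨p.concat (w.adj_getVert_succ (by omega)), by rw [SimpleGraph.Walk.length_concat]; omega⟩

namespace IsShortestOdd

variable {u : V} {w : G.Walk u u} {i j : ℕ}

theorem le_or_le (hw : IsShortestOdd G w) (hij : i ≤ j) (hj : j ≤ w.length)
    (q : G.Walk (w.getVert i) (w.getVert j)) :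
    Odd (j - i + q.length) ∧ w.length ≤ j - i + q.length ∨
      Even (j - i + q.length) ∧ j - i ≤ q.length := by
  rcases Nat.even_or_odd (j - i + q.length) with h | h
  · right
    refine ⟨h, ?_⟩
    obtain ⟨p₁, h₁⟩ := w.exists_walk_getVert (Nat.zero_le i) (hij.trans hj)
    obtain ⟨p₂, h₂⟩ := w.exists_walk_getVert hj le_rfl
    have hend : w.getVert w.length = w.getVert 0 := by simp
    have hodd := hw.1
    have := hw.2 _ ((p₁.append (q.append p₂)).copy rfl hend) (by
      simp only [SimpleGraph.Walk.length_copy, SimpleGraph.Walk.length_append, h₁, h₂]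
      grind)
    simp only [SimpleGraph.Walk.length_copy, SimpleGraph.Walk.length_append, h₁, h₂] at this
    omega
  · left
    refine ⟨h, ?_⟩
    obtain ⟨p, hp⟩ := w.exists_walk_getVert hij hj
    have := hw.2 _ (p.append q.reverse) (by simpa [hp] using h)
    simpa [hp] using this

theorem getVert_inj (hw : IsShortestOdd G w) (hi : i < w.length) (hj : j < w.length)
    (h : w.getVert i = w.getVert j) : i = j := by
  wlog hij : i ≤ j generalizing i j
  · exact (this hj hi h.symm (by omega)).symm
  have := hw.le_or_le hij hj.le (SimpleGraph.Walk.nil.copy rfl h)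
  simp only [SimpleGraph.Walk.length_copy, SimpleGraph.Walk.length_nil] at this
  omega

theorem eq_of_adj (hw : IsShortestOdd G w) (hij : i < j) (hj : j < w.length)
    (h : G.Adj (w.getVert i) (w.getVert j)) : j = i + 1 ∨ i = 0 ∧ j + 1 = w.length := by
  have := hw.le_or_le hij.le hj.le h.toWalk
  rw [SimpleGraph.Walk.length_cons, SimpleGraph.Walk.length_nil] at this
  omega

theorem eq_of_common_adj (hw : IsShortestOdd G w) (hlen : 5 ≤ w.length) (hij : i < j)
    (hj : j < w.length) {r : V} (hri : G.Adj r (w.getVert i)) (hrj : G.Adj r (w.getVert j)) :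
    j = i + 2 ∨ j + 2 = i + w.length := by
  have := hw.le_or_le hij.le hj.le (.cons hri.symm hrj.toWalk)
  have hodd := hw.1
  simp only [SimpleGraph.Walk.length_cons, SimpleGraph.Walk.length_nil, Nat.odd_iff,
    Nat.even_iff] at this hodd
  omega

theorem five_le_length (hw : IsShortestOdd G w) (hT : ¬ HasTriangle G) : 5 ≤ w.length := by
  obtain ⟨k, hk⟩ := hw.1
  have hadj := fun i => w.adj_getVert_succ (i := i)
  have hend : w.getVert w.length = w.getVert 0 := by simp
  by_contra! hlt
  obtain rfl | rfl : k = 0 ∨ k = 1 := by omega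
  · have := hadj 0 (by omega)
    rw [hk] at hend
    exact this.ne hend.symm
  · have h0 := hadj 0 (by omega)
    have h1 := hadj 1 (by omega)
    have h2 := hadj 2 (by omega)
    rw [hk] at hend
    norm_num at h0 h1 h2 hend
    rw [hend] at h2
    exact hT ⟨_, _, _, h0, by simpa using h2.symm, h1⟩

theorem mem_support_iff (hw : IsShortestOdd G w) {v : V} :
    v ∈ w.support ↔ ∃ i < w.length, w.getVert i = v := by
  rw [SimpleGraph.Walk.mem_support_iff_exists_getVert]
  constructor
  · rintro ⟨i, rfl, hi⟩
    obtain hi | rfl := hi.lt_or_eq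
    · exact ⟨i, hi, rfl⟩
    · exact ⟨0, hw.1.pos, by simp⟩
  · rintro ⟨i, hi, rfl⟩
    exact ⟨i, rfl, hi.le⟩

variable [DecidableEq V]

theorem card_support (hw : IsShortestOdd G w) : w.support.toFinset.card = w.length := by
  have : w.support.toFinset = (Finset.range w.length).image w.getVert := by
    ext v
    simp [hw.mem_support_iff]
  rw [this, Finset.card_image_of_injOn, Finset.card_range]
  intro i hi j hj h
  exact hw.getVert_inj (by simpa using hi) (by simpa using hj) h

open Classical in
theorem card_common_le (hw : IsShortestOdd G w) (hlen : 5 ≤ w.length) (r : V) :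
    (w.support.toFinset.filter (G.Adj r)).card ≤ 2 := by
  by_contra! h
  obtain ⟨a, b, c, ha, hb, hc, hab, hac, hbc⟩ := Finset.two_lt_card_iff.1 h
  simp only [Finset.mem_filter, List.mem_toFinset, hw.mem_support_iff] at ha hb hc
  obtain ⟨⟨i, hi, rfl⟩, hia⟩ := ha
  obtain ⟨⟨j, hj, rfl⟩, hjb⟩ := hb
  obtain ⟨⟨k, hk, rfl⟩, hkc⟩ := hc
  have key : ∀ {m n}, m < w.length → n < w.length → w.getVert m ≠ w.getVert n →
      G.Adj r (w.getVert m) → G.Adj r (w.getVert n) →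
      n = m + 2 ∨ n + 2 = m + w.length ∨ m = n + 2 ∨ m + 2 = n + w.length := by
    intro m n hm hn hmn h1 h2
    rcases lt_trichotomy m n with h | h | h
    · have := hw.eq_of_common_adj hlen h hn h1 h2
      omega
    · exact absurd (congrArg _ h) hmn
    · have := hw.eq_of_common_adj hlen h hm h2 h1
      omega
  have h1 := key hi hj hab hia hjb
  have h2 := key hi hk hac hia hkc
  have h3 := key hj hk hbc hjb hkc
  have hodd := hw.1
  rw [Nat.odd_iff] at hodd
  omega

theorem exists_adj_notMem [Fintype V] (hw : IsShortestOdd G w) (hcrit : FourVertexCritical G)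
    {v : V} (hv : v ∈ w.support.toFinset) : ∃ r ∉ w.support.toFinset, G.Adj v r := by
  obtain ⟨a, b, c, hab, hac, hbc, ha, hb, hc⟩ := hcrit.exists_three_neighbors v
  by_contra! h
  have hmem : ∀ t, G.Adj v t → ∃ i < w.length, w.getVert i = t := fun t ht => by
    by_contra hn
    exact h t (by rwa [List.mem_toFinset, hw.mem_support_iff]) ht
  obtain ⟨l, hl, rfl⟩ := hw.mem_support_iff.1 (List.mem_toFinset.1 hv)
  obtain ⟨i, hi, rfl⟩ := hmem a ha
  obtain ⟨j, hj, rfl⟩ := hmem b hb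
  obtain ⟨k, hk, rfl⟩ := hmem c hc
  have key : ∀ {m}, m < w.length → G.Adj (w.getVert l) (w.getVert m) →
      m = l + 1 ∨ l = m + 1 ∨ l = 0 ∧ m + 1 = w.length ∨ m = 0 ∧ l + 1 = w.length := by
    intro m hm h1
    rcases lt_trichotomy l m with h | h | h
    · have := hw.eq_of_adj h hm h1
      omega
    · exact absurd (congrArg _ h) h1.ne
    · have := hw.eq_of_adj h hl h1.symm
      omega
  have h1 := key hi ha
  have h2 := key hj hb
  have h3 := key hk hc
  have hij : i ≠ j := fun h => hab (h ▸ rfl)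
  have hik : i ≠ k := fun h => hac (h ▸ rfl)
  have hjk : j ≠ k := fun h => hbc (h ▸ rfl)
  omega

end IsShortestOdd

end OddCycle

section TriangleFree

variable {V : Type*} {G : SimpleGraph V} [Fintype V]

theorem FourVertexCritical.false_of_three_independent (hcrit : FourVertexCritical G)
    (A B C : Set V) (hA : ∀ a ∈ A, ∀ b ∈ A, ¬ G.Adj a b) (hB : ∀ a ∈ B, ∀ b ∈ B, ¬ G.Adj a b)
    (hC : ∀ a ∈ C, ∀ b ∈ C, ¬ G.Adj a b) (hcover : ∀ v, v ∈ A ∨ v ∈ B ∨ v ∈ C) : False := by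
  classical
  refine hcrit.not_properOn (fun v => if v ∈ A then 0 else if v ∈ B then 1 else 2) ?_
  intro a _ b _ hab h
  have h1 := hA a
  have h2 := hB a
  have h3 := hC a
  have := hcover a
  have := hcover b
  by_cases ha : a ∈ A <;> by_cases hb : b ∈ A <;> by_cases ha' : a ∈ B <;>
    by_cases hb' : b ∈ B <;> simp_all

theorem FourVertexCritical.false_of_five_cycle_add_three (hcrit : FourVertexCritical G)
    (hT : ¬ HasTriangle G) {u p₁ p₂ p₃ p₄ r₁ r₂ r₃ : V} (h₁ : G.Adj u p₁) (h₂ : G.Adj p₁ p₂)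
    (h₃ : G.Adj p₂ p₃) (h₄ : G.Adj p₃ p₄) (h₅ : G.Adj p₄ u) (hr : ¬ G.Adj r₁ r₃)
    (hur₁ : ¬ G.Adj u r₁) (hur₃ : ¬ G.Adj u r₃) (hur₂ : G.Adj u r₂)
    (hcover : ∀ v, v ∈ ({u, p₁, p₂, p₃, p₄, r₁, r₂, r₃} : Set V)) : False := by
  have hT' : ∀ a b c, G.Adj a b → G.Adj a c → ¬ G.Adj b c :=
    fun a b c hab hac hbc => hT ⟨a, b, c, hab, hac, hbc⟩
  have h₁₃ := hT' _ _ _ h₂.symm h₃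
  have h₂₄ := hT' _ _ _ h₃.symm h₄
  have h1 := hT' _ _ _ h₁ hur₂
  have h4 := hT' _ _ _ h₅.symm hur₂
  simp only [Set.mem_insert_iff, Set.mem_singleton_iff] at hcover
  by_cases h3 : G.Adj p₃ r₂
  · have h2 := hT' _ _ _ h₃.symm h3
    refine hcrit.false_of_three_independent {u, r₁, r₃} {p₁, p₃} {p₂, p₄, r₂} ?_ ?_ ?_
      (fun v => by have := hcover v; simp only [Set.mem_insert_iff, Set.mem_singleton_iff]; tauto)
    all_goals simp [G.adj_comm, *]
  · refine hcrit.false_of_three_independent {u, r₁, r₃} {p₁, p₃, r₂} {p₂, p₄} ?_ ?_ ?_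
      (fun v => by have := hcover v; simp only [Set.mem_insert_iff, Set.mem_singleton_iff]; tauto)
    all_goals simp [G.adj_comm, *]

variable [DecidableEq V] {u : V} {w : G.Walk u u} {r₁ r₂ r₃ : V}

theorem IsShortestOdd.false_of_cover_of_not_adj (hw : IsShortestOdd G w)
    (hcrit : FourVertexCritical G) (hT : ¬ HasTriangle G) (hlen : w.length = 5)
    (hr : ¬ G.Adj r₁ r₃) (hcover : ∀ v, v ∈ w.support.toFinset ∨ v = r₁ ∨ v = r₂ ∨ v = r₃) :
    False := by
  classical
  obtain ⟨v, hv, hv₁, hv₃⟩ : ∃ v ∈ w.support.toFinset, ¬ G.Adj r₁ v ∧ ¬ G.Adj r₃ v := by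
    by_contra! h
    have hsub : w.support.toFinset ⊆ w.support.toFinset.filter (G.Adj r₁) ∪
        w.support.toFinset.filter (G.Adj r₃) := by
      intro v hv
      by_cases h1 : G.Adj r₁ v
      · simp only [Finset.mem_union, Finset.mem_filter]
        exact Or.inl ⟨hv, h1⟩
      · simp only [Finset.mem_union, Finset.mem_filter]
        exact Or.inr ⟨hv, h v hv h1⟩
    have := (Finset.card_le_card hsub).trans (Finset.card_union_le _ _)
    have := hw.card_common_le hlen.ge r₁
    have := hw.card_common_le hlen.ge r₃
    have := hw.card_support
    omega
  obtain ⟨r, hr', hvr⟩ := hw.exists_adj_notMem hcrit hv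
  have hv₁' : ¬ G.Adj v r₁ := fun h => hv₁ h.symm
  have hv₃' : ¬ G.Adj v r₃ := fun h => hv₃ h.symm
  have hvr₂ : G.Adj v r₂ := by
    rcases hcover r with h | rfl | rfl | rfl
    · exact absurd h hr'
    · exact absurd hvr hv₁'
    · exact hvr
    · exact absurd hvr hv₃'
  have hend : w.getVert 5 = w.getVert 0 := by rw [← hlen]; simp
  have h0 := w.adj_getVert_succ (i := 0) (by omega)
  have h1 := w.adj_getVert_succ (i := 1) (by omega)
  have h2 := w.adj_getVert_succ (i := 2) (by omega)
  have h3 := w.adj_getVert_succ (i := 3) (by omega)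
  have h4 := w.adj_getVert_succ (i := 4) (by omega)
  rw [hend] at h4
  have hcover' : ∀ v, v = w.getVert 0 ∨ v = w.getVert 1 ∨ v = w.getVert 2 ∨ v = w.getVert 3 ∨
      v = w.getVert 4 ∨ v = r₁ ∨ v = r₂ ∨ v = r₃ := by
    intro v
    rcases hcover v with h | h
    · obtain ⟨i, hi, rfl⟩ := hw.mem_support_iff.1 (List.mem_toFinset.1 h)
      rw [hlen] at hi
      interval_cases i <;> simp
    · tauto
  obtain ⟨i, hi, rfl⟩ := hw.mem_support_iff.1 (List.mem_toFinset.1 hv)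
  rw [hlen] at hi
  interval_cases i
  · exact hcrit.false_of_five_cycle_add_three hT h0 h1 h2 h3 h4 hr hv₁' hv₃' hvr₂
      fun v => by have := hcover' v; simp only [Set.mem_insert_iff, Set.mem_singleton_iff]; tauto
  · exact hcrit.false_of_five_cycle_add_three hT h1 h2 h3 h4 h0 hr hv₁' hv₃' hvr₂
      fun v => by have := hcover' v; simp only [Set.mem_insert_iff, Set.mem_singleton_iff]; tauto
  · exact hcrit.false_of_five_cycle_add_three hT h2 h3 h4 h0 h1 hr hv₁' hv₃' hvr₂
      fun v => by have := hcover' v; simp only [Set.mem_insert_iff, Set.mem_singleton_iff]; tauto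
  · exact hcrit.false_of_five_cycle_add_three hT h3 h4 h0 h1 h2 hr hv₁' hv₃' hvr₂
      fun v => by have := hcover' v; simp only [Set.mem_insert_iff, Set.mem_singleton_iff]; tauto
  · exact hcrit.false_of_five_cycle_add_three hT h4 h0 h1 h2 h3 hr hv₁' hv₃' hvr₂
      fun v => by have := hcover' v; simp only [Set.mem_insert_iff, Set.mem_singleton_iff]; tauto

theorem IsShortestOdd.false_of_cover (hw : IsShortestOdd G w) (hcrit : FourVertexCritical G)
    (hT : ¬ HasTriangle G)
    (hcover : ∀ v, v ∈ w.support.toFinset ∨ v = r₁ ∨ v = r₂ ∨ v = r₃) : False := by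
  classical
  have h5 := hw.five_le_length hT
  have hlen : w.length = 5 := by
    have hsub : w.support.toFinset ⊆ w.support.toFinset.filter (G.Adj r₁) ∪
        (w.support.toFinset.filter (G.Adj r₂) ∪ w.support.toFinset.filter (G.Adj r₃)) := by
      intro v hv
      obtain ⟨r, hr, hvr⟩ := hw.exists_adj_notMem hcrit hv
      simp only [Finset.mem_union, Finset.mem_filter]
      rcases hcover r with h | rfl | rfl | rfl
      · exact absurd h hr
      · exact Or.inl ⟨hv, hvr.symm⟩
      · exact Or.inr (Or.inl ⟨hv, hvr.symm⟩)
      · exact Or.inr (Or.inr ⟨hv, hvr.symm⟩)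
    have h1 := Finset.card_le_card hsub
    grw [Finset.card_union_le, Finset.card_union_le, hw.card_support, hw.card_common_le h5,
      hw.card_common_le h5, hw.card_common_le h5] at h1
    have hodd := Nat.odd_iff.1 hw.1
    omega
  by_cases h13 : G.Adj r₁ r₃
  · by_cases h12 : G.Adj r₁ r₂
    · exact hw.false_of_cover_of_not_adj hcrit hT hlen (r₁ := r₂) (r₂ := r₁) (r₃ := r₃)
        (fun h => hT ⟨_, _, _, h12, h13, h⟩) fun v => by have := hcover v; tauto
    · exact hw.false_of_cover_of_not_adj hcrit hT hlen (r₂ := r₃) h12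
        fun v => by have := hcover v; tauto
  · exact hw.false_of_cover_of_not_adj hcrit hT hlen h13 hcover

theorem EntropyDeficit.of_not_hasTriangle {y : ℕ} (hconn : G.Connected)
    (hcrit : FourVertexCritical G) (hy : 3 ≤ y) (hG : RarelyEqual G y) (hT : ¬ HasTriangle G) :
    EntropyDeficit G y Finset.univ (saveOne y + saveTwo y) := by
  have hnot : ¬ G.Colorable 2 := fun h => by
    obtain ⟨c⟩ := h.mono (show 2 ≤ 3 by norm_num)
    exact hcrit.not_properOn c fun _ _ _ _ h => c.valid h
  obtain ⟨u, w, hw⟩ := exists_isShortestOdd hnot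
  refine EntropyDeficit.mono ?_ (saveOne_add_saveTwo_le hy)
  have hne : w.support.toFinset.Nonempty := ⟨u, by simp⟩
  have hC := entropyDeficit_support hy w hw.1 hw.card_support
  have hCX := fun r₁ r₂ r₃ => hw.false_of_cover (r₁ := r₁) (r₂ := r₂) (r₃ := r₃) hcrit hT
  set C := w.support.toFinset
  have hext : ∀ {S : Finset V}, ¬ AttachedOnce G S → ∃ x ∉ S, ∀ d, EntropyDeficit G y S d →
      EntropyDeficit G y (insert x S) (d + savePair y) := by
    intro S hS
    unfold AttachedOnce at hS
    push Not at hS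
    obtain ⟨x, hx, p, hp, q, hq, hxp, hxq, hpq⟩ := hS
    exact ⟨x, hx, fun d h => h.insert_of_adj_two hy hG hx hp hq hxp hxq hpq⟩
  have hcover : ∀ {S : Finset V}, S = Finset.univ → ∀ v, v ∈ S := fun h v => h ▸ Finset.mem_univ v
  have hu₀ : C ≠ Finset.univ := fun hu => hCX u u u fun v => Or.inl (hcover hu v)
  by_cases hS₀ : AttachedOnce G C
  · rcases hC.three_pairs hconn hcrit hy hG (fun _ => True) (fun _ _ _ _ _ => trivial)
      (fun _ _ _ _ _ _ _ _ _ h₁ h₂ h₃ _ => hT ⟨_, _, _, h₁, h₂, h₃⟩) hne hu₀ hS₀ trivial with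
      h | ⟨h, -⟩
    · exact h
    · exact absurd h hT
  obtain ⟨x, -, hx⟩ := hext hS₀
  have hu₁ : insert x C ≠ Finset.univ := fun hu => hCX x x x fun v => by
    have := hcover hu v
    rw [Finset.mem_insert] at this
    tauto
  by_cases hS₁ : AttachedOnce G (insert x C)
  · rcases (hx _ hC).two_pairs hconn hcrit hy hG (Finset.insert_nonempty _ _) hu₁ hS₁ with
      h | ⟨h, -⟩
    · exact h.mono (by linarith)
    · exact absurd h hT
  obtain ⟨z, -, hz⟩ := hext hS₁
  have hu₂ : insert z (insert x C) ≠ Finset.univ := fun hu => hCX x z z fun v => by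
    have := hcover hu v
    rw [Finset.mem_insert, Finset.mem_insert] at this
    tauto
  by_cases hS₂ : AttachedOnce G (insert z (insert x C))
  · obtain ⟨Q, a, b, -, -, -, -, -, -, -, hu, h⟩ := (hz _ (hx _ hC)).exists_close hconn hcrit hy hG
      (fun _ => True) (fun _ _ _ _ _ => trivial) (Finset.insert_nonempty _ _) hu₂ hS₂ trivial
    exact (h.grow hconn hcrit hy hG (Finset.insert_nonempty _ _) hu).mono (by linarith)
  obtain ⟨t, -, ht⟩ := hext hS₂
  have hu₃ : insert t (insert z (insert x C)) ≠ Finset.univ := fun hu => hCX x z t fun v => by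
    have := hcover hu v
    rw [Finset.mem_insert, Finset.mem_insert, Finset.mem_insert] at this
    tauto
  exact ((ht _ (hz _ (hx _ hC))).grow hconn hcrit hy hG (Finset.insert_nonempty _ _) hu₃).mono
    (by linarith)

end TriangleFree

section Tomescu

/-- Tomescu's bound for the number of colourings with `y + 1` colours of a connected graph on `n`
vertices that is not `3`-colourable. -/
def tomescuBound (n y : ℕ) : ℕ := (y + 1) * y ^ (n - 3) * (y - 1) * (y - 2)

theorem tomescuBound_pos {n y : ℕ} (hy : 3 ≤ y) : 0 < tomescuBound n y := by
  have h1 : 0 < y := by omega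
  have h2 : 0 < y - 1 := by omega
  have h3 : 0 < y - 2 := by omega
  unfold tomescuBound
  positivity

theorem mul_tomescuBound {n y : ℕ} (hn : 3 ≤ n) :
    y * tomescuBound n y = tomescuBound (n + 1) y := by
  unfold tomescuBound
  rw [show n + 1 - 3 = n - 3 + 1 by omega, pow_succ]
  ring

theorem log_tomescuBound {n y : ℕ} (hn : 3 ≤ n) (hy : 3 ≤ y) :
    Real.log (tomescuBound n y) =
      Real.log (y + 1) + (n - 1) * Real.log y - (saveOne y + saveTwo y) := by
  have h : (3 : ℝ) ≤ y := by exact_mod_cast hy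
  unfold tomescuBound
  push_cast [Nat.cast_sub (show 1 ≤ y by omega), Nat.cast_sub (show 2 ≤ y by omega)]
  rw [Real.log_mul (mul_ne_zero (by positivity) (by linarith)) (by linarith),
    Real.log_mul (by positivity) (by linarith), Real.log_mul (by positivity) (by positivity),
    Real.log_pow, log_sub_one_eq hy, log_sub_two_eq hy, Nat.cast_sub hn]
  push_cast
  ring

variable {V W : Type*} {G : SimpleGraph V} {H : SimpleGraph W} {y : ℕ}

theorem four_le_card [Fintype V] (h : ¬ G.Colorable 3) : 4 ≤ Fintype.card V := by
  by_contra! hlt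
  exact h (G.colorable_of_fintype.mono (by omega))

/-- A connected graph that is not four-vertex-critical has a proper connected induced subgraph
that needs four colours. -/
theorem exists_connected_induce [Fintype V] (hcol : ¬ G.Colorable 3)
    (hcrit : ¬ FourVertexCritical G) : ∃ T : Set V, T ≠ Set.univ ∧ (G.induce T).Connected ∧
      ¬ (G.induce T).Colorable 3 := by
  classical
  have hnot : ∀ c : V → Fin 3, ¬ ProperOn G Finset.univ c := fun c hc =>
    hcol ⟨SimpleGraph.Coloring.mk c fun h => hc _ (Finset.mem_univ _) _ (Finset.mem_univ _) h⟩
  obtain ⟨S, hS, hSc⟩ : ∃ S : Finset V, S ≠ Finset.univ ∧ ∀ c : V → Fin 3, ¬ ProperOn G S c := by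
    by_contra! h
    exact hcrit ⟨h, hnot⟩
  have hind : ¬ (G.induce (S : Set V)).Colorable 3 := by
    rintro ⟨c⟩
    refine hSc (fun v => if h : v ∈ S then c ⟨v, h⟩ else 0) fun u hu v hv huv => ?_
    simp only [hu, hv, dif_pos]
    exact c.valid huv
  rw [SimpleGraph.colorable_iff_forall_connectedComponent] at hind
  push Not at hind
  obtain ⟨K, hK⟩ := hind
  refine ⟨(↑) '' K.supp, fun h => hS ?_, ?_, ?_⟩
  · refine Finset.eq_univ_iff_forall.2 fun v => ?_
    obtain ⟨x, -, rfl⟩ : v ∈ ((↑) '' K.supp : Set V) := h ▸ Set.mem_univ v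
    exact x.2
  · refine K.connected_toSimpleGraph.map (⟨fun x => ⟨x.1, x.1, x.2, rfl⟩, id⟩ :
      K.toSimpleGraph →g G.induce ((↑) '' K.supp)) ?_
    rintro ⟨-, x, hx, rfl⟩
    exact ⟨⟨x, hx⟩, rfl⟩
  · rintro ⟨c⟩
    exact hK ⟨c.comp (⟨fun x => ⟨x.1, x.1, x.2, rfl⟩, id⟩ :
      K.toSimpleGraph →g G.induce ((↑) '' K.supp))⟩

/-- A bound for the colourings of an induced subgraph gives an entropy deficit. -/
theorem entropyDeficit_of_induce [Fintype V] [DecidableEq V] (hy : 3 ≤ y) {T : Finset V}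
    (hT : 3 ≤ T.card)
    (h : (properColorings (G.induce (T : Set V)) (y + 1)).card ≤ tomescuBound T.card y) :
    EntropyDeficit G y T (saveOne y + saveTwo y) := by
  classical
  have key := totalEntropy_le_add (properColorings G (y + 1)) (S := ∅) (S' := T)
    (fun g (v : (T : Set V)) => g v) (fun _ => (tomescuBound T.card y : ℝ))
    (fun f _ g _ hfg v hv => congrFun hfg ⟨v, hv⟩) (fun f hf => ?_) (fun _ _ _ _ => rfl)
  · rwa [totalEntropy_empty, zero_add, Finset.sum_const, nsmul_eq_mul,
      log_tomescuBound hT hy] at key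
  · refine mod_cast (Finset.card_le_card fun g hg => ?_).trans h
    obtain ⟨g', hg', rfl⟩ := Finset.mem_image.1 hg
    exact mem_properColorings.2 fun u v huv =>
      mem_properColorings.1 (mem_agreeOn.1 hg').1 _ _ huv

theorem EntropyDeficit.card_le [Fintype V] (hy : 3 ≤ y) (hV : 3 ≤ Fintype.card V)
    (h : EntropyDeficit G y Finset.univ (saveOne y + saveTwo y)) :
    (properColorings G (y + 1)).card ≤ tomescuBound (Fintype.card V) y := by
  rcases Nat.eq_zero_or_pos (properColorings G (y + 1)).card with h0 | h0
  · rw [h0]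
    exact Nat.zero_le _
  have hpos : (0 : ℝ) < (properColorings G (y + 1)).card := by exact_mod_cast h0
  unfold EntropyDeficit at h
  rw [totalEntropy_univ, Finset.card_univ, ← log_tomescuBound hV hy] at h
  have := le_of_mul_le_mul_left h hpos
  rw [Real.log_le_log_iff hpos (by exact_mod_cast tomescuBound_pos hy)] at this
  exact_mod_cast this

/-- A complete subgraph on four vertices saves `saveOne` and `saveTwo`. -/
theorem EntropyDeficit.of_fourClique [Fintype V] (hconn : G.Connected) (hy : 3 ≤ y)
    (hK : ¬ NoFourClique G) : EntropyDeficit G y Finset.univ (saveOne y + saveTwo y) := by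
  classical
  unfold NoFourClique at hK
  push Not at hK
  obtain ⟨a, b, c, d, hab, hac, had, hbc, hbd, hcd⟩ := hK
  have h1 : EntropyDeficit G y {c, d} 0 :=
    (entropyDeficit_singleton d).insert_of_adj (by simpa using hcd.ne) (by simp) hcd
  have h2 : EntropyDeficit G y {b, c, d} (0 + saveOne y) :=
    h1.insert_of_adj_edge hy (by simp [hbc.ne, hbd.ne]) (by simp) (by simp) hbc hbd hcd
  have h3 : EntropyDeficit G y {a, b, c, d} (0 + saveOne y + saveTwo y) :=
    h2.insert_of_adj_triangle hy (by simp [hab.ne, hac.ne, had.ne]) (by simp) (by simp) (by simp)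
      hab hac had hbc hbd hcd
  rw [zero_add] at h3
  exact h3.grow_univ hconn (Finset.insert_nonempty _ _)

/-- The graph obtained from `G` by identifying `b` with `a`. -/
def identify [DecidableEq V] (G : SimpleGraph V) {a b : V} (hab : a ≠ b) :
    SimpleGraph {v // v ≠ b} :=
  SimpleGraph.fromRel fun u v => ∃ x x', G.Adj x x' ∧
    (if h : x = b then ⟨a, hab⟩ else ⟨x, h⟩ : {v // v ≠ b}) = u ∧
    (if h : x' = b then ⟨a, hab⟩ else ⟨x', h⟩ : {v // v ≠ b}) = v

/-- The quotient map onto the graph with `b` identified with `a`. -/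
def identifyHom [DecidableEq V] (G : SimpleGraph V) {a b : V} (hab : a ≠ b) (hadj : ¬ G.Adj a b) :
    G →g identify G hab where
  toFun x := if h : x = b then ⟨a, hab⟩ else ⟨x, h⟩
  map_rel' {x x'} h := by
    refine (SimpleGraph.fromRel_adj _ _ _).2 ⟨?_, Or.inl ⟨x, x', h, rfl, rfl⟩⟩
    have := h.ne
    have := h.symm
    by_cases h1 : x = b <;> by_cases h2 : x' = b <;> simp only [h1, h2, dif_pos, dif_neg,
      not_false_eq_true] <;> grind

theorem identifyHom_surjective [DecidableEq V] {a b : V} (hab : a ≠ b) (hadj : ¬ G.Adj a b) :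
    Function.Surjective (identifyHom G hab hadj) :=
  fun x => ⟨x, dif_neg x.2⟩

theorem equalCount_le_identify [Fintype V] [DecidableEq V] {a b : V} (hab : a ≠ b) (x : ℕ) :
    equalCount G x a b ≤ (properColorings (identify G hab) x).card := by
  have hval : ∀ {f : V → Fin x}, f a = f b → ∀ v : V,
      f (if h : v = b then ⟨a, hab⟩ else ⟨v, h⟩ : {v // v ≠ b}) = f v := by
    intro f hf v
    split_ifs with h
    · rw [hf, h]
    · rfl
  refine Finset.card_le_card_of_injOn (fun f v => f v) ?_ ?_
  · intro f hf
    obtain ⟨hf, hfab⟩ := Finset.mem_filter.1 hf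
    have hf' := mem_properColorings.1 hf
    refine mem_properColorings.2 fun u v huv => ?_
    rcases (SimpleGraph.fromRel_adj _ _ _).1 huv with
      ⟨-, ⟨s, t, hst, rfl, rfl⟩ | ⟨s, t, hst, rfl, rfl⟩⟩
    · simpa only [hval hfab] using hf' s t hst
    · simpa only [hval hfab] using hf' t s hst.symm
  · intro f hf g hg hfg
    have hfab := (Finset.mem_filter.1 hf).2
    have hgab := (Finset.mem_filter.1 hg).2
    ext1 v
    rw [← hval hfab v, ← hval hgab v]
    exact congrFun hfg _

theorem card_properColorings_le.{u} (hy : 3 ≤ y) (n : ℕ) : ∀ {V : Type u} [Fintype V]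
    (G : SimpleGraph V), G.Connected → ¬ G.Colorable 3 → Fintype.card V = n →
      (properColorings G (y + 1)).card ≤ tomescuBound n y := by
  induction n using Nat.strong_induction_on with
  | _ n ih =>
  intro V _ G hconn hcol hn
  classical
  have h4 := four_le_card hcol
  by_cases hcrit : FourVertexCritical G
  swap
  · obtain ⟨T, hT, hTconn, hTcol⟩ := exists_connected_induce hcol hcrit
    obtain ⟨T, rfl⟩ := T.toFinite.exists_finset_coe
    have hcard : Fintype.card (T : Set V) = T.card := by simp
    have hlt : T.card < Fintype.card V :=
      (Finset.card_lt_iff_ne_univ T).2 fun h => hT (by simp [h])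
    have hT4 := hcard ▸ four_le_card hTcol
    have := entropyDeficit_of_induce hy (by omega) (ih _ (hn ▸ hlt) _ hTconn hTcol hcard)
    exact hn ▸ (this.grow_univ hconn (Finset.card_pos.1 (by omega))).card_le hy (by omega)
  by_cases hK : NoFourClique G
  swap
  · exact hn ▸ (EntropyDeficit.of_fourClique hconn hy hK).card_le hy (by omega)
  by_contra! hlt
  have hG : RarelyEqual G y := by
    intro a b hab
    by_cases hadj : G.Adj a b
    · simp [equalCount_of_adj hadj]
    have hcard : Fintype.card {v // v ≠ b} = n - 1 := by
      rw [← hn]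
      simp
    have hcol' : ¬ (identify G hab).Colorable 3 := fun ⟨c⟩ =>
      hcol ⟨c.comp (identifyHom G hab hadj)⟩
    have h4' := four_le_card hcol'
    have hle := (equalCount_le_identify (G := G) hab (y + 1)).trans (ih (n - 1) (by omega) _
      (hconn.map _ (identifyHom_surjective hab hadj)) hcol' hcard)
    refine (Nat.mul_le_mul_left y hle).trans ?_
    rw [mul_tomescuBound (by omega), Nat.sub_add_cancel (by omega)]
    exact hlt.le
  have hD : EntropyDeficit G y Finset.univ (saveOne y + saveTwo y) := by
    by_cases hT : HasTriangle G
    · exact .of_hasTriangle hconn hcrit hy hG hK hT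
    · exact .of_not_hasTriangle hconn hcrit hy hG hT
  exact absurd (hn ▸ hD.card_le hy (by omega)) hlt.not_ge

theorem numColorings_eq_card {V : Type} [Fintype V] (G : SimpleGraph V) (x : ℕ) :
    numColorings G x = (properColorings G x).card := by
  classical
  rw [numColorings, Nat.card_eq_fintype_card]
  exact Fintype.card_of_subtype _ fun f => mem_properColorings

end Tomescu

/-- If `G` is a connected graph on `n` vertices with chromatic number exactly `4` and
`y ≥ 3` is an integer, then `Q_G(y) ≤ (y+1)·y^(n-3)·(y-1)·(y-2)`. -/
theorem tomescu_four_chromatic_bound {V : Type} [Fintype V] (G : SimpleGraph V)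
    (hconn : G.Connected) (hchrom : G.chromaticNumber = 4)
    (y : ℕ) (hy : 3 ≤ y) :
    numColorings G (y + 1) ≤
      (y + 1) * y ^ (Fintype.card V - 3) * (y - 1) * (y - 2) := by
  have hcol : ¬ G.Colorable 3 := by
    rw [← SimpleGraph.chromaticNumber_le_iff_colorable, hchrom]
    norm_num
  rw [numColorings_eq_card]
  exact card_properColorings_le hy _ G hconn hcol rfl
end
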